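/- Let n > 2, p > 1, and let Ω ⊂ ℝⁿ be open. Let f : Ω → ℝ be measurable with ‖f‖_{L(n,1)(Ω)} < ∞, and let u : Ω → ℝ be locally Lipschitz and a local minimizer of the p-Dirichlet functional w ↦ ∫ [|Dw|^p/p − f·w] dx. Then there is a constant c = c(n,p) such that for every ball B = B_r(x₀) with B ⋐ Ω one has ‖Du‖_{L^∞(B_{r/2}(x₀))} ≤ c·(⨍_B |Du|^p dx)^{1/p} + c·‖f‖_{L(n,1)(B)}^{1/(p−1)}. -/

import Mathlib

open MeasureTheory Metric Set
open scoped ENNReal NNReal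
noncomputable section

/-- `u` is locally Lipschitz on `s`: Lipschitz on every compact subset of `s`. -/
def LocLipOn {n : ℕ} {F : Type*} [PseudoMetricSpace F]
    (s : Set (EuclideanSpace ℝ (Fin n))) (u : EuclideanSpace ℝ (Fin n) → F) : Prop :=
  ∀ K : Set (EuclideanSpace ℝ (Fin n)), IsCompact K → K ⊆ s → ∃ C : ℝ≥0, LipschitzOnWith C u K

/-- The Lorentz `L(n,1)`-functional `‖f‖_{L(n,1)(Ω)} = ∫₀^∞ |{x ∈ Ω : |f(x)| > λ}|^{1/n} dλ`. -/
def lorentzNorm {n : ℕ} {F : Type*} [NormedAddCommGroup F]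
    (Ω : Set (EuclideanSpace ℝ (Fin n))) (f : EuclideanSpace ℝ (Fin n) → F) : ℝ≥0∞ :=
  ∫⁻ lam in Ioi (0:ℝ), (volume {x | x ∈ Ω ∧ lam < ‖f x‖}) ^ (1 / (n : ℝ))

/-- `u` is a local minimizer of `w ↦ ∫ [Fi(Dw) − f·w] dx` on `Ω` among locally Lipschitz
maps: for every open `B' ⋐ Ω` and every locally Lipschitz competitor `w` with `{w ≠ u}`
compactly contained in `B'`, the energy of `u` on `B'` does not exceed that of `w`. -/
def IsLocMinimizer {n : ℕ} (Ω : Set (EuclideanSpace ℝ (Fin n)))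
    (Fi : EuclideanSpace ℝ (Fin n) → ℝ) (f : EuclideanSpace ℝ (Fin n) → ℝ)
    (u : EuclideanSpace ℝ (Fin n) → ℝ) : Prop :=
  ∀ B' : Set (EuclideanSpace ℝ (Fin n)), IsOpen B' → IsCompact (closure B') →
    closure B' ⊆ Ω →
    ∀ w : EuclideanSpace ℝ (Fin n) → ℝ, LocLipOn Ω w →
      IsCompact (closure {x | w x ≠ u x}) → closure {x | w x ≠ u x} ⊆ B' →
      ∫ x in B', (Fi (gradient u x) - f x * u x) ≤ ∫ x in B', (Fi (gradient w x) - f x * w x)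

set_option linter.unusedSectionVars false

section HilbertSpace

open Filter Topology

variable {H : Type*} [NormedAddCommGroup H] [InnerProductSpace ℝ H]

/-- A Lipschitz, strongly monotone perturbation of the identity has a zero in the weak sense
on every complete subspace. -/
theorem exists_weak_zero_of_strongly_monotone [CompleteSpace H] (K : Submodule ℝ H)
    (hK : IsClosed (K : Set H)) (A : H → H) {L m : ℝ} (hm : 0 < m)
    (hL : ∀ x y, ‖A x - A y‖ ≤ L * ‖x - y‖)
    (hA : ∀ x y, m * ‖x - y‖ ^ 2 ≤ inner ℝ (A x - A y) (x - y)) :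
    ∃ g ∈ K, ∀ ψ ∈ K, inner ℝ (A g) ψ = 0 := by
  have : CompleteSpace K := hK.completeSpace_coe
  set L' : ℝ := max L (m + 1) with hL'
  have hL'pos : 0 < L' := lt_of_lt_of_le (by linarith) (le_max_right _ _)
  have hmL : m < L' := lt_of_lt_of_le (by linarith) (le_max_right _ _)
  have hL2 : ∀ x y, ‖A x - A y‖ ≤ L' * ‖x - y‖ := fun x y =>
    (hL x y).trans (mul_le_mul_of_nonneg_right (le_max_left _ _) (norm_nonneg _))
  set s : ℝ := m / L' ^ 2 with hs
  have hspos : 0 < s := by positivity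
  set q : ℝ := 1 - m ^ 2 / L' ^ 2 with hq
  have hq0 : 0 ≤ q := by
    rw [hq, sub_nonneg, div_le_one (by positivity)]
    exact pow_le_pow_left₀ hm.le hmL.le 2
  have hq1 : q < 1 := by
    rw [hq]; have : 0 < m ^ 2 / L' ^ 2 := by positivity
    linarith
  let Φ : K → K := fun g => g - s • K.orthogonalProjectionOnto (A g)
  have hΦ : ∀ x y : K, ‖Φ x - Φ y‖ ≤ Real.sqrt q * ‖x - y‖ := by
    intro x y
    have e1 : Φ x - Φ y = (x - y) - s • K.orthogonalProjectionOnto (A x - A y) := by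
      simp only [Φ, map_sub, smul_sub]; abel
    rw [e1, ← Real.sqrt_sq (norm_nonneg (x - y)), ← Real.sqrt_mul hq0]
    apply Real.le_sqrt_of_sq_le
    rw [norm_sub_sq_real, real_inner_smul_right, norm_smul, mul_pow, Real.norm_eq_abs, sq_abs]
    have e2 : inner ℝ (x - y) (K.orthogonalProjectionOnto (A x - A y)) =
        inner ℝ (A x - A y) ((x : H) - y) := by
      have := K.inner_orthogonalProjectionOnto_eq_of_mem_right (x - y) (A x - A y)
      rw [real_inner_comm]
      exact this
    have e3 : ‖K.orthogonalProjectionOnto (A x - A y)‖ ≤ L' * ‖x - y‖ :=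
      (K.norm_orthogonalProjectionOnto_apply_le _).trans (hL2 x y)
    have e4 : ‖K.orthogonalProjectionOnto (A x - A y)‖ ^ 2 ≤ L' ^ 2 * ‖x - y‖ ^ 2 := by
      rw [← mul_pow]; exact pow_le_pow_left₀ (norm_nonneg _) e3 2
    have e5 := hA x y
    have e6 : ‖(x : H) - y‖ = ‖x - y‖ := by simp
    rw [e6] at e5
    rw [e2]
    have e7 : s ^ 2 * ‖K.orthogonalProjectionOnto (A x - A y)‖ ^ 2
        ≤ s ^ 2 * (L' ^ 2 * ‖x - y‖ ^ 2) := by gcongr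
    have e8 : s ^ 2 * L' ^ 2 = m ^ 2 / L' ^ 2 := by rw [hs]; field_simp
    have e9 : s * m = m ^ 2 / L' ^ 2 := by rw [hs]; ring
    have e10 : s * (m * ‖x - y‖ ^ 2) ≤ s * inner ℝ (A x - A y) ((x : H) - y) := by gcongr
    have e11 : s ^ 2 * (L' ^ 2 * ‖x - y‖ ^ 2) = m ^ 2 / L' ^ 2 * ‖x - y‖ ^ 2 := by
      rw [← e8]; ring
    have e12 : s * (m * ‖x - y‖ ^ 2) = m ^ 2 / L' ^ 2 * ‖x - y‖ ^ 2 := by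
      rw [← e9]; ring
    rw [hq]
    nlinarith
  have hcontr : ContractingWith (Real.sqrt q).toNNReal Φ := by
    refine ⟨?_, LipschitzWith.of_dist_le_mul fun x y => ?_⟩
    · rw [Real.toNNReal_lt_one]
      exact (Real.sqrt_lt_sqrt hq0 hq1).trans_eq Real.sqrt_one
    · rw [dist_eq_norm, dist_eq_norm, Real.coe_toNNReal _ (Real.sqrt_nonneg q)]
      exact hΦ x y
  obtain ⟨g, hg, -⟩ := hcontr.exists_fixedPoint (0 : K) (edist_ne_top _ _)
  refine ⟨g, g.2, fun ψ hψ => ?_⟩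
  have h1 : K.orthogonalProjectionOnto (A g) = 0 := by
    have h2 : g - s • K.orthogonalProjectionOnto (A g) = g := hg
    have h3 : s • K.orthogonalProjectionOnto (A g) = 0 := by
      simpa using h2
    exact (smul_eq_zero.1 h3).resolve_left hspos.ne'
  have h2 := K.inner_orthogonalProjectionOnto_eq_of_mem_right ⟨ψ, hψ⟩ (A g)
  rw [h1] at h2
  simpa using h2.symm

/-- Composite of the averages `(1 + T i) / 2` for `j < i ≤ j + m`. -/
def dyadicAverage (T : ℕ → H →ₗ[ℝ] H) (j : ℕ) : ℕ → H →ₗ[ℝ] H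
  | 0 => LinearMap.id
  | m + 1 => (dyadicAverage T j m).comp ((2⁻¹ : ℝ) • (LinearMap.id + T (j + m + 1)))

theorem norm_dyadicAverage_le (T : ℕ → H →ₗ[ℝ] H) (hT : ∀ i x, ‖T i x‖ = ‖x‖) (j m : ℕ) (x : H) :
    ‖dyadicAverage T j m x‖ ≤ ‖x‖ := by
  induction m generalizing x with
  | zero => simp [dyadicAverage]
  | succ m ih =>
    refine (ih _).trans ?_
    simp only [LinearMap.smul_apply, LinearMap.add_apply, LinearMap.id_apply, norm_smul]
    have := norm_add_le x (T (j + m + 1) x)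
    rw [hT] at this
    norm_num
    linarith

theorem dyadicAverage_commute (T : ℕ → H →ₗ[ℝ] H) (hc : ∀ i j x, T i (T j x) = T j (T i x))
    (j m i : ℕ) (x : H) : dyadicAverage T j m (T i x) = T i (dyadicAverage T j m x) := by
  induction m generalizing x with
  | zero => simp [dyadicAverage]
  | succ m ih =>
    simp only [dyadicAverage, LinearMap.comp_apply, LinearMap.smul_apply, LinearMap.add_apply,
      LinearMap.id_apply, map_smul, map_add, hc (j + m + 1) i, ih]

theorem dyadicAverage_commute' (T : ℕ → H →ₗ[ℝ] H) (hc : ∀ i j x, T i (T j x) = T j (T i x))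
    (j m j' m' : ℕ) (x : H) : dyadicAverage T j m (dyadicAverage T j' m' x) =
      dyadicAverage T j' m' (dyadicAverage T j m x) := by
  induction m' generalizing x with
  | zero => simp [dyadicAverage]
  | succ m' ih => simp [dyadicAverage, ih, dyadicAverage_commute T hc j m]

theorem dyadicAverage_add (T : ℕ → H →ₗ[ℝ] H) (j a b : ℕ) (x : H) :
    dyadicAverage T j (a + b) x = dyadicAverage T j a (dyadicAverage T (j + a) b x) := by
  induction b generalizing x with
  | zero => simp [dyadicAverage]
  | succ b ih =>
    rw [← add_assoc]
    simp only [dyadicAverage, LinearMap.comp_apply, ih, add_assoc]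

theorem dyadicAverage_diffQuot (T : ℕ → H →ₗ[ℝ] H) (hsq : ∀ i x, T i x = T (i + 1) (T (i + 1) x))
    (x : H) (j m : ℕ) : dyadicAverage T j m ((2 : ℝ) ^ (j + m) • (T (j + m) x - x)) =
      (2 : ℝ) ^ j • (T j x - x) := by
  induction m with
  | zero => simp [dyadicAverage]
  | succ m ih =>
    rw [← ih]
    simp only [dyadicAverage, LinearMap.comp_apply]
    congr 1
    rw [hsq (j + m) x, ← add_assoc, pow_succ]
    simp only [LinearMap.smul_apply, LinearMap.add_apply, LinearMap.id_apply, map_smul, map_sub]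
    module

theorem norm_dyadicAverage_sub_le (T : ℕ → H →ₗ[ℝ] H) (hT : ∀ i x, ‖T i x‖ = ‖x‖) {y : H} {K : ℝ}
    (hK : 0 ≤ K) (hy : ∀ i, ‖T i y - y‖ ≤ K * (2⁻¹) ^ i) (j m : ℕ) :
    ‖dyadicAverage T j m y - y‖ ≤ K * (2⁻¹) ^ j := by
  have key : ‖dyadicAverage T j m y - y‖ ≤ K * ((2⁻¹) ^ j - (2⁻¹) ^ (j + m)) := by
    induction m with
    | zero => simp [dyadicAverage]
    | succ m ih =>
      have e : dyadicAverage T j (m + 1) y - y =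
          dyadicAverage T j m ((2⁻¹ : ℝ) • (T (j + m + 1) y - y)) +
            (dyadicAverage T j m y - y) := by
        have : (2⁻¹ : ℝ) • (y + T (j + m + 1) y) = (2⁻¹ : ℝ) • (T (j + m + 1) y - y) + y := by
          module
        simp only [dyadicAverage, LinearMap.comp_apply, LinearMap.smul_apply,
          LinearMap.add_apply, LinearMap.id_apply]
        rw [this, map_add]; abel
      rw [e]
      refine (norm_add_le _ _).trans ?_
      have h1 := (norm_dyadicAverage_le T hT j m ((2⁻¹ : ℝ) • (T (j + m + 1) y - y)))
      rw [norm_smul] at h1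
      have h2 := hy (j + m + 1)
      rw [Real.norm_of_nonneg (by norm_num)] at h1
      have e2 : ((2⁻¹ : ℝ)) ^ (j + m) = 2 * (2⁻¹) ^ (j + m + 1) := by rw [pow_succ]; ring
      rw [← add_assoc] 
      have h3 : 0 ≤ K * (2⁻¹ : ℝ) ^ (j + m + 1) := by positivity
      nlinarith
  refine key.trans ?_
  have : 0 ≤ K * (2⁻¹ : ℝ) ^ (j + m) := by positivity
  linarith

/-- Dyadic difference quotients along a one-parameter group of linear isometries of a Hilbert
space converge as soon as they are bounded. -/
theorem exists_tendsto_dyadic_diffQuot [CompleteSpace H] (T : ℕ → H →ₗ[ℝ] H)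
    (hT : ∀ i x, ‖T i x‖ = ‖x‖)
    (hc : ∀ i j x, T i (T j x) = T j (T i x)) (hsq : ∀ i x, T i x = T (i + 1) (T (i + 1) x))
    {x : H} {C : ℝ} (hx : ∀ i, ‖(2 : ℝ) ^ i • (T i x - x)‖ ≤ C) :
    ∃ y, Tendsto (fun i => (2 : ℝ) ^ i • (T i x - x)) atTop (𝓝 y) := by
  set X : ℕ → H := fun i => (2 : ℝ) ^ i • (T i x - x) with hX
  have hC : 0 ≤ C := (norm_nonneg _).trans (hx 0)
  have hTx : ∀ i, ‖T i x - x‖ ≤ C * (2⁻¹) ^ i := by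
    intro i
    have := hx i
    rw [norm_smul, norm_pow, Real.norm_ofNat] at this
    rw [inv_pow, ← div_eq_mul_inv, le_div_iff₀ (by positivity)]
    linarith
  have havg : ∀ j m, dyadicAverage T j m (X (j + m)) = X j := dyadicAverage_diffQuot T hsq x
  have hmono : Monotone fun i => ‖X i‖ := by
    refine monotone_nat_of_le_succ fun i => ?_
    rw [← havg i 1]
    exact norm_dyadicAverage_le T hT _ _ _
  have hbdd : BddAbove (range fun i => ‖X i‖) := ⟨C, by rintro _ ⟨i, rfl⟩; exact hx i⟩
  set c := ⨆ i, ‖X i‖ with hcdef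
  have hle : ∀ i, ‖X i‖ ≤ c := fun i => le_ciSup hbdd i
  have hc0 : 0 ≤ c := (norm_nonneg _).trans (hle 0)
  have hXi : ∀ l i, ‖T i (X l) - X l‖ ≤ (2 * C * 2 ^ l) * (2⁻¹) ^ i := by
    intro l i
    have e : T i (X l) - X l = (2 : ℝ) ^ l • (T l (T i x - x) - (T i x - x)) := by
      simp only [hX, map_smul, map_sub, hc i l]; module
    rw [e, norm_smul, norm_pow, Real.norm_ofNat]
    have h1 := norm_sub_le (T l (T i x - x)) (T i x - x)
    rw [hT] at h1
    have h2 := hTx i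
    have : (2 : ℝ) ^ l * ‖T l (T i x - x) - (T i x - x)‖ ≤ 2 ^ l * (2 * (C * (2⁻¹) ^ i)) := by
      gcongr; linarith
    linarith
  have hlow : ∀ l j k, l ≤ j → j ≤ k →
      2 * ‖X l‖ - (2 * C * 2 ^ l) * (2⁻¹) ^ j ≤ ‖X j + X k‖ := by
    intro l j k hlj hjk
    obtain ⟨a, rfl⟩ := Nat.exists_eq_add_of_le hlj
    obtain ⟨b, rfl⟩ := Nat.exists_eq_add_of_le hjk
    have h1 := norm_dyadicAverage_le T hT l (a + b) (X (l + a) + X (l + a + b))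
    have h2 : dyadicAverage T l (a + b) (X (l + a + b)) = X l := by
      rw [add_assoc]; exact havg l (a + b)
    have h3 : dyadicAverage T l (a + b) (X (l + a)) = dyadicAverage T (l + a) b (X l) := by
      rw [dyadicAverage_add, dyadicAverage_commute' T hc, havg]
    rw [map_add, h2, h3] at h1
    have h4 := norm_dyadicAverage_sub_le T hT (by positivity) (hXi l) (l + a) b
    have h5 : (2 : ℝ) • X l = (dyadicAverage T (l + a) b (X l) + X l) -
        (dyadicAverage T (l + a) b (X l) - X l) := by module
    have h6 : 2 * ‖X l‖ = ‖(2 : ℝ) • X l‖ := by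
      rw [norm_smul (2 : ℝ) (X l), Real.norm_ofNat]
    have h7 := norm_sub_le (dyadicAverage T (l + a) b (X l) + X l)
      (dyadicAverage T (l + a) b (X l) - X l)
    rw [← h5, ← h6] at h7
    linarith
  have hcauchy : CauchySeq X := by
    rw [Metric.cauchySeq_iff']
    intro ε hε
    set δ : ℝ := min (ε ^ 2 / (16 * (c + 1))) 1 with hδ
    have hδ0 : 0 < δ := by positivity
    have hδ1 : δ * (16 * (c + 1)) ≤ ε ^ 2 := by
      rw [← le_div_iff₀ (by positivity)]; exact min_le_left _ _
    obtain ⟨l, hl⟩ := exists_lt_of_lt_ciSup (show c - δ / 2 < ⨆ i, ‖X i‖ by rw [← hcdef]; linarith)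
    have hlim : Tendsto (fun j : ℕ => (2 * C * 2 ^ l) * (2⁻¹ : ℝ) ^ j) atTop (𝓝 0) := by
      have := (tendsto_pow_atTop_nhds_zero_of_lt_one (r := (2⁻¹ : ℝ)) (by norm_num)
        (by norm_num)).const_mul (2 * C * 2 ^ l)
      simpa using this
    obtain ⟨N, hN⟩ := ((hlim.eventually (gt_mem_nhds hδ0)).and (eventually_ge_atTop l)).exists
    refine ⟨N, fun k hk => ?_⟩
    have h1 := hlow l N k hN.2 hk
    have h2 : 2 * c - 2 * δ ≤ ‖X N + X k‖ := by linarith [hN.1]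
    have h3 := parallelogram_law_with_norm ℝ (X k) (X N)
    have h4 := hle k
    have h5 := hle N
    rw [dist_eq_norm]
    have h6 : ‖X k - X N‖ ^ 2 < ε ^ 2 := by
      rw [add_comm (X N)] at h2
      have hk0 := norm_nonneg (X k)
      have hN0 := norm_nonneg (X N)
      have hs0 := norm_nonneg (X k + X N)
      have a1 : ‖X k‖ * ‖X k‖ ≤ c * c := mul_self_le_mul_self hk0 h4
      have a2 : ‖X N‖ * ‖X N‖ ≤ c * c := mul_self_le_mul_self hN0 h5
      have a3 : 4 * c * c - 8 * c * δ ≤ ‖X k + X N‖ * ‖X k + X N‖ := by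
        rcases le_total 0 (2 * c - 2 * δ) with h | h
        · have := mul_self_le_mul_self h h2
          nlinarith
        · nlinarith
      nlinarith
    exact lt_of_pow_lt_pow_left₀ 2 hε.le h6
  exact cauchySeq_tendsto_of_complete hcauchy

end HilbertSpace

section RadialField

variable {E : Type*} [NormedAddCommGroup E] [InnerProductSpace ℝ E]

/-- The slopes of `b` between points of `s` lie in `[m, M]`. -/
def SlopesIn (b : ℝ → ℝ) (s : Set ℝ) (m M : ℝ) : Prop :=
  ∀ x ∈ s, ∀ y ∈ s, x ≤ y → m * (y - x) ≤ b y - b x ∧ b y - b x ≤ M * (y - x)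

theorem SlopesIn.union {b : ℝ → ℝ} {s t : Set ℝ} {m M c : ℝ} (hs : SlopesIn b s m M)
    (ht : SlopesIn b t m M) (hsc : ∀ x ∈ s, x ≤ c) (htc : ∀ x ∈ t, c ≤ x) (hcs : c ∈ s)
    (hct : c ∈ t) : SlopesIn b (s ∪ t) m M := by
  rintro x (hx | hx) y (hy | hy) hxy
  · exact hs x hx y hy hxy
  · have h1 := hs x hx c hcs (hsc x hx)
    have h2 := ht c hct y hy (htc y hy)
    constructor <;> nlinarith [h1.1, h1.2, h2.1, h2.2]
  · have e : x = y := le_antisymm hxy ((hsc y hy).trans (htc x hx))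
    subst e; simp
  · exact ht x hx y hy hxy

theorem inner_radial_sub (a : ℝ → ℝ) (z w : E) :
    inner ℝ (a ‖z‖ • z - a ‖w‖ • w) (z - w) =
      (a ‖z‖ * ‖z‖ - a ‖w‖ * ‖w‖) * (‖z‖ - ‖w‖) +
        (a ‖z‖ + a ‖w‖) * (‖z‖ * ‖w‖ - inner ℝ z w) := by
  simp only [inner_sub_left, inner_sub_right, real_inner_smul_left, real_inner_self_eq_norm_sq,
    real_inner_comm z w]
  ring

theorem norm_radial_sub_sq (a : ℝ → ℝ) (z w : E) :
    ‖a ‖z‖ • z - a ‖w‖ • w‖ ^ 2 = (a ‖z‖ * ‖z‖ - a ‖w‖ * ‖w‖) ^ 2 +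
      2 * (a ‖z‖ * a ‖w‖) * (‖z‖ * ‖w‖ - inner ℝ z w) := by
  rw [norm_sub_sq_real, norm_smul, norm_smul, real_inner_smul_left, real_inner_smul_right,
    mul_pow, mul_pow, Real.norm_eq_abs, Real.norm_eq_abs, sq_abs, sq_abs]
  ring

/-- Monotonicity and Lipschitz bounds for a radial field `z ↦ a(|z|) z`. -/
theorem radial_bounds {a : ℝ → ℝ} {s : Set ℝ} {m M : ℝ} (hm : 0 ≤ m)
    (ha : ∀ t ∈ s, m ≤ a t ∧ a t ≤ M) (hb : SlopesIn (fun t => a t * t) s m M) {z w : E}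
    (hz : ‖z‖ ∈ s) (hw : ‖w‖ ∈ s) :
    m * ‖z - w‖ ^ 2 ≤ inner ℝ (a ‖z‖ • z - a ‖w‖ • w) (z - w) ∧
      ‖a ‖z‖ • z - a ‖w‖ • w‖ ≤ M * ‖z - w‖ := by
  have hi : 0 ≤ ‖z‖ * ‖w‖ - inner ℝ z w := sub_nonneg.2 (real_inner_le_norm z w)
  have hn : ‖z - w‖ ^ 2 = (‖z‖ - ‖w‖) ^ 2 + 2 * (‖z‖ * ‖w‖ - inner ℝ z w) := by
    rw [norm_sub_sq_real]; ring
  obtain ⟨az, az'⟩ := ha _ hz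
  obtain ⟨aw, aw'⟩ := ha _ hw
  have hM : 0 ≤ M := hm.trans (az.trans az')
  have hsl : m * (‖z‖ - ‖w‖) ^ 2 ≤ (a ‖z‖ * ‖z‖ - a ‖w‖ * ‖w‖) * (‖z‖ - ‖w‖) ∧
      (a ‖z‖ * ‖z‖ - a ‖w‖ * ‖w‖) ^ 2 ≤ M ^ 2 * (‖z‖ - ‖w‖) ^ 2 := by
    rcases le_total ‖w‖ ‖z‖ with h | h
    · obtain ⟨h1, h2⟩ := hb _ hw _ hz h
      have h0 : 0 ≤ ‖z‖ - ‖w‖ := sub_nonneg.2 h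
      simp only at h1 h2
      have h3 : 0 ≤ a ‖z‖ * ‖z‖ - a ‖w‖ * ‖w‖ := (mul_nonneg hm h0).trans h1
      constructor
      · nlinarith
      · rw [← mul_pow]; exact pow_le_pow_left₀ h3 h2 2
    · obtain ⟨h1, h2⟩ := hb _ hz _ hw h
      have h0 : 0 ≤ ‖w‖ - ‖z‖ := sub_nonneg.2 h
      simp only at h1 h2
      have h3 : 0 ≤ a ‖w‖ * ‖w‖ - a ‖z‖ * ‖z‖ := (mul_nonneg hm h0).trans h1
      constructor
      · nlinarith
      · have := pow_le_pow_left₀ h3 h2 2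
        nlinarith
  constructor
  · rw [inner_radial_sub, hn]
    nlinarith [hsl.1]
  · refine le_of_sq_le_sq ?_ (by positivity)
    rw [norm_radial_sub_sq, mul_pow, hn]
    have : a ‖z‖ * a ‖w‖ ≤ M ^ 2 := by
      rw [pow_two]; exact mul_le_mul az' aw' (hm.trans aw) hM
    nlinarith [hsl.2]

end RadialField

section TruncatedPower

/-- `t ^ (p - 2)` with `t` truncated to `[ε, 1]`. -/
def truncPow (p ε t : ℝ) : ℝ := (max ε (min t 1)) ^ (p - 2)

/-- Lower ellipticity constant of `truncPow p ε` on `[ε, ∞)`. -/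
def ellLow (p ε : ℝ) : ℝ := min 1 (p - 1) * min 1 (ε ^ (p - 2))

/-- Upper ellipticity constant of `truncPow p ε` on `[ε, ∞)`. -/
def ellUp (p ε : ℝ) : ℝ := max 1 (p - 1) * max 1 (ε ^ (p - 2))

variable {p ε : ℝ}

theorem ellLow_pos (hp : 1 < p) (hε : 0 < ε) : 0 < ellLow p ε :=
  mul_pos (lt_min one_pos (by linarith)) (lt_min one_pos (Real.rpow_pos_of_pos hε _))

theorem one_le_ellUp : 1 ≤ ellUp p ε := by
  have h1 : (1 : ℝ) ≤ max 1 (p - 1) := le_max_left _ _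
  have h2 : (1 : ℝ) ≤ max 1 (ε ^ (p - 2)) := le_max_left _ _
  exact one_le_mul_of_one_le_of_one_le h1 h2

theorem rpow_sub_two_mem (hε : 0 < ε) {t : ℝ} (ht : ε ≤ t) (ht1 : t ≤ 1) :
    min 1 (ε ^ (p - 2)) ≤ t ^ (p - 2) ∧ t ^ (p - 2) ≤ max 1 (ε ^ (p - 2)) := by
  have ht0 : 0 < t := hε.trans_le ht
  rcases le_total 2 p with h | h
  · have h0 : 0 ≤ p - 2 := by linarith
    exact ⟨(min_le_right _ _).trans (Real.rpow_le_rpow hε.le ht h0),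
      (Real.rpow_le_one ht0.le ht1 h0).trans (le_max_left _ _)⟩
  · have h0 : p - 2 ≤ 0 := by linarith
    exact ⟨(min_le_left _ _).trans (Real.one_le_rpow_of_pos_of_le_one_of_nonpos ht0 ht1 h0),
      (Real.rpow_le_rpow_of_nonpos hε ht h0).trans (le_max_right _ _)⟩

theorem ellLow_le (hε : 0 < ε) (hp : 1 < p) {t : ℝ} (ht : ε ≤ t) (ht1 : t ≤ 1) :
    ellLow p ε ≤ t ^ (p - 2) ∧ ellLow p ε ≤ (p - 1) * t ^ (p - 2) ∧
      t ^ (p - 2) ≤ ellUp p ε ∧ (p - 1) * t ^ (p - 2) ≤ ellUp p ε := by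
  obtain ⟨h1, h2⟩ := rpow_sub_two_mem (p := p) hε ht ht1
  have h3 : 0 < t ^ (p - 2) := Real.rpow_pos_of_pos (hε.trans_le ht) _
  have h4 : 0 ≤ min 1 (ε ^ (p - 2)) := le_min zero_le_one (Real.rpow_nonneg hε.le _)
  have h5 : (0 : ℝ) ≤ max 1 (p - 1) := zero_le_one.trans (le_max_left _ _)
  refine ⟨?_, ?_, ?_, ?_⟩
  · calc _ ≤ 1 * t ^ (p - 2) := mul_le_mul (min_le_left _ _) h1 h4 zero_le_one
      _ = _ := one_mul _
  · exact mul_le_mul (min_le_right _ _) h1 h4 (by linarith)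
  · calc _ = 1 * t ^ (p - 2) := (one_mul _).symm
      _ ≤ _ := mul_le_mul (le_max_left _ _) h2 h3.le h5
  · exact mul_le_mul (le_max_right _ _) h2 h3.le h5

theorem truncPow_of_mem {t : ℝ} (ht : ε ≤ t) (ht1 : t ≤ 1) : truncPow p ε t = t ^ (p - 2) := by
  rw [truncPow, min_eq_left ht1, max_eq_right ht]

theorem truncPow_of_one_le (hε1 : ε ≤ 1) {t : ℝ} (ht1 : 1 ≤ t) : truncPow p ε t = 1 := by
  rw [truncPow, min_eq_right ht1, max_eq_right hε1, Real.one_rpow]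

theorem truncPow_of_le (hε1 : ε ≤ 1) {t : ℝ} (ht : t ≤ ε) : truncPow p ε t = ε ^ (p - 2) := by
  rw [truncPow, min_eq_left (ht.trans hε1), max_eq_left ht]

theorem truncPow_mem (hp : 1 < p) (hε : 0 < ε) (hε1 : ε ≤ 1) {k t : ℝ} (hk : ε ≤ k)
    (hk1 : k ≤ 1) (ht : k ≤ t) :
    ellLow p k ≤ truncPow p ε t ∧ truncPow p ε t ≤ ellUp p k := by
  rcases le_total t 1 with h | h
  · rw [truncPow_of_mem (hk.trans ht) h]
    have := ellLow_le (hε.trans_le hk) hp ht h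
    exact ⟨this.1, this.2.2.1⟩
  · rw [truncPow_of_one_le hε1 h]
    have := ellLow_le (hε.trans_le hk) hp hk1 le_rfl
    simp only [Real.one_rpow] at this
    exact ⟨this.1, this.2.2.1⟩

theorem slopesIn_truncPow_Ici (hp : 1 < p) (hε : 0 < ε) {k : ℝ} (hk : ε ≤ k)
    (hk1 : k ≤ 1) : SlopesIn (fun t => truncPow p ε t * t) (Ici k) (ellLow p k) (ellUp p k) := by
  have hk0 : 0 < k := hε.trans_le hk
  have e : Ici k = Icc k 1 ∪ Ici 1 := (Icc_union_Ici_eq_Ici hk1).symm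
  rw [e]
  refine SlopesIn.union (c := 1) ?_ ?_ (fun x hx => hx.2) (fun x hx => hx) ⟨hk1, le_rfl⟩
    self_mem_Ici
  · have hd : ∀ x ∈ Icc k 1, HasDerivAt (fun t : ℝ => t ^ (p - 1)) ((p - 1) * x ^ (p - 2)) x := by
      intro x hx
      have := Real.hasDerivAt_rpow_const (x := x) (p := p - 1) (Or.inl (hk0.trans_le hx.1).ne')
      rwa [show p - 1 - 1 = p - 2 by ring] at this
    have hc : ContinuousOn (fun t : ℝ => t ^ (p - 1)) (Icc k 1) :=
      fun x hx => (hd x hx).continuousAt.continuousWithinAt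
    have hdf : DifferentiableOn ℝ (fun t : ℝ => t ^ (p - 1)) (interior (Icc k 1)) :=
      fun x hx => (hd x (interior_subset hx)).differentiableAt.differentiableWithinAt
    have hbe : ∀ x ∈ Icc k 1, truncPow p ε x * x = x ^ (p - 1) := by
      intro x hx
      rw [truncPow_of_mem (hk.trans hx.1) hx.2]
      nth_rewrite 2 [← Real.rpow_one x]
      rw [← Real.rpow_add (hk0.trans_le hx.1)]; congr 1; ring
    intro x hx y hy hxy
    simp only [hbe x hx, hbe y hy]
    constructor
    · refine (convex_Icc k 1).mul_sub_le_image_sub_of_le_deriv hc hdf ?_ x hx y hy hxy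
      intro z hz
      have hz' := interior_subset hz
      rw [(hd z hz').deriv]
      exact (ellLow_le hk0 hp hz'.1 hz'.2).2.1
    · refine (convex_Icc k 1).image_sub_le_mul_sub_of_deriv_le hc hdf ?_ x hx y hy hxy
      intro z hz
      have hz' := interior_subset hz
      rw [(hd z hz').deriv]
      exact (ellLow_le hk0 hp hz'.1 hz'.2).2.2.2
  · intro x hx y hy hxy
    simp only [truncPow_of_one_le (hk.trans hk1) hx, truncPow_of_one_le (hk.trans hk1) hy]
    have := ellLow_le hk0 hp hk1 le_rfl
    simp only [Real.one_rpow] at this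
    have h0 : 0 ≤ y - x := sub_nonneg.2 hxy
    constructor <;> nlinarith [this.1, this.2.2.1]

theorem truncPow_mem' (hp : 1 < p) (hε : 0 < ε) (hε1 : ε ≤ 1) (t : ℝ) :
    ellLow p ε ≤ truncPow p ε t ∧ truncPow p ε t ≤ ellUp p ε := by
  rcases le_total ε t with h | h
  · exact truncPow_mem hp hε hε1 le_rfl hε1 h
  · rw [truncPow_of_le hε1 h, ← truncPow_of_le (p := p) hε1 (le_refl ε)]
    exact truncPow_mem hp hε hε1 le_rfl hε1 le_rfl

theorem slopesIn_truncPow (hp : 1 < p) (hε : 0 < ε) (hε1 : ε ≤ 1) :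
    SlopesIn (fun t => truncPow p ε t * t) univ (ellLow p ε) (ellUp p ε) := by
  rw [← Iic_union_Ici (a := ε)]
  refine SlopesIn.union (c := ε) ?_ (slopesIn_truncPow_Ici hp hε le_rfl hε1) (fun x hx => hx)
    (fun x hx => hx) self_mem_Iic self_mem_Ici
  intro x hx y hy hxy
  simp only [truncPow_of_le hε1 hx, truncPow_of_le hε1 hy]
  have := ellLow_le hε hp (le_refl ε) hε1
  have h0 : 0 ≤ y - x := sub_nonneg.2 hxy
  constructor <;> nlinarith [this.1, this.2.2.1]

variable {E : Type*} [NormedAddCommGroup E] [InnerProductSpace ℝ E]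

/-- The regularized `p`-Laplace field. -/
def truncField (p ε : ℝ) (z : E) : E := truncPow p ε ‖z‖ • z

theorem truncField_bounds (hp : 1 < p) (hε : 0 < ε) (hε1 : ε ≤ 1) (z w : E) :
    ellLow p ε * ‖z - w‖ ^ 2 ≤ inner ℝ (truncField p ε z - truncField p ε w) (z - w) ∧
      ‖truncField p ε z - truncField p ε w‖ ≤ ellUp p ε * ‖z - w‖ :=
  radial_bounds (ellLow_pos hp hε).le (fun t _ => truncPow_mem' hp hε hε1 t)
    (slopesIn_truncPow hp hε hε1) (mem_univ _) (mem_univ _)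

theorem truncField_bounds_of_le (hp : 1 < p) (hε : 0 < ε) {k : ℝ} (hk : ε ≤ k)
    (hk1 : k ≤ 1) {z w : E} (hz : k ≤ ‖z‖) (hw : k ≤ ‖w‖) :
    ellLow p k * ‖z - w‖ ^ 2 ≤ inner ℝ (truncField p ε z - truncField p ε w) (z - w) ∧
      ‖truncField p ε z - truncField p ε w‖ ≤ ellUp p k * ‖z - w‖ :=
  radial_bounds (ellLow_pos hp (hε.trans_le hk)).le
    (fun _ ht => truncPow_mem hp hε (hk.trans hk1) hk hk1 ht)
    (slopesIn_truncPow_Ici hp hε hk hk1) hz hw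

theorem norm_truncField_sub_le (hp : 1 < p) (hε : 0 < ε) (hε1 : ε ≤ 1) {z : E} (hz : ‖z‖ ≤ 1) :
    ‖‖z‖ ^ (p - 2) • z - truncField p ε z‖ ≤ 2 * ε ^ (p - 1) := by
  rcases le_total ε ‖z‖ with h | h
  · rw [truncField, truncPow_of_mem h hz, sub_self, norm_zero]
    positivity
  · rw [truncField, truncPow_of_le hε1 h, ← sub_smul, norm_smul]
    rcases eq_or_lt_of_le (norm_nonneg z) with h0 | h0
    · rw [← h0, mul_zero]; positivity
    have e1 : ε ^ (p - 2) * ε = ε ^ (p - 1) := by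
      nth_rewrite 2 [← Real.rpow_one ε]
      rw [← Real.rpow_add hε]; congr 1; ring
    have e2 : ‖z‖ ^ (p - 2) * ‖z‖ = ‖z‖ ^ (p - 1) := by
      nth_rewrite 2 [← Real.rpow_one ‖z‖]
      rw [← Real.rpow_add h0]; congr 1; ring
    have e3 : ‖z‖ ^ (p - 1) ≤ ε ^ (p - 1) := Real.rpow_le_rpow h0.le h (by linarith)
    have e4 : ε ^ (p - 2) * ‖z‖ ≤ ε ^ (p - 1) := by
      rw [← e1]; gcongr
    have e5 : ‖‖z‖ ^ (p - 2) - ε ^ (p - 2)‖ ≤ ‖z‖ ^ (p - 2) + ε ^ (p - 2) := by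
      refine (norm_sub_le _ _).trans_eq ?_
      rw [Real.norm_of_nonneg (by positivity), Real.norm_of_nonneg (by positivity)]
    nlinarith

theorem truncField_zero : truncField p ε (0 : E) = 0 := by simp [truncField]

theorem rpow_div_ellLow_le (hp : 1 < p) (hε : 0 < ε) :
    ε ^ (p - 1) / ellLow p ε ≤ (ε ^ (p - 1) + ε) / min 1 (p - 1) := by
  have h0 : 0 < min 1 (p - 1) := lt_min one_pos (by linarith)
  have h1 : 0 < ε ^ (p - 2) := Real.rpow_pos_of_pos hε _
  have e1 : ε ^ (p - 2) * ε = ε ^ (p - 1) := by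
    nth_rewrite 2 [← Real.rpow_one ε]
    rw [← Real.rpow_add hε]; congr 1; ring
  rw [ellLow, mul_comm, ← div_div]
  gcongr
  rw [div_le_iff₀ (lt_min one_pos h1)]
  rcases le_total 1 (ε ^ (p - 2)) with h | h
  · rw [min_eq_left h, mul_one]; linarith
  · rw [min_eq_right h, add_mul, mul_comm ε, e1]
    have : 0 ≤ ε ^ (p - 1) * ε ^ (p - 2) := by positivity
    linarith

end TruncatedPower

section Huber

/-- The function `t ↦ max t 0 ^ 2` has derivative `2 * max t 0`. -/
theorem hasDerivAt_max_zero_sq (t : ℝ) : HasDerivAt (fun s : ℝ => max s 0 ^ 2) (2 * max t 0) t := by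
  rcases lt_trichotomy t 0 with h | h | h
  · have : (fun s : ℝ => max s 0 ^ 2) =ᶠ[nhds t] fun _ => 0 := by
      filter_upwards [gt_mem_nhds h] with s hs
      rw [max_eq_right hs.le]; ring
    rw [max_eq_right h.le, mul_zero]
    exact (hasDerivAt_const t (0 : ℝ)).congr_of_eventuallyEq this
  · subst h
    rw [max_self, mul_zero, hasDerivAt_iff_isLittleO_nhds_zero]
    simp only [zero_add, max_self, smul_zero, sub_zero, ne_eq, OfNat.ofNat_ne_zero,
      not_false_eq_true, zero_pow]
    have h2 : (fun h : ℝ => max h 0 ^ 2) =O[nhds 0] fun h : ℝ => h ^ 2 := by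
      refine Asymptotics.isBigO_of_le _ fun x => ?_
      rw [norm_pow, norm_pow]
      refine pow_le_pow_left₀ (norm_nonneg _) ?_ 2
      rw [Real.norm_of_nonneg (le_max_right _ _), Real.norm_eq_abs]
      exact max_le (le_abs_self x) (abs_nonneg x)
    refine h2.trans_isLittleO ?_
    have := Asymptotics.isLittleO_pow_pow (𝕜 := ℝ) (show 1 < 2 by norm_num)
    simpa using this
  · have : (fun s : ℝ => max s 0 ^ 2) =ᶠ[nhds t] fun s => s ^ 2 := by
      filter_upwards [lt_mem_nhds h] with s hs
      rw [max_eq_left hs.le]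
    rw [max_eq_left h.le]
    refine HasDerivAt.congr_of_eventuallyEq ?_ this
    simpa using hasDerivAt_pow 2 t

/-- A `C¹` convex approximation of `t ↦ max (t - k - d) 0`, vanishing for `t ≤ k`. -/
def huber (k d t : ℝ) : ℝ := (max (t - k) 0 ^ 2 - max (t - k - 2 * d) 0 ^ 2) / (4 * d)

/-- The derivative of `huber k d`. -/
def huberDeriv (k d t : ℝ) : ℝ := (max (t - k) 0 - max (t - k - 2 * d) 0) / (2 * d)

variable {k d : ℝ}

theorem hasDerivAt_huber (hd : 0 < d) (t : ℝ) : HasDerivAt (huber k d) (huberDeriv k d t) t := by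
  have h1 := (hasDerivAt_max_zero_sq (t - k)).comp_sub_const t k
  have h2 := (hasDerivAt_max_zero_sq (t - (k + 2 * d))).comp_sub_const t (k + 2 * d)
  have h3 := (h1.sub h2).div_const (4 * d)
  have e : huber k d = fun x => (max (x - k) 0 ^ 2 - max (x - (k + 2 * d)) 0 ^ 2) / (4 * d) := by
    funext x; rw [huber, sub_add_eq_sub_sub]
  rw [e]
  refine h3.congr_deriv ?_
  rw [huberDeriv, sub_add_eq_sub_sub]
  field_simp
  ring

theorem continuous_huberDeriv : Continuous (huberDeriv k d) := by
  unfold huberDeriv; fun_prop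

theorem contDiff_huber (hd : 0 < d) : ContDiff ℝ 1 (huber k d) := by
  rw [contDiff_one_iff_deriv]
  refine ⟨fun t => (hasDerivAt_huber hd t).differentiableAt, ?_⟩
  have : deriv (huber k d) = huberDeriv k d := funext fun t => (hasDerivAt_huber hd t).deriv
  rw [this]; exact continuous_huberDeriv

theorem huber_of_le (hd : 0 < d) {t : ℝ} (ht : t ≤ k) : huber k d t = 0 := by
  rw [huber, max_eq_right (by linarith), max_eq_right (by linarith)]; simp

theorem huberDeriv_of_le (hd : 0 < d) {t : ℝ} (ht : t ≤ k) : huberDeriv k d t = 0 := by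
  rw [huberDeriv, max_eq_right (by linarith), max_eq_right (by linarith)]; simp

theorem huber_bounds (hd : 0 < d) (t : ℝ) :
    0 ≤ huberDeriv k d t ∧ huberDeriv k d t ≤ 1 ∧ max (t - k - d) 0 ≤ huber k d t ∧
      huber k d t ≤ max (t - k) 0 ∧ huber k d t ^ 2 ≤ huberDeriv k d t * max (t - k) 0 ^ 2 := by
  obtain ⟨s, rfl⟩ : ∃ s, t = s + k := ⟨t - k, by ring⟩
  simp only [huber, huberDeriv, add_sub_cancel_right]
  rcases le_total s 0 with h | h
  · rw [max_eq_right h, max_eq_right (by linarith : s - 2 * d ≤ 0),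
      max_eq_right (by linarith : s - d ≤ 0)]
    simp
  rcases le_total s (2 * d) with h2 | h2
  · rw [max_eq_left h, max_eq_right (by linarith : s - 2 * d ≤ 0)]
    simp only [sub_zero, ne_eq, OfNat.ofNat_ne_zero, not_false_eq_true, zero_pow]
    refine ⟨by positivity, by rw [div_le_one (by positivity)]; exact h2, max_le ?_ (by positivity),
      ?_, ?_⟩
    · rw [le_div_iff₀ (by positivity)]; nlinarith [sq_nonneg (s - 2 * d)]
    · rw [div_le_iff₀ (by positivity)]; nlinarith
    · rw [div_pow, div_mul_eq_mul_div, div_le_div_iff₀ (by positivity) (by positivity)]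
      have : 0 ≤ d * s ^ 3 * (8 * d - s) := by
        have : 0 ≤ 8 * d - s := by linarith
        positivity
      nlinarith
  · rw [max_eq_left h, max_eq_left (by linarith : 0 ≤ s - 2 * d),
      max_eq_left (by linarith : 0 ≤ s - d)]
    have e1 : (s - (s - 2 * d)) / (2 * d) = 1 := by field_simp; ring
    have e2 : (s ^ 2 - (s - 2 * d) ^ 2) / (4 * d) = s - d := by field_simp; ring
    rw [e1, e2]
    refine ⟨by norm_num, le_rfl, le_rfl, by linarith, ?_⟩
    nlinarith

end Huber

section LTwo

open Filter Topology

variable {α : Type*} [MeasurableSpace α] {μ : Measure α}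
variable {V : Type*} [NormedAddCommGroup V]

/-- The `L²` norm as a real number. -/
def ltwo (μ : Measure α) (F : α → V) : ℝ := (eLpNorm F 2 μ).toReal

theorem ltwo_nonneg (F : α → V) : 0 ≤ ltwo μ F := ENNReal.toReal_nonneg

theorem ofReal_ltwo {F : α → V} (hF : MemLp F 2 μ) : ENNReal.ofReal (ltwo μ F) = eLpNorm F 2 μ :=
  ENNReal.ofReal_toReal hF.eLpNorm_ne_top

theorem ltwo_sq {F : α → V} (hF : MemLp F 2 μ) : ltwo μ F ^ 2 = ∫ x, ‖F x‖ ^ 2 ∂μ := by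
  have h := hF.eLpNorm_eq_integral_rpow_norm (by norm_num) (by norm_num)
  have h0 : 0 ≤ ∫ x, ‖F x‖ ^ 2 ∂μ := integral_nonneg fun x => by positivity
  simp only [ENNReal.toReal_ofNat, Real.rpow_ofNat] at h
  rw [ltwo, h, ENNReal.toReal_ofReal (by positivity), ← Real.rpow_natCast, ← Real.rpow_mul h0]
  norm_num

theorem ltwo_add_le {F G : α → V} (hF : MemLp F 2 μ) (hG : MemLp G 2 μ) :
    ltwo μ (fun x => F x + G x) ≤ ltwo μ F + ltwo μ G := by
  rw [ltwo, ltwo, ltwo, ← ENNReal.toReal_add hF.eLpNorm_ne_top hG.eLpNorm_ne_top]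
  exact ENNReal.toReal_mono (ENNReal.add_ne_top.2 ⟨hF.eLpNorm_ne_top, hG.eLpNorm_ne_top⟩)
    (eLpNorm_add_le hF.1 hG.1 (by norm_num))

theorem ltwo_sub_le {F G : α → V} (hF : MemLp F 2 μ) (hG : MemLp G 2 μ) :
    ltwo μ (fun x => F x - G x) ≤ ltwo μ F + ltwo μ G := by
  rw [ltwo, ltwo, ltwo, ← ENNReal.toReal_add hF.eLpNorm_ne_top hG.eLpNorm_ne_top]
  exact ENNReal.toReal_mono (ENNReal.add_ne_top.2 ⟨hF.eLpNorm_ne_top, hG.eLpNorm_ne_top⟩)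
    (eLpNorm_sub_le hF.1 hG.1 (by norm_num))

theorem ltwo_sub_comm (F G : α → V) :
    ltwo μ (fun x => F x - G x) = ltwo μ (fun x => G x - F x) := by
  rw [ltwo, ltwo]; congr 1; exact eLpNorm_sub_comm F G 2 μ

theorem ltwo_triangle {F G K : α → V} (hF : MemLp F 2 μ) (hG : MemLp G 2 μ) (hK : MemLp K 2 μ) :
    ltwo μ (fun x => F x - K x) ≤
      ltwo μ (fun x => F x - G x) + ltwo μ (fun x => G x - K x) := by
  have := ltwo_add_le (hF.sub hG) (hG.sub hK)
  simp only [Pi.sub_apply, sub_add_sub_cancel] at this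
  exact this

theorem ltwo_le_add_sub {F G : α → V} (hF : MemLp F 2 μ) (hG : MemLp G 2 μ) :
    ltwo μ F ≤ ltwo μ (fun x => F x - G x) + ltwo μ G := by
  have := ltwo_add_le (hF.sub hG) hG
  simp only [Pi.sub_apply, sub_add_cancel] at this
  exact this

theorem ltwo_mono {W : Type*} [NormedAddCommGroup W] {F : α → V} {G : α → W} (hG : MemLp G 2 μ)
    (h : ∀ᵐ x ∂μ, ‖F x‖ ≤ ‖G x‖) : ltwo μ F ≤ ltwo μ G :=
  ENNReal.toReal_mono hG.eLpNorm_ne_top (eLpNorm_mono_ae h)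

theorem ltwo_mono' {W : Type*} [NormedAddCommGroup W] {F : α → V} {G : α → W} (hG : MemLp G 2 μ)
    {c : ℝ} (hc : 0 ≤ c) (h : ∀ᵐ x ∂μ, ‖F x‖ ≤ c * ‖G x‖) : ltwo μ F ≤ c * ltwo μ G := by
  have h1 := eLpNorm_le_mul_eLpNorm_of_ae_le_mul h 2
  have := ENNReal.toReal_mono (ENNReal.mul_ne_top ENNReal.ofReal_ne_top hG.eLpNorm_ne_top) h1
  rwa [ENNReal.toReal_mul, ENNReal.toReal_ofReal hc] at this

theorem ltwo_congr {F G : α → V} (h : F =ᵐ[μ] G) : ltwo μ F = ltwo μ G := by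
  rw [ltwo, ltwo, eLpNorm_congr_ae h]

theorem ltwo_smul [NormedSpace ℝ V] (c : ℝ) (F : α → V) :
    ltwo μ (fun x => c • F x) = |c| * ltwo μ F := by
  have : eLpNorm (fun x => c • F x) 2 μ = ‖c‖ₑ * eLpNorm F 2 μ := eLpNorm_const_smul c F 2 μ
  rw [ltwo, ltwo, this, ENNReal.toReal_mul, toReal_enorm, Real.norm_eq_abs]

theorem ltwo_norm (F : α → V) : ltwo μ (fun x => ‖F x‖) = ltwo μ F := by
  rw [ltwo, ltwo, eLpNorm_norm]

theorem MeasureTheory.MemLp.integrable_inner' [InnerProductSpace ℝ V] {F G : α → V}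
    (hF : MemLp F 2 μ) (hG : MemLp G 2 μ) : Integrable (fun x => inner ℝ (F x) (G x)) μ := by
  have h : Integrable (fun x => inner ℝ (hF.toLp F x) (hG.toLp G x)) μ :=
    L2.integrable_inner _ _
  refine h.congr ?_
  filter_upwards [hF.coeFn_toLp, hG.coeFn_toLp] with x h1 h2
  rw [h1, h2]

theorem abs_integral_inner_le [InnerProductSpace ℝ V] {F G : α → V} (hF : MemLp F 2 μ)
    (hG : MemLp G 2 μ) : |∫ x, inner ℝ (F x) (G x) ∂μ| ≤ ltwo μ F * ltwo μ G := by
  have h := abs_real_inner_le_norm (hF.toLp F) (hG.toLp G)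
  rw [Lp.norm_toLp, Lp.norm_toLp, L2.inner_def] at h
  have e : ∫ x, inner ℝ (hF.toLp F x) (hG.toLp G x) ∂μ = ∫ x, inner ℝ (F x) (G x) ∂μ := by
    refine integral_congr_ae ?_
    filter_upwards [hF.coeFn_toLp, hG.coeFn_toLp] with x h1 h2
    rw [h1, h2]
  rwa [e] at h

theorem MeasureTheory.MemLp.integrable_mul' {F G : α → ℝ}
    (hF : MemLp F 2 μ) (hG : MemLp G 2 μ) : Integrable (fun x => F x * G x) μ :=
  MemLp.integrable_mul hF hG

theorem abs_integral_mul_le {F G : α → ℝ} (hF : MemLp F 2 μ)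
    (hG : MemLp G 2 μ) : |∫ x, F x * G x ∂μ| ≤ ltwo μ F * ltwo μ G := by
  have := abs_integral_inner_le hG hF
  simpa [mul_comm] using this

theorem ltwo_tendsto_iff {ι : Type*} {l : Filter ι} {F : ι → α → V} (hF : ∀ i, MemLp (F i) 2 μ) :
    Tendsto (fun i => ltwo μ (F i)) l (𝓝 0) ↔ Tendsto (fun i => eLpNorm (F i) 2 μ) l (𝓝 0) := by
  rw [← ENNReal.toReal_zero]
  exact ENNReal.tendsto_toReal_iff (fun i => (hF i).eLpNorm_ne_top) ENNReal.zero_ne_top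

end LTwo

section TestFunctions

variable {E : Type*} [NormedAddCommGroup E] [InnerProductSpace ℝ E] [FiniteDimensional ℝ E]

/-- Continuously differentiable functions with compact support. -/
structure IsTestFunction (φ : E → ℝ) : Prop where
  contDiff : ContDiff ℝ 1 φ
  compact : HasCompactSupport φ

namespace IsTestFunction

variable {φ ψ : E → ℝ}

theorem hasGradientAt (h : IsTestFunction φ) (x : E) : HasGradientAt φ (gradient φ x) x :=
  ((h.contDiff.differentiable (by norm_num)) x).hasGradientAt

theorem continuous (h : IsTestFunction φ) : Continuous φ := h.contDiff.continuous

theorem gradient_eq (φ : E → ℝ) :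
    gradient φ = fun x => (InnerProductSpace.toDual ℝ E).symm (fderiv ℝ φ x) := rfl

theorem continuous_gradient (h : IsTestFunction φ) : Continuous (gradient φ) := by
  rw [gradient_eq]
  exact (LinearIsometryEquiv.continuous _).comp (h.contDiff.continuous_fderiv (by norm_num))

theorem support_gradient_subset (φ : E → ℝ) : Function.support (gradient φ) ⊆ tsupport φ := by
  intro x hx
  apply support_fderiv_subset ℝ
  intro h0
  apply hx
  simp [gradient_eq, h0]

theorem hasCompactSupport_gradient (h : IsTestFunction φ) : HasCompactSupport (gradient φ) :=
  h.compact.mono' (support_gradient_subset φ)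

theorem gradient_eq_zero {x : E} (hx : x ∉ tsupport φ) : gradient φ x = 0 := by
  by_contra h
  exact hx (support_gradient_subset φ h)

theorem mul (hφ : IsTestFunction φ) (hψ : ContDiff ℝ 1 ψ) : IsTestFunction fun x => φ x * ψ x :=
  ⟨hφ.contDiff.mul hψ, hφ.compact.mul_right⟩

theorem sub (hφ : IsTestFunction φ) (hψ : IsTestFunction ψ) :
    IsTestFunction fun x => φ x - ψ x := by
  refine ⟨hφ.contDiff.sub hψ.contDiff, ?_⟩
  exact hφ.compact.sub hψ.compact

theorem const_mul (hφ : IsTestFunction φ) (c : ℝ) : IsTestFunction fun x => c * φ x :=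
  ⟨contDiff_const.mul hφ.contDiff, hφ.compact.mul_left⟩

theorem comp_add_right (hφ : IsTestFunction φ) (v : E) : IsTestFunction fun x => φ (x + v) :=
  ⟨hφ.contDiff.comp (contDiff_id.add contDiff_const),
    hφ.compact.comp_homeomorph (Homeomorph.addRight v)⟩

end IsTestFunction

theorem HasGradientAt.mul' [CompleteSpace E] {f g : E → ℝ} {f' g' x : E} (hf : HasGradientAt f f' x)
    (hg : HasGradientAt g g' x) :
    HasGradientAt (fun y => f y * g y) (f x • g' + g x • f') x := by
  rw [hasGradientAt_iff_hasFDerivAt] at *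
  refine (hf.mul hg).congr_fderiv ?_
  simp

end TestFunctions

section GradientRules

variable {E : Type*} [NormedAddCommGroup E] [InnerProductSpace ℝ E] [CompleteSpace E]

theorem HasGradientAt.sub' {f g : E → ℝ} {f' g' x : E} (hf : HasGradientAt f f' x)
    (hg : HasGradientAt g g' x) : HasGradientAt (fun y => f y - g y) (f' - g') x := by
  rw [hasGradientAt_iff_hasFDerivAt] at *
  exact (hf.sub hg).congr_fderiv (by simp)

theorem HasGradientAt.add' {f g : E → ℝ} {f' g' x : E} (hf : HasGradientAt f f' x)
    (hg : HasGradientAt g g' x) : HasGradientAt (fun y => f y + g y) (f' + g') x := by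
  rw [hasGradientAt_iff_hasFDerivAt] at *
  exact (hf.add hg).congr_fderiv (by simp)

theorem HasGradientAt.const_mul' {f : E → ℝ} {f' x : E} (hf : HasGradientAt f f' x) (c : ℝ) :
    HasGradientAt (fun y => c * f y) (c • f') x := by
  rw [hasGradientAt_iff_hasFDerivAt] at *
  exact (hf.const_mul c).congr_fderiv (by simp)

theorem HasGradientAt.comp_add_right {f : E → ℝ} {f' x : E} (v : E)
    (hf : HasGradientAt f f' (x + v)) : HasGradientAt (fun y => f (y + v)) f' x := by
  rw [hasGradientAt_iff_hasFDerivAt] at *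
  exact (hasFDerivAt_comp_add_right v).2 hf

theorem HasDerivAt.comp_hasGradientAt {h : ℝ → ℝ} {h' : ℝ} {f : E → ℝ} {f' x : E}
    (hh : HasDerivAt h h' (f x)) (hf : HasGradientAt f f' x) :
    HasGradientAt (fun y => h (f y)) (h' • f') x := by
  rw [hasGradientAt_iff_hasFDerivAt] at *
  exact (hh.comp_hasFDerivAt x hf).congr_fderiv (by simp)

theorem HasGradientAt.hasDerivAt_line {f : E → ℝ} {f' x e : E} {t : ℝ}
    (hf : HasGradientAt f f' (x + t • e)) :
    HasDerivAt (fun s : ℝ => f (x + s • e)) (inner ℝ f' e) t := by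
  rw [hasGradientAt_iff_hasFDerivAt] at hf
  have h1 : HasDerivAt (fun s : ℝ => x + s • e) e t := by
    simpa using ((hasDerivAt_id t).smul_const e).const_add x
  refine (hf.comp_hasDerivAt t h1).congr_deriv ?_
  simp

end GradientRules

section Translation

open Filter Topology

variable {E : Type*} [NormedAddCommGroup E] [InnerProductSpace ℝ E] [FiniteDimensional ℝ E]
  [MeasurableSpace E] [BorelSpace E]
variable {V : Type*} [NormedAddCommGroup V]

theorem measurePreserving_add_right' (v : E) :
    MeasurePreserving (fun x : E => x + v) volume volume := measurePreserving_add_right volume v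

theorem MeasureTheory.MemLp.comp_add_right {F : E → V} (hF : MemLp F 2 volume) (v : E) :
    MemLp (fun x => F (x + v)) 2 volume :=
  hF.comp_measurePreserving (measurePreserving_add_right' v)

theorem ltwo_comp_add_right {F : E → V} (hF : MemLp F 2 volume) (v : E) :
    ltwo volume (fun x => F (x + v)) = ltwo volume F := by
  rw [ltwo, ltwo]
  congr 1
  exact eLpNorm_comp_measurePreserving hF.1 (measurePreserving_add_right' v)

/-- Translations as linear isometries of `L²`. -/
def lpTranslate [NormedSpace ℝ V] (v : E) :
    Lp V 2 (volume : Measure E) →ₗᵢ[ℝ] Lp V 2 (volume : Measure E) :=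
  Lp.compMeasurePreservingₗᵢ ℝ (fun x => x + v) (measurePreserving_add_right' v)

theorem lpTranslate_toLp [NormedSpace ℝ V] (v : E) {F : E → V} (hF : MemLp F 2 volume) :
    lpTranslate v (hF.toLp F) = (hF.comp_add_right v).toLp (fun x => F (x + v)) :=
  Lp.toLp_compMeasurePreserving hF (measurePreserving_add_right' v)

theorem coeFn_lpTranslate [NormedSpace ℝ V] (v : E) (F : Lp V 2 (volume : Measure E)) :
    lpTranslate v F =ᵐ[volume] fun x => F (x + v) :=
  Lp.coeFn_compMeasurePreserving F (measurePreserving_add_right' v)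

theorem lpTranslate_lpTranslate [NormedSpace ℝ V] (v w : E) (F : Lp V 2 (volume : Measure E)) :
    lpTranslate v (lpTranslate w F) = lpTranslate (v + w) F := by
  obtain ⟨F, hF, rfl⟩ : ∃ (G : E → V) (hG : MemLp G 2 volume), F = hG.toLp G :=
    ⟨F, Lp.memLp F, (Lp.toLp_coeFn _ _).symm⟩
  rw [lpTranslate_toLp, lpTranslate_toLp, lpTranslate_toLp]
  congr 1
  funext x
  rw [add_assoc]

theorem tendsto_lpTranslate [NormedSpace ℝ V] (F : Lp V 2 (volume : Measure E)) :
    Tendsto (fun v : E => lpTranslate v F) (𝓝 0) (𝓝 F) := by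
  let G : E → C(E, E) := fun v => ⟨fun x => x + v, by fun_prop⟩
  have hG : Continuous G := ContinuousMap.continuous_of_continuous_uncurry _ (by
    change Continuous fun q : E × E => q.2 + q.1
    fun_prop)
  have h := Continuous.compMeasurePreservingLp (f := fun _ : E => F) continuous_const hG
    (fun v => measurePreserving_add_right' v) (by norm_num)
  have h0 := h.tendsto 0
  have e : Lp.compMeasurePreserving (G 0) (measurePreserving_add_right' (0 : E)) F = F := by
    refine Lp.ext ((coeFn_lpTranslate (0 : E) F).trans ?_)
    exact Eventually.of_forall fun x => by simp
  rw [e] at h0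
  exact h0

theorem tendsto_ltwo_translate_sub [NormedSpace ℝ V] {F : E → V} (hF : MemLp F 2 volume) :
    Tendsto (fun v : E => ltwo volume fun x => F (x + v) - F x) (𝓝 0) (𝓝 0) := by
  have h := (tendsto_lpTranslate (hF.toLp F)).sub_const (hF.toLp F)
  rw [sub_self] at h
  have h2 := h.norm
  rw [norm_zero] at h2
  refine h2.congr fun v => ?_
  rw [lpTranslate_toLp, ← MemLp.toLp_sub, Lp.norm_toLp]
  rfl

variable {φ : E → ℝ}

theorem IsTestFunction.memLp (h : IsTestFunction φ) : MemLp φ 2 volume :=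
  h.continuous.memLp_of_hasCompactSupport h.compact

theorem IsTestFunction.memLp_gradient (h : IsTestFunction φ) : MemLp (gradient φ) 2 volume :=
  h.continuous_gradient.memLp_of_hasCompactSupport h.hasCompactSupport_gradient

theorem IsTestFunction.memLp_inner_gradient (h : IsTestFunction φ) (e : E) :
    MemLp (fun x => inner ℝ (gradient φ x) e) 2 volume :=
  (h.continuous_gradient.inner continuous_const).memLp_of_hasCompactSupport
    (h.hasCompactSupport_gradient.mono fun x hx => by
      rw [Function.mem_support] at hx ⊢
      intro h0; simp [h0] at hx)

theorem IsTestFunction.exists_bound (h : IsTestFunction φ) : ∃ M, ∀ x, ‖gradient φ x‖ ≤ M :=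
  h.continuous_gradient.bounded_above_of_compact_support h.hasCompactSupport_gradient

theorem IsTestFunction.hasDerivAt_integral_translate (h : IsTestFunction φ) {F : E → ℝ}
    (hF : MemLp F 2 volume) (e : E) (t : ℝ) :
    HasDerivAt (fun s : ℝ => ∫ x, F x * φ (x + s • e))
      (∫ x, F x * inner ℝ (gradient φ (x + t • e)) e) t := by
  obtain ⟨M, hM⟩ := h.exists_bound
  obtain ⟨R, hR⟩ := h.compact.isCompact.isBounded.subset_closedBall (0 : E)
  have hM0 : 0 ≤ M := (norm_nonneg _).trans (hM 0)
  set K : Set E := closedBall 0 (R + (|t| + 1) * ‖e‖) with hK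
  have hKm : MemLp (K.indicator fun _ => (1 : ℝ)) 2 volume :=
    memLp_indicator_const 2 measurableSet_closedBall 1 (Or.inr measure_closedBall_lt_top.ne)
  have hmemi : ∀ s : ℝ, MemLp (fun x => φ (x + s • e)) 2 volume := fun s =>
    h.memLp.comp_add_right _
  refine (hasDerivAt_integral_of_dominated_loc_of_deriv_le
    (F' := fun s x => F x * inner ℝ (gradient φ (x + s • e)) e)
    (bound := fun x => (M * ‖e‖) * (‖F x‖ * K.indicator (fun _ => (1 : ℝ)) x))
    (ball_mem_nhds t one_pos) ?_ ?_ ?_ ?_ ?_ ?_).2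
  · exact Eventually.of_forall fun s => hF.1.mul (hmemi s).1
  · exact hF.integrable_mul' (hmemi t)
  · exact hF.1.mul ((h.memLp_inner_gradient e).comp_add_right _).1
  · refine Eventually.of_forall fun x s hs => ?_
    rw [norm_mul]
    by_cases hx : x ∈ K
    · rw [indicator_of_mem hx, mul_one, mul_comm]
      gcongr
      exact (norm_inner_le_norm _ _).trans (by gcongr; exact hM _)
    · have : gradient φ (x + s • e) = 0 := by
        refine IsTestFunction.gradient_eq_zero fun hmem => hx ?_
        have h1 := mem_closedBall_zero_iff.1 (hR hmem)
        rw [hK, mem_closedBall_zero_iff]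
        have h2 : ‖x‖ ≤ ‖x + s • e‖ + ‖s • e‖ := by
          have := norm_sub_le (x + s • e) (s • e)
          rwa [add_sub_cancel_right] at this
        rw [norm_smul] at h2
        have h3 : ‖s‖ ≤ |t| + 1 := by
          rw [mem_ball, Real.dist_eq] at hs
          rw [Real.norm_eq_abs]
          have := abs_add_le (s - t) t
          rw [sub_add_cancel] at this
          linarith
        have h4 : ‖s‖ * ‖e‖ ≤ (|t| + 1) * ‖e‖ := by gcongr
        linarith
      rw [this, inner_zero_left, norm_zero, mul_zero, indicator_of_notMem hx]
      simp
  · exact (hF.norm.integrable_mul' hKm).const_mul _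
  · exact Eventually.of_forall fun x s _ => (h.hasGradientAt _).hasDerivAt_line.const_mul (F x)

/-- Mean value theorem for `t ↦ ∫ F φ(· + t e)`. -/
theorem IsTestFunction.exists_integral_translate_sub_eq (h : IsTestFunction φ) {F : E → ℝ}
    (hF : MemLp F 2 volume) (e : E) (s : ℝ) :
    ∃ t : ℝ, |t| ≤ |s| ∧ ∫ x, F x * (φ (x + s • e) - φ x) =
      s * ∫ x, F x * inner ℝ (gradient φ (x + t • e)) e := by
  set J : ℝ → ℝ := fun s => ∫ x, F x * φ (x + s • e) with hJ
  have hd : ∀ t, HasDerivAt J (∫ x, F x * inner ℝ (gradient φ (x + t • e)) e) t :=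
    fun t => h.hasDerivAt_integral_translate hF e t
  have e1 : ∫ x, F x * (φ (x + s • e) - φ x) = J s - J 0 := by
    simp only [hJ, zero_smul, add_zero, mul_sub]
    exact integral_sub (hF.integrable_mul' (h.memLp.comp_add_right _)) (hF.integrable_mul' h.memLp)
  rw [e1]
  have hcont : Continuous J := continuous_iff_continuousAt.2 fun t => (hd t).continuousAt
  rcases lt_trichotomy s 0 with hs | rfl | hs
  · obtain ⟨t, ht, htt⟩ := exists_hasDerivAt_eq_slope J _ hs hcont.continuousOn fun x _ => hd x
    refine ⟨t, abs_le_abs_of_nonpos ht.2.le ht.1.le, ?_⟩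
    rw [htt]; field_simp [hs.ne]; ring
  · exact ⟨0, le_rfl, by simp⟩
  · obtain ⟨t, ht, htt⟩ := exists_hasDerivAt_eq_slope J _ hs hcont.continuousOn fun x _ => hd x
    refine ⟨t, abs_le_abs_of_nonneg ht.1.le ht.2.le, ?_⟩
    rw [htt]; field_simp [hs.ne']; ring

theorem IsTestFunction.ltwo_translate_sub_le (h : IsTestFunction φ) (e : E) (s : ℝ) :
    ltwo volume (fun x => φ (x + s • e) - φ x) ≤
      |s| * ltwo volume fun x => inner ℝ (gradient φ x) e := by
  have hF : MemLp (fun x => φ (x + s • e) - φ x) 2 volume := (h.memLp.comp_add_right _).sub h.memLp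
  obtain ⟨t, -, ht⟩ := h.exists_integral_translate_sub_eq hF e s
  have h1 := abs_integral_mul_le hF ((h.memLp_inner_gradient e).comp_add_right (t • e))
  rw [ltwo_comp_add_right (h.memLp_inner_gradient e)] at h1
  have h2 := ltwo_sq hF
  simp only [Real.norm_eq_abs, sq_abs] at h2
  simp only [← pow_two] at ht
  rw [ht] at h2
  set X := ltwo volume fun x => φ (x + s • e) - φ x
  rcases (ltwo_nonneg (μ := volume) fun x => φ (x + s • e) - φ x).eq_or_lt with h0 | h0
  · have h0' : X = 0 := h0.symm
    rw [h0']; exact mul_nonneg (abs_nonneg _) (ltwo_nonneg _)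
  · have h3 : X ^ 2 ≤ |s| * (X * ltwo volume fun x => inner ℝ (gradient φ x) e) := by
      rw [h2]
      refine (le_abs_self _).trans ?_
      rw [abs_mul]
      gcongr
    refine le_of_mul_le_mul_left ?_ h0
    linarith

end Translation

section DifferenceQuotients

open Filter Topology

variable {E : Type*} [NormedAddCommGroup E] [InnerProductSpace ℝ E] [FiniteDimensional ℝ E]
  [MeasurableSpace E] [BorelSpace E]

/-- `g` is a limit of gradients in `L²` and solves `-div A(g) = f` weakly in the open set `B`, for
a Lipschitz, strongly monotone field `A`. -/
structure IsWeakGradient (A : E → E) (m M : ℝ) (B : Set E) (f : E → ℝ) (g : E → E) : Prop where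
  pos : 0 < m
  nonneg : 0 ≤ M
  mono : ∀ z w, m * ‖z - w‖ ^ 2 ≤ inner ℝ (A z - A w) (z - w)
  lip : ∀ z w, ‖A z - A w‖ ≤ M * ‖z - w‖
  zero : A 0 = 0
  isOpen : IsOpen B
  memLp_rhs : MemLp f 2 volume
  memLp : MemLp g 2 volume
  approx : ∀ δ > 0, ∃ φ : E → ℝ, IsTestFunction φ ∧
    ltwo volume (fun x => gradient φ x - g x) ≤ δ
  weak : ∀ ψ : E → ℝ, IsTestFunction ψ → tsupport ψ ⊆ B →
    ∫ x, inner ℝ (A (g x)) (gradient ψ x) = ∫ x, f x * ψ x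

/-- Difference quotient. -/
def diffQuot {V : Type*} [AddCommGroup V] [Module ℝ V] (h : ℝ) (e : E) (F : E → V) (x : E) : V :=
  h⁻¹ • (F (x + h • e) - F x)

variable {A : E → E} {m M : ℝ} {B : Set E} {f : E → ℝ} {g : E → E} {φ Θ η : E → ℝ} {e : E} {h : ℝ}

theorem IsTestFunction.diffQuot (hφ : IsTestFunction φ) (h : ℝ) (e : E) :
    IsTestFunction (diffQuot h e φ) :=
  ((hφ.comp_add_right (h • e)).sub hφ).const_mul h⁻¹

theorem IsTestFunction.gradient_diffQuot (hφ : IsTestFunction φ) (h : ℝ) (e : E) :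
    gradient (_root_.diffQuot h e φ) = _root_.diffQuot h e (gradient φ) := by
  funext x
  exact (((HasGradientAt.comp_add_right (h • e) (hφ.hasGradientAt _)).sub'
    (hφ.hasGradientAt x)).const_mul' h⁻¹).gradient

section

variable {V : Type*} [NormedAddCommGroup V] [InnerProductSpace ℝ V]

theorem integral_inner_sub_left' {F G K : E → V} (hF : MemLp F 2 volume) (hG : MemLp G 2 volume)
    (hK : MemLp K 2 volume) : ∫ x, inner ℝ (F x - G x) (K x) =
      (∫ x, inner ℝ (F x) (K x)) - ∫ x, inner ℝ (G x) (K x) := by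
  simp only [inner_sub_left]
  exact integral_sub (hF.integrable_inner' hK) (hG.integrable_inner' hK)

theorem integral_inner_sub_right' {F G K : E → V} (hF : MemLp F 2 volume) (hG : MemLp G 2 volume)
    (hK : MemLp K 2 volume) : ∫ x, inner ℝ (K x) (F x - G x) =
      (∫ x, inner ℝ (K x) (F x)) - ∫ x, inner ℝ (K x) (G x) := by
  simp only [inner_sub_right]
  exact integral_sub (hK.integrable_inner' hF) (hK.integrable_inner' hG)

theorem integral_sub_mul' {F G K : E → ℝ} (hF : MemLp F 2 volume) (hG : MemLp G 2 volume)
    (hK : MemLp K 2 volume) : ∫ x, (F x - G x) * K x =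
      (∫ x, F x * K x) - ∫ x, G x * K x := by
  simp only [sub_mul]
  exact integral_sub (hF.integrable_mul' hK) (hG.integrable_mul' hK)

end

namespace IsWeakGradient

theorem continuous (H : IsWeakGradient A m M B f g) : Continuous A := by
  have : LipschitzWith M.toNNReal A := LipschitzWith.of_dist_le_mul fun x y => by
    rw [dist_eq_norm, dist_eq_norm, Real.coe_toNNReal _ H.nonneg]; exact H.lip x y
  exact this.continuous

theorem memLp_comp (H : IsWeakGradient A m M B f g) {F : E → E} (hF : MemLp F 2 volume) :
    MemLp (fun x => A (F x)) 2 volume := by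
  refine MemLp.of_le_mul (c := M) hF (H.continuous.comp_aestronglyMeasurable hF.1) ?_
  refine Eventually.of_forall fun x => ?_
  have := H.lip (F x) 0
  rwa [H.zero, sub_zero, sub_zero] at this

theorem memLp_diffQuot {V : Type*} [NormedAddCommGroup V] [NormedSpace ℝ V] {F : E → V}
    (hF : MemLp F 2 volume) : MemLp (diffQuot h e F) 2 volume :=
  ((hF.comp_add_right (h • e)).sub hF).const_smul h⁻¹

/-- Discrete differentiation of the weak equation. -/
theorem abs_integral_diffQuot_le (H : IsWeakGradient A m M B f g) (hφ : IsTestFunction φ)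
    (hh : 0 < h) (he : ‖e‖ ≤ 1) (hΘ : IsTestFunction Θ) (hΘB : tsupport Θ ⊆ B)
    (hΘB' : ∀ x ∈ tsupport Θ, x + h • e ∈ B) {S : ℝ}
    (hS : ∀ t : ℝ, |t| ≤ h → ltwo volume (fun x => f (x + t • e) - f x) ≤ S) :
    |(∫ x, inner ℝ (diffQuot h e (fun y => A (gradient φ y)) x) (gradient Θ x)) +
      ∫ x, f x * inner ℝ (gradient Θ x) e| ≤
      (2 * M * ltwo volume (fun x => gradient φ x - g x) / h + S) * ltwo volume (gradient Θ) := by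
  set ψ : E → ℝ := fun x => h⁻¹ * (Θ x - Θ (x + (-h) • e)) with hψ
  have hΘ' := hΘ.comp_add_right ((-h) • e)
  have hψt : IsTestFunction ψ := (hΘ.sub hΘ').const_mul h⁻¹
  have hgψ : gradient ψ = fun x => h⁻¹ • (gradient Θ x - gradient Θ (x + (-h) • e)) := by
    funext x
    exact (((hΘ.hasGradientAt x).sub' (HasGradientAt.comp_add_right ((-h) • e)
      (hΘ.hasGradientAt _))).const_mul' h⁻¹).gradient
  have hgΘ := hΘ.memLp_gradient
  have hz := hφ.memLp_gradient
  have hAz := H.memLp_comp hz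
  have hAg := H.memLp_comp H.memLp
  have hsupp : tsupport ψ ⊆ B := by
    have hc : IsClosed (tsupport Θ ∪ (fun x => x + (-h) • e) ⁻¹' tsupport Θ) :=
      (isClosed_tsupport Θ).union ((isClosed_tsupport Θ).preimage (by fun_prop))
    refine (closure_minimal ?_ hc).trans (union_subset hΘB fun x hx => ?_)
    · intro x hx
      by_contra hcon
      simp only [mem_union, not_or, mem_preimage] at hcon
      apply hx
      simp only [hψ, image_eq_zero_of_notMem_tsupport hcon.1,
        image_eq_zero_of_notMem_tsupport hcon.2, sub_zero, mul_zero]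
    · have := hΘB' _ hx
      simpa [add_assoc] using this
  have hw := H.weak ψ hψt hsupp
  have hsh : MemLp (fun x => gradient Θ (x + (-h) • e)) 2 volume := hgΘ.comp_add_right _
  have h1 : ∫ x, inner ℝ (diffQuot h e (fun y => A (gradient φ y)) x) (gradient Θ x) =
      -∫ x, inner ℝ (A (gradient φ x)) (gradient ψ x) := by
    have ha : ∫ x, inner ℝ (A (gradient φ (x + h • e))) (gradient Θ x) =
        ∫ x, inner ℝ (A (gradient φ x)) (gradient Θ (x + (-h) • e)) := by
      rw [← integral_add_right_eq_self (fun x => inner ℝ (A (gradient φ x))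
        (gradient Θ (x + (-h) • e))) (h • e)]
      simp only [add_assoc, neg_smul, add_neg_cancel, add_zero]
    simp only [diffQuot, hgψ, inner_smul_left, inner_smul_right, integral_const_mul]
    rw [integral_inner_sub_left' (hAz.comp_add_right (h • e)) hAz hgΘ,
      integral_inner_sub_right' hgΘ hsh hAz, ha]
    simp only [conj_trivial]
    ring
  have h2 : ∫ x, inner ℝ (A (gradient φ x)) (gradient ψ x) =
      (∫ x, inner ℝ (A (gradient φ x) - A (g x)) (gradient ψ x)) + ∫ x, f x * ψ x := by
    rw [← hw, integral_inner_sub_left' hAz hAg hψt.memLp_gradient]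
    ring
  obtain ⟨t, ht, htt⟩ := hΘ.exists_integral_translate_sub_eq H.memLp_rhs e (-h)
  have hi := hΘ.memLp_inner_gradient e
  have h3 : ∫ x, f x * ψ x = ∫ x, f (x + (-t) • e) * inner ℝ (gradient Θ x) e := by
    have hb : ∫ x, f x * ψ x = -h⁻¹ * ∫ x, f x * (Θ (x + (-h) • e) - Θ x) := by
      rw [← integral_const_mul]
      refine integral_congr_ae (Eventually.of_forall fun x => ?_)
      simp only [hψ]; ring
    rw [hb, htt, ← mul_assoc, neg_mul_neg, inv_mul_cancel₀ hh.ne', one_mul,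
      ← integral_add_right_eq_self (fun x => f (x + (-t) • e) * inner ℝ (gradient Θ x) e) (t • e)]
    simp only [add_assoc, neg_smul, add_neg_cancel, add_zero]
  rw [h1, h2, h3]
  have h4 : ∫ x, (f (x + (-t) • e) - f x) * inner ℝ (gradient Θ x) e =
      (∫ x, f (x + (-t) • e) * inner ℝ (gradient Θ x) e) - ∫ x, f x * inner ℝ (gradient Θ x) e :=
    integral_sub_mul' (H.memLp_rhs.comp_add_right _) H.memLp_rhs hi
  have h5 : ltwo volume (fun x => A (gradient φ x) - A (g x)) ≤
      M * ltwo volume (fun x => gradient φ x - g x) :=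
    ltwo_mono' (hz.sub H.memLp) H.nonneg (Eventually.of_forall fun x => H.lip _ _)
  have h6 : ltwo volume (gradient ψ) ≤ h⁻¹ * (2 * ltwo volume (gradient Θ)) := by
    rw [hgψ, ltwo_smul, abs_of_pos (inv_pos.2 hh)]
    gcongr
    refine (ltwo_sub_le hgΘ hsh).trans ?_
    rw [ltwo_comp_add_right hgΘ]
    linarith
  have h7 := abs_integral_inner_le (hAz.sub hAg) hψt.memLp_gradient
  have h8 := abs_integral_mul_le ((H.memLp_rhs.comp_add_right ((-t) • e)).sub H.memLp_rhs) hi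
  have h9 : ltwo volume (fun x => inner ℝ (gradient Θ x) e) ≤ ltwo volume (gradient Θ) :=
    ltwo_mono hgΘ (Eventually.of_forall fun x => (norm_inner_le_norm _ _).trans
      (mul_le_of_le_one_right (norm_nonneg _) he))
  have h10 := hS (-t) (by rw [abs_neg]; rwa [abs_neg, abs_of_pos hh] at ht)
  have e1 : |∫ x, inner ℝ (A (gradient φ x) - A (g x)) (gradient ψ x)| ≤
      2 * M * ltwo volume (fun x => gradient φ x - g x) / h * ltwo volume (gradient Θ) := by
    calc _ ≤ _ := h7
      _ ≤ (M * ltwo volume (fun x => gradient φ x - g x)) *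
          (h⁻¹ * (2 * ltwo volume (gradient Θ))) :=
        mul_le_mul h5 h6 (ltwo_nonneg _) (mul_nonneg H.nonneg (ltwo_nonneg _))
      _ = _ := by field_simp
  have e2 : |∫ x, (f (x + (-t) • e) - f x) * inner ℝ (gradient Θ x) e| ≤
      S * ltwo volume (gradient Θ) :=
    h8.trans (mul_le_mul h10 h9 (ltwo_nonneg _) ((ltwo_nonneg _).trans h10))
  rw [h4] at e2
  rw [add_mul]
  rw [abs_le] at e1 e2 ⊢
  constructor <;> linarith [e1.1, e1.2, e2.1, e2.2]

end IsWeakGradient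

end DifferenceQuotients

section Caccioppoli

open Filter Topology

variable {E : Type*} [NormedAddCommGroup E] [InnerProductSpace ℝ E]

/-- Bounds for the lower order terms in the Caccioppoli inequality. -/
theorem abs_caccioppoli_terms_le {a q v e : E} {M η σ ψ s f : ℝ} (hM : 0 ≤ M)
    (he : ‖e‖ ≤ 1) (hη : 0 ≤ η) (hσ : 0 ≤ σ) (hσ1 : σ ≤ 1) (hs : 0 ≤ s)
    (hψ : ψ ^ 2 ≤ σ * s ^ 2) (ha : ‖a‖ ≤ M * ‖q‖) :
    |inner ℝ a ((2 * η * ψ) • v) + f * inner ℝ ((η ^ 2 * σ) • q + (2 * η * ψ) • v) e| ≤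
      2 * M * (η * √σ * ‖q‖) * (s * ‖v‖) + (η * |f|) * (η * √σ * ‖q‖)
        + 2 * (η * |f|) * (s * ‖v‖) := by
  have hr : 0 ≤ √σ := Real.sqrt_nonneg _
  have hr1 : √σ ≤ 1 := Real.sqrt_le_one.2 hσ1
  have hrr : √σ * √σ = σ := Real.mul_self_sqrt hσ
  have hψ' : |ψ| ≤ √σ * s := by
    rw [← Real.sqrt_sq_eq_abs, ← Real.sqrt_sq hs, ← Real.sqrt_mul hσ]
    exact Real.sqrt_le_sqrt hψ
  have h1 : |inner ℝ a ((2 * η * ψ) • v)| ≤ 2 * M * (η * √σ * ‖q‖) * (s * ‖v‖) := by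
    rw [inner_smul_right, abs_mul, abs_mul, abs_of_nonneg (by positivity : 0 ≤ 2 * η)]
    calc 2 * η * |ψ| * |inner ℝ a v| ≤ 2 * η * (√σ * s) * (M * ‖q‖ * ‖v‖) := by
          gcongr
          exact (abs_real_inner_le_norm _ _).trans (by gcongr)
      _ = _ := by ring
  have h2 : |inner ℝ ((η ^ 2 * σ) • q + (2 * η * ψ) • v) e| ≤
      η ^ 2 * √σ * ‖q‖ + 2 * η * s * ‖v‖ := by
    calc _ ≤ ‖(η ^ 2 * σ) • q + (2 * η * ψ) • v‖ * ‖e‖ := abs_real_inner_le_norm _ _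
      _ ≤ ‖(η ^ 2 * σ) • q + (2 * η * ψ) • v‖ * 1 := by gcongr
      _ ≤ ‖(η ^ 2 * σ) • q‖ + ‖(2 * η * ψ) • v‖ := by rw [mul_one]; exact norm_add_le _ _
      _ = η ^ 2 * (√σ * √σ) * ‖q‖ + 2 * η * |ψ| * ‖v‖ := by
          rw [norm_smul, norm_smul, Real.norm_eq_abs, Real.norm_eq_abs, abs_mul (2 * η), hrr,
            abs_of_nonneg (by positivity : 0 ≤ η ^ 2 * σ), abs_of_nonneg (by positivity : 0 ≤ 2 * η)]
      _ ≤ η ^ 2 * (√σ * 1) * ‖q‖ + 2 * η * (1 * s) * ‖v‖ := by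
          gcongr
          exact hψ'.trans (by gcongr)
      _ = _ := by ring
  have h3 : |f * inner ℝ ((η ^ 2 * σ) • q + (2 * η * ψ) • v) e| ≤
      |f| * (η * (η * √σ * ‖q‖)) + 2 * (η * |f|) * (s * ‖v‖) := by
    rw [abs_mul]
    calc _ ≤ |f| * (η ^ 2 * √σ * ‖q‖ + 2 * η * s * ‖v‖) := by gcongr
      _ = _ := by ring
  have h4 := (abs_add_le _ _).trans (add_le_add h1 h3)
  linarith

/-- Pointwise lower bound where the field is elliptic. -/
theorem caccioppoli_pointwise {a q v e : E} {m M η σ ψ s f : ℝ} (hm : 0 < m) (hM : 0 ≤ M)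
    (he : ‖e‖ ≤ 1) (hη : 0 ≤ η) (hσ : 0 ≤ σ) (hσ1 : σ ≤ 1) (hs : 0 ≤ s)
    (hψ : ψ ^ 2 ≤ σ * s ^ 2) (ha : ‖a‖ ≤ M * ‖q‖) (ha' : m * ‖q‖ ^ 2 ≤ inner ℝ a q) :
    m / 2 * (η ^ 2 * σ * ‖q‖ ^ 2) ≤
      inner ℝ a ((η ^ 2 * σ) • q + (2 * η * ψ) • v) +
        f * inner ℝ ((η ^ 2 * σ) • q + (2 * η * ψ) • v) e +
      (4 * M ^ 2 / m + m) * (s ^ 2 * ‖v‖ ^ 2) + 2 / m * (η ^ 2 * f ^ 2) := by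
  have h1 := (abs_le.1 (abs_caccioppoli_terms_le (v := v) (f := f) hM he hη hσ hσ1 hs hψ ha)).1
  have hrr : √σ ^ 2 = σ := Real.sq_sqrt hσ
  rw [inner_add_right, inner_smul_right a q]
  have h2 : η ^ 2 * σ * (m * ‖q‖ ^ 2) ≤ η ^ 2 * σ * inner ℝ a q := by gcongr
  have hx2 : (η * √σ * ‖q‖) ^ 2 = η ^ 2 * σ * ‖q‖ ^ 2 := by rw [mul_pow, mul_pow, hrr]
  have hF2 : (η * |f|) ^ 2 = η ^ 2 * f ^ 2 := by rw [mul_pow, sq_abs]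
  have hy2 : (s * ‖v‖) ^ 2 = s ^ 2 * ‖v‖ ^ 2 := mul_pow _ _ _
  rw [← hx2, ← hF2, ← hy2]
  have h2' : m * (η * √σ * ‖q‖) ^ 2 ≤ η ^ 2 * σ * inner ℝ a q := by rw [hx2]; linarith
  set x := η * √σ * ‖q‖
  set y := s * ‖v‖
  set F := η * |f|
  have k1 : 2 * M * x * y ≤ m / 4 * x ^ 2 + 4 * M ^ 2 / m * y ^ 2 := by
    have : 0 ≤ (m * x - 4 * M * y) ^ 2 / (4 * m) := by positivity
    have e : (m * x - 4 * M * y) ^ 2 / (4 * m) =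
      m / 4 * x ^ 2 + 4 * M ^ 2 / m * y ^ 2 - 2 * M * x * y := by field_simp; ring
    linarith
  have k2 : F * x ≤ m / 4 * x ^ 2 + 1 / m * F ^ 2 := by
    have : 0 ≤ (m * x - 2 * F) ^ 2 / (4 * m) := by positivity
    have e : (m * x - 2 * F) ^ 2 / (4 * m) =
      m / 4 * x ^ 2 + 1 / m * F ^ 2 - F * x := by field_simp; ring
    linarith
  have k3 : 2 * F * y ≤ m * y ^ 2 + 1 / m * F ^ 2 := by
    have : 0 ≤ (m * y - F) ^ 2 / m := by positivity
    have e : (m * y - F) ^ 2 / m = m * y ^ 2 + 1 / m * F ^ 2 - 2 * F * y := by field_simp; ring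
    linarith
  have e2 : 2 / m * F ^ 2 = 1 / m * F ^ 2 + 1 / m * F ^ 2 := by ring
  rw [e2, add_mul]
  linarith

/-- Pointwise lower bound where the field is merely monotone. -/
theorem caccioppoli_pointwise_of_monotone {a q v e : E} {m M η σ ψ s f W : ℝ} (hm : 0 ≤ m)
    (hM : 0 ≤ M) (he : ‖e‖ ≤ 1) (hη : 0 ≤ η) (hη1 : η ≤ 1) (hσ : 0 ≤ σ) (hσ1 : σ ≤ 1) (hs : 0 ≤ s)
    (hψ : ψ ^ 2 ≤ σ * s ^ 2) (ha : ‖a‖ ≤ M * ‖q‖) (ha' : 0 ≤ inner ℝ a q)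
    (hq : η * ‖q‖ ≤ W) (hv : s * ‖v‖ ≤ W) (hf : |f| ≤ W) :
    m / 2 * (η ^ 2 * σ * ‖q‖ ^ 2) ≤
      inner ℝ a ((η ^ 2 * σ) • q + (2 * η * ψ) • v) +
        f * inner ℝ ((η ^ 2 * σ) • q + (2 * η * ψ) • v) e + (m + 2 * M + 3) * W ^ 2 := by
  have h1 := (abs_le.1 (abs_caccioppoli_terms_le (v := v) (f := f) hM he hη hσ hσ1 hs hψ ha)).1
  have hrr : √σ ^ 2 = σ := Real.sq_sqrt hσ
  have hr1 : √σ ≤ 1 := Real.sqrt_le_one.2 hσ1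
  rw [inner_add_right, inner_smul_right a q]
  have h2 : 0 ≤ η ^ 2 * σ * inner ℝ a q := by positivity
  have hx2 : (η * √σ * ‖q‖) ^ 2 = η ^ 2 * σ * ‖q‖ ^ 2 := by rw [mul_pow, mul_pow, hrr]
  rw [← hx2]
  have hx : η * √σ * ‖q‖ ≤ W := by
    refine le_trans ?_ hq
    calc η * √σ * ‖q‖ ≤ η * 1 * ‖q‖ := by gcongr
      _ = _ := by ring
  have hF : η * |f| ≤ W := (mul_le_of_le_one_left (abs_nonneg _) hη1).trans hf
  have hx0 : 0 ≤ η * √σ * ‖q‖ := by positivity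
  have hy0 : 0 ≤ s * ‖v‖ := by positivity
  have hF0 : 0 ≤ η * |f| := by positivity
  set x := η * √σ * ‖q‖
  set y := s * ‖v‖
  set F := η * |f|
  have hW : 0 ≤ W := hy0.trans hv
  have k0 : m * x ^ 2 ≤ m * W ^ 2 := by gcongr
  have k1 : 2 * M * x * y ≤ 2 * M * W * W := by gcongr
  have k2 : F * x ≤ W * W := by gcongr
  have k3 : 2 * F * y ≤ 2 * W * W := by gcongr
  have k4 : 0 ≤ m * x ^ 2 := by positivity
  nlinarith

end Caccioppoli

section ApproximatingSequence

open Filter Topology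

variable {E : Type*} [NormedAddCommGroup E] [InnerProductSpace ℝ E] [FiniteDimensional ℝ E]
  [MeasurableSpace E] [BorelSpace E]

variable {V : Type*} [NormedAddCommGroup V] [NormedSpace ℝ V]

/-- The `L²` modulus of continuity in direction `e`. -/
def ltwoModulus (F : E → V) (e : E) (h : ℝ) : ℝ :=
  ⨆ t : Icc (-h) h, ltwo volume fun x => F (x + (t : ℝ) • e) - F x

theorem ltwo_translate_sub_le_modulus {F : E → V} (hF : MemLp F 2 volume) (e : E) {t h : ℝ}
    (ht : |t| ≤ h) : ltwo volume (fun x => F (x + t • e) - F x) ≤ ltwoModulus F e h := by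
  refine le_ciSup (f := fun t : Icc (-h) h => ltwo volume fun x => F (x + (t : ℝ) • e) - F x)
    ⟨2 * ltwo volume F, ?_⟩ ⟨t, abs_le.1 ht⟩
  rintro _ ⟨t, rfl⟩
  refine (ltwo_sub_le (hF.comp_add_right _) hF).trans ?_
  rw [ltwo_comp_add_right hF]
  linarith

theorem tendsto_ltwoModulus {F : E → V} (hF : MemLp F 2 volume) (e : E) :
    Tendsto (ltwoModulus F e) (𝓝[>] 0) (𝓝 0) := by
  rw [Metric.tendsto_nhds]
  intro ε hε
  have h1 := tendsto_ltwo_translate_sub hF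
  have h2 : Tendsto (fun t : ℝ => t • e) (𝓝 0) (𝓝 0) := by
    have : Continuous fun t : ℝ => t • e := by fun_prop
    simpa using this.tendsto 0
  have h3 := Metric.tendsto_nhds.1 (h1.comp h2) (ε / 2) (by positivity)
  obtain ⟨δ, hδ, h4⟩ := Metric.eventually_nhds_iff.1 h3
  filter_upwards [Ioo_mem_nhdsGT hδ] with h hh
  have hne : Nonempty (Icc (-h) h) := ⟨⟨0, by simp [hh.1.le]⟩⟩
  have hle : ltwoModulus F e h ≤ ε / 2 := by
    refine ciSup_le fun t => ?_
    have := h4 (y := t) (by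
      rw [Real.dist_0_eq_abs]; exact (abs_le.2 t.2).trans_lt hh.2)
    rw [Real.dist_0_eq_abs] at this
    exact (le_abs_self _).trans this.le
  have h0 : 0 ≤ ltwoModulus F e h := Real.iSup_nonneg fun t => ltwo_nonneg _
  rw [Real.dist_0_eq_abs, abs_of_nonneg h0]
  linarith

variable {A : E → E} {m M : ℝ} {B : Set E} {f : E → ℝ} {g : E → E} {φ Θ η : E → ℝ} {e : E} {h : ℝ}

theorem IsTestFunction.ltwo_diffQuot_sub_inner_le (hφ : IsTestFunction φ)
    (hg : MemLp g 2 volume) (he : ‖e‖ ≤ 1) (hh : 0 < h) :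
    ltwo volume (fun x => _root_.diffQuot h e φ x - inner ℝ (g x) e) ≤
      ltwo volume (fun x => gradient φ x - g x) + ltwoModulus g e h := by
  have hz := hφ.memLp_gradient
  have hw := (hφ.diffQuot h e).memLp
  have hge : MemLp (fun x => inner ℝ (g x) e) 2 volume := hg.inner_const e
  set F : E → ℝ := fun x => _root_.diffQuot h e φ x - inner ℝ (g x) e with hFdef
  have hF : MemLp F 2 volume := hw.sub hge
  obtain ⟨t, ht, htt⟩ := hφ.exists_integral_translate_sub_eq hF e h
  rw [abs_of_pos hh] at ht
  have hzt := hz.comp_add_right (t • e)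
  have h1 : ltwo volume F ^ 2 = ∫ x, F x * inner ℝ (gradient φ (x + t • e) - g x) e := by
    rw [ltwo_sq hF]
    have a1 : ∫ x, ‖F x‖ ^ 2 = ∫ x, (_root_.diffQuot h e φ x - inner ℝ (g x) e) * F x :=
      integral_congr_ae (Eventually.of_forall fun x => by
        simp only [Real.norm_eq_abs, sq_abs]; rw [sq])
    have a2 : ∫ x, _root_.diffQuot h e φ x * F x =
        ∫ x, F x * inner ℝ (gradient φ (x + t • e)) e := by
      rw [← mul_right_inj' hh.ne', ← htt, ← integral_const_mul]
      refine integral_congr_ae (Eventually.of_forall fun x => ?_)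
      simp only [_root_.diffQuot, smul_eq_mul]
      field_simp
    rw [a1, integral_sub_mul' hw hge hF, a2]
    rw [← integral_congr_ae (Eventually.of_forall fun x => mul_comm (F x) (inner ℝ (g x) e)),
      ← integral_sub (hF.integrable_mul' (hzt.inner_const e)) (hF.integrable_mul' hge)]
    refine integral_congr_ae (Eventually.of_forall fun x => ?_)
    simp only [inner_sub_left, mul_sub]
  have h2 : ltwo volume F ^ 2 ≤
      ltwo volume F * ltwo volume (fun x => gradient φ (x + t • e) - g x) := by
    rw [h1]
    refine (le_abs_self _).trans ((abs_integral_mul_le hF ((hzt.sub hg).inner_const e)).trans ?_)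
    refine mul_le_mul_of_nonneg_left (ltwo_mono (hzt.sub hg) (Eventually.of_forall fun x => ?_))
      (ltwo_nonneg _)
    exact (norm_inner_le_norm _ _).trans (mul_le_of_le_one_right (norm_nonneg _) he)
  have h3 : ltwo volume F ≤ ltwo volume (fun x => gradient φ (x + t • e) - g x) := by
    rcases (ltwo_nonneg (μ := volume) F).eq_or_lt with h0 | h0
    · rw [← h0]; exact ltwo_nonneg _
    · rw [sq] at h2; exact le_of_mul_le_mul_left h2 h0
  refine h3.trans ((ltwo_triangle hzt (hg.comp_add_right (t • e)) hg).trans ?_)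
  refine add_le_add (ltwo_comp_add_right (hz.sub hg) (t • e)).le ?_
  exact ltwo_translate_sub_le_modulus hg e ht

/-- Test functions `φ i` whose gradients approximate `g` much faster than the step `2⁻ⁱ`. -/
structure IsApproxSeq (A : E → E) (f : E → ℝ) (g : E → E) (η : E → ℝ) (e : E)
    (φ : ℕ → E → ℝ) (τ : ℕ → ℝ) : Prop where
  test : ∀ i, IsTestFunction (φ i)
  close : ∀ i, ltwo volume (fun x => gradient (φ i) x - g x) ≤ (1 / 4) ^ i
  tendsto : Tendsto τ atTop (𝓝 0)
  tendsto_diffQuot : Tendsto (fun i => ltwo volume fun x =>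
    diffQuot ((1 / 2) ^ i) e (φ i) x - inner ℝ (g x) e) atTop (𝓝 0)
  weak : ∀ᶠ i in atTop, ∀ Θ : E → ℝ, IsTestFunction Θ → tsupport Θ ⊆ tsupport η →
    |(∫ x, inner ℝ (diffQuot ((1 / 2) ^ i) e (fun y => A (gradient (φ i) y)) x) (gradient Θ x)) +
      ∫ x, f x * inner ℝ (gradient Θ x) e| ≤ τ i * ltwo volume (gradient Θ)

theorem tendsto_half_pow : Tendsto (fun i : ℕ => ((1 : ℝ) / 2) ^ i) atTop (𝓝[>] 0) :=
  tendsto_nhdsWithin_iff.2 ⟨tendsto_pow_atTop_nhds_zero_of_lt_one (by norm_num) (by norm_num),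
    Eventually.of_forall fun i => by simp⟩

theorem IsWeakGradient.exists_approxSeq (H : IsWeakGradient A m M B f g) (hη : IsTestFunction η)
    (hηB : tsupport η ⊆ B) (he : ‖e‖ ≤ 1) : ∃ φ τ, IsApproxSeq A f g η e φ τ := by
  choose φ hφ hφg using fun i : ℕ => H.approx ((1 / 4) ^ i) (by positivity)
  have h4 : Tendsto (fun i : ℕ => ((1 : ℝ) / 4) ^ i) atTop (𝓝 0) :=
    tendsto_pow_atTop_nhds_zero_of_lt_one (by norm_num) (by norm_num)
  have h2 := tendsto_half_pow.mono_right nhdsWithin_le_nhds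
  refine ⟨φ, fun i => 2 * M * (1 / 2) ^ i + ltwoModulus f e ((1 / 2) ^ i), hφ, hφg, ?_, ?_, ?_⟩
  · simpa using (h2.const_mul (2 * M)).add ((tendsto_ltwoModulus H.memLp_rhs e).comp tendsto_half_pow)
  · refine squeeze_zero (fun i => ltwo_nonneg _)
      (fun i => (hφ i).ltwo_diffQuot_sub_inner_le H.memLp he (by positivity)) ?_
    simpa using (squeeze_zero (fun i => ltwo_nonneg _) hφg h4).add
      ((tendsto_ltwoModulus H.memLp e).comp tendsto_half_pow)
  · obtain ⟨δ, hδ, hδB⟩ := hη.compact.isCompact.exists_cthickening_subset_open H.isOpen hηB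
    filter_upwards [h2.eventually (gt_mem_nhds hδ)] with i hi Θ hΘ hΘη
    have hpos : (0 : ℝ) < (1 / 2) ^ i := by positivity
    refine (H.abs_integral_diffQuot_le (hφ i) hpos he hΘ (hΘη.trans hηB) (fun x hx => ?_)
      (fun t ht => ltwo_translate_sub_le_modulus H.memLp_rhs e ht)).trans ?_
    · refine hδB (mem_cthickening_of_dist_le _ x _ _ (hΘη hx) ?_)
      rw [dist_eq_norm, add_sub_cancel_left, norm_smul, Real.norm_eq_abs, abs_of_pos hpos]
      exact (mul_le_of_le_one_right hpos.le he).trans hi.le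
    · refine mul_le_mul_of_nonneg_right (add_le_add ?_ le_rfl) (ltwo_nonneg _)
      rw [div_le_iff₀ hpos]
      have : (1 / 2 : ℝ) ^ i * (1 / 2) ^ i = (1 / 4) ^ i := by rw [← mul_pow]; norm_num
      rw [mul_assoc (2 * M), this]
      exact mul_le_mul_of_nonneg_left (hφg i) (by linarith [H.nonneg])

end ApproximatingSequence

section SecondOrderBound

open Filter Topology

variable {E : Type*} [NormedAddCommGroup E] [InnerProductSpace ℝ E] [FiniteDimensional ℝ E]
  [MeasurableSpace E] [BorelSpace E]

variable {A : E → E} {m M N : ℝ} {B : Set E} {f : E → ℝ} {g : E → E} {φ Θ η w : E → ℝ} {e : E}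
  {h : ℝ} {Ψ σ : ℝ → ℝ}

namespace IsTestFunction

theorem sq_mul_comp (hη : IsTestFunction η) (hw : IsTestFunction w) (hΨ : ContDiff ℝ 1 Ψ) :
    IsTestFunction fun x => η x ^ 2 * Ψ (w x) := by
  have := hη.mul (hη.contDiff.mul (hΨ.comp hw.contDiff))
  simpa [sq, mul_assoc] using this

theorem gradient_sq_mul_comp (hη : IsTestFunction η) (hw : IsTestFunction w)
    (hσ : ∀ t, HasDerivAt Ψ (σ t) t) (x : E) :
    gradient (fun x => η x ^ 2 * Ψ (w x)) x =
      (η x ^ 2 * σ (w x)) • gradient w x + (2 * η x * Ψ (w x)) • gradient η x := by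
  have h1 := (hη.hasGradientAt x).mul' (hη.hasGradientAt x)
  have h2 := h1.mul' ((hσ (w x)).comp_hasGradientAt (hw.hasGradientAt x))
  have h3 : (fun x => η x ^ 2 * Ψ (w x)) = fun y => η y * η y * Ψ (w y) := by
    funext y; rw [sq]
  rw [h3, h2.gradient]
  module

theorem tsupport_sq_mul_comp : tsupport (fun x => η x ^ 2 * Ψ (w x)) ⊆ tsupport η :=
  closure_mono fun x hx h0 => hx (by simp [h0])

theorem memLp_smul_gradient (hη : IsTestFunction η) (hw : IsTestFunction w) :
    MemLp (fun x => η x • gradient w x) 2 volume :=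
  (hη.continuous.smul hw.continuous_gradient).memLp_of_hasCompactSupport hη.compact.smul_right

theorem ltwo_gradient_sq_mul_comp_le (hη : IsTestFunction η) (hw : IsTestFunction w)
    (hσ : ∀ t, HasDerivAt Ψ (σ t) t) (h0 : ∀ t, 0 ≤ σ t) (h1 : ∀ t, σ t ≤ 1)
    (hΨ : ∀ t, |Ψ t| ≤ |t|) (hη0 : ∀ x, 0 ≤ η x) (hη1 : ∀ x, η x ≤ 1)
    (hN : ∀ x, ‖gradient η x‖ ≤ N) :
    ltwo volume (gradient fun x => η x ^ 2 * Ψ (w x)) ≤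
      ltwo volume (fun x => η x • gradient w x) + 2 * N * ltwo volume w := by
  have hN0 : 0 ≤ N := (norm_nonneg _).trans (hN 0)
  have hm1 := hη.memLp_smul_gradient hw
  have hm2 : MemLp (fun x => (2 * N) • w x) 2 volume := hw.memLp.const_smul (2 * N)
  have key : ltwo volume (gradient fun x => η x ^ 2 * Ψ (w x)) ≤
      ltwo volume fun x => ‖η x • gradient w x‖ + ‖(2 * N) • w x‖ := by
    refine ltwo_mono (hm1.norm.add hm2.norm) (Eventually.of_forall fun x => ?_)
    rw [gradient_sq_mul_comp hη hw hσ]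
    refine (norm_add_le _ _).trans ?_
    rw [Real.norm_of_nonneg (by positivity : 0 ≤ ‖η x • gradient w x‖ + ‖(2 * N) • w x‖)]
    rw [norm_smul, norm_smul, norm_smul, norm_smul, Real.norm_eq_abs, Real.norm_eq_abs,
      Real.norm_eq_abs, Real.norm_eq_abs, Real.norm_eq_abs, abs_mul, abs_mul, abs_mul, abs_mul,
      abs_of_nonneg (hη0 x), abs_of_nonneg (h0 (w x)), abs_of_nonneg hN0,
      abs_of_nonneg (sq_nonneg (η x)), abs_two]
    refine add_le_add ?_ ?_
    · have : η x ^ 2 * σ (w x) ≤ η x := by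
        calc η x ^ 2 * σ (w x) ≤ η x ^ 2 * 1 := by gcongr; exact h1 _
          _ = η x * η x := by ring
          _ ≤ η x * 1 := by gcongr; exacts [hη0 x, hη1 x]
          _ = η x := mul_one _
      gcongr
    · calc 2 * η x * |Ψ (w x)| * ‖gradient η x‖ ≤ 2 * 1 * |w x| * N := by
            have := hΨ (w x)
            have := hη1 x
            gcongr
            · exact hN x
        _ = _ := by ring
  refine key.trans ((ltwo_add_le hm1.norm hm2.norm).trans ?_)
  rw [ltwo_norm, ltwo_norm, ltwo_smul, abs_of_nonneg (by positivity : 0 ≤ 2 * N)]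

end IsTestFunction

theorem ltwo_diffQuot_le (hφ : IsTestFunction φ) (he : ‖e‖ ≤ 1) (hh : 0 < h) :
    ltwo volume (diffQuot h e φ) ≤ ltwo volume (gradient φ) := by
  have h1 : ltwo volume (diffQuot h e φ) =
      h⁻¹ * ltwo volume (fun x => φ (x + h • e) - φ x) := by
    have := ltwo_smul (μ := volume) h⁻¹ (fun x => φ (x + h • e) - φ x)
    rw [abs_of_pos (inv_pos.2 hh)] at this
    exact this
  rw [h1, inv_mul_le_iff₀ hh]
  refine (hφ.ltwo_translate_sub_le e h).trans ?_
  rw [abs_of_pos hh]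
  refine mul_le_mul_of_nonneg_left (ltwo_mono hφ.memLp_gradient (Eventually.of_forall fun x => ?_))
    hh.le
  exact (norm_inner_le_norm _ _).trans (mul_le_of_le_one_right (norm_nonneg _) he)

namespace IsWeakGradient

theorem norm_diffQuot_comp_le (H : IsWeakGradient A m M B f g) (z : E → E) (x : E) :
    ‖diffQuot h e (fun y => A (z y)) x‖ ≤ M * ‖diffQuot h e z x‖ := by
  simp only [diffQuot, norm_smul]
  calc _ ≤ ‖h⁻¹‖ * (M * ‖z (x + h • e) - z x‖) := by gcongr; exact H.lip _ _
    _ = _ := by ring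

theorem le_inner_diffQuot {c : ℝ} {z : E → E} (x : E)
    (hc : c * ‖z (x + h • e) - z x‖ ^ 2 ≤
      inner ℝ (A (z (x + h • e)) - A (z x)) (z (x + h • e) - z x)) :
    c * ‖diffQuot h e z x‖ ^ 2 ≤ inner ℝ (diffQuot h e (fun y => A (z y)) x) (diffQuot h e z x) := by
  simp only [diffQuot, norm_smul, inner_smul_left, inner_smul_right, Real.norm_eq_abs, mul_pow,
    sq_abs, conj_trivial]
  have := mul_le_mul_of_nonneg_left hc (mul_self_nonneg h⁻¹)
  linarith

end IsWeakGradient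

theorem IsTestFunction.memLp_mul (hη : IsTestFunction η) (hη0 : ∀ x, 0 ≤ η x) (hη1 : ∀ x, η x ≤ 1)
    (hf : MemLp f 2 volume) : MemLp (fun x => η x * f x) 2 volume := by
  refine hf.of_le (hη.continuous.aestronglyMeasurable.mul hf.1) (Eventually.of_forall fun x => ?_)
  rw [norm_mul, Real.norm_of_nonneg (hη0 x)]
  exact mul_le_of_le_one_left (norm_nonneg _) (hη1 x)

theorem ltwo_mul_le_of_le_one (hη0 : ∀ x, 0 ≤ η x) (hη1 : ∀ x, η x ≤ 1)
    (hf : MemLp f 2 volume) : ltwo volume (fun x => η x * f x) ≤ ltwo volume f := by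
  refine ltwo_mono hf (Eventually.of_forall fun x => ?_)
  rw [norm_mul, Real.norm_of_nonneg (hη0 x)]
  exact mul_le_of_le_one_left (norm_nonneg _) (hη1 x)

/-- Energy estimate for a uniformly elliptic linear inequality. -/
theorem energy_le {a : E → E} (hm : 0 < m) (hM : 0 ≤ M) (hη : IsTestFunction η)
    (hw : IsTestFunction w) (hη0 : ∀ x, 0 ≤ η x) (hη1 : ∀ x, η x ≤ 1) (he : ‖e‖ ≤ 1)
    (hf : MemLp f 2 volume) (haL : MemLp a 2 volume) (ha : ∀ x, ‖a x‖ ≤ M * ‖gradient w x‖)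
    (ha' : ∀ x, m * ‖gradient w x‖ ^ 2 ≤ inner ℝ (a x) (gradient w x)) :
    m / 2 * ltwo volume (fun x => η x • gradient w x) ^ 2 ≤
      ((∫ x, inner ℝ (a x) (gradient (fun x => η x ^ 2 * w x) x)) +
        ∫ x, f x * inner ℝ (gradient (fun x => η x ^ 2 * w x) x) e) +
      (4 * M ^ 2 / m + m) * ltwo volume (fun x => w x • gradient η x) ^ 2 +
        2 / m * ltwo volume (fun x => η x * f x) ^ 2 := by
  have hσ : ∀ t : ℝ, HasDerivAt (fun t : ℝ => t) ((fun _ => (1 : ℝ)) t) t := fun t => hasDerivAt_id t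
  have hΘ := hη.sq_mul_comp (w := w) (Ψ := fun t => t) hw contDiff_id
  have hgr := hη.gradient_sq_mul_comp (w := w) hw hσ
  beta_reduce at hΘ hgr
  have hXL := hη.memLp_smul_gradient hw
  have hvL := hw.memLp_smul_gradient hη
  have hfL := hη.memLp_mul hη0 hη1 hf
  have i1 := haL.integrable_inner' hΘ.memLp_gradient
  have i2 := hf.integrable_mul' (hΘ.memLp_inner_gradient e)
  have i3 := (hvL.norm.integrable_sq).const_mul (4 * M ^ 2 / m + m)
  have i4 := (hfL.norm.integrable_sq).const_mul (2 / m)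
  rw [ltwo_sq hXL, ltwo_sq hvL, ltwo_sq hfL, ← integral_const_mul, ← integral_const_mul,
    ← integral_const_mul, ← integral_add' i1 i2, ← integral_add' (i1.add i2) i3,
    ← integral_add' ((i1.add i2).add i3) i4]
  refine integral_mono ((hXL.norm.integrable_sq).const_mul (m / 2)) (((i1.add i2).add i3).add i4)
    fun x => ?_
  have := caccioppoli_pointwise (a := a x) (q := gradient w x) (v := gradient η x)
    (ψ := w x) (s := |w x|) (f := f x) hm hM he (hη0 x) zero_le_one le_rfl (abs_nonneg _)
    (by rw [sq_abs, one_mul]) (ha x) (ha' x)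
  simp only [Pi.add_apply]
  rw [hgr]
  simp only [norm_smul, norm_mul, mul_pow, Real.norm_eq_abs, sq_abs, mul_one] at this ⊢
  exact this

theorem le_of_sq_le_add {X b : ℝ} (hm : 0 < m) (hb : 0 ≤ b) (h : m / 2 * X ^ 2 ≤ X + b) :
    X ≤ max 1 (2 * (1 + b) / m) := by
  rcases le_total X 1 with hX1 | hX1
  · exact hX1.trans (le_max_left _ _)
  · refine le_trans ?_ (le_max_right _ _)
    rw [le_div_iff₀ hm]
    have : m / 2 * X * X ≤ (1 + b) * X := by nlinarith
    have := le_of_mul_le_mul_right this (by linarith)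
    linarith

theorem IsApproxSeq.ltwo_gradient_le {φ : ℕ → E → ℝ} {τ : ℕ → ℝ} (S : IsApproxSeq A f g η e φ τ)
    (hg : MemLp g 2 volume) (i : ℕ) : ltwo volume (gradient (φ i)) ≤ ltwo volume g + 1 := by
  have h4 : (1 / 4 : ℝ) ^ i ≤ 1 := pow_le_one₀ (by norm_num) (by norm_num)
  have := ltwo_le_add_sub (S.test i).memLp_gradient hg
  have := S.close i
  linarith

theorem IsWeakGradient.ltwo_smul_gradient_diffQuot_bdd (H : IsWeakGradient A m M B f g)
    (hη : IsTestFunction η) (he : ‖e‖ ≤ 1) (hη0 : ∀ x, 0 ≤ η x) (hη1 : ∀ x, η x ≤ 1)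
    {φ : ℕ → E → ℝ} {τ : ℕ → ℝ} (S : IsApproxSeq A f g η e φ τ) :
    ∃ C, ∀ᶠ i in atTop, ltwo volume
      (fun x => η x • gradient (diffQuot ((1 / 2) ^ i) e (φ i)) x) ≤ C := by
  obtain ⟨N, hN⟩ := hη.exists_bound
  have hN0 : 0 ≤ N := (norm_nonneg _).trans (hN 0)
  set G := ltwo volume g + 1 with hGdef
  have hG : 0 ≤ G := by have := ltwo_nonneg (μ := volume) g; positivity
  have hf := H.memLp_rhs
  have hm := H.pos
  set b := 2 * N * G + (4 * M ^ 2 / m + m) * (N * G) ^ 2 + 2 / m * ltwo volume f ^ 2 with hb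
  have hb0 : 0 ≤ b := by positivity
  refine ⟨max 1 (2 * (1 + b) / m), ?_⟩
  filter_upwards [S.weak, S.tendsto.eventually (gt_mem_nhds one_pos)] with i hi hτ
  have hpos : (0 : ℝ) < (1 / 2) ^ i := by positivity
  generalize ((1 : ℝ) / 2) ^ i = h at hi hpos ⊢
  have hφ := S.test i
  have hw := hφ.diffQuot h e
  have hq := hφ.gradient_diffQuot h e
  have hzL := hφ.memLp_gradient
  have hwG : ltwo volume (diffQuot h e (φ i)) ≤ G :=
    (ltwo_diffQuot_le hφ he hpos).trans (S.ltwo_gradient_le H.memLp i)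
  have haL : MemLp (diffQuot h e (fun y => A (gradient (φ i) y))) 2 volume :=
    memLp_diffQuot (H.memLp_comp hzL)
  have hen := energy_le (a := diffQuot h e (fun y => A (gradient (φ i) y))) hm H.nonneg hη hw hη0
    hη1 he hf haL
    (fun x => by rw [hq]; exact H.norm_diffQuot_comp_le _ x)
    (fun x => by rw [hq]; exact le_inner_diffQuot x (H.mono _ _))
  generalize diffQuot h e (φ i) = w at hw hwG hen ⊢
  generalize diffQuot h e (fun y => A (gradient (φ i) y)) = a at hi hen
  have hΘ := hη.sq_mul_comp (w := w) (Ψ := fun t => t) hw contDiff_id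
  have h1 := hi _ hΘ (IsTestFunction.tsupport_sq_mul_comp (w := w) (Ψ := fun t => t))
  have h2 := hη.ltwo_gradient_sq_mul_comp_le (w := w) (Ψ := fun t => t) (σ := fun _ => 1) hw
    (fun t => hasDerivAt_id t) (fun _ => zero_le_one) (fun _ => le_rfl)
      (fun _ => le_rfl) hη0 hη1 hN
  beta_reduce at h1 h2
  have b1 : ltwo volume (fun x => w x • gradient η x) ≤ N * G := by
    refine (ltwo_mono' hw.memLp hN0 (Eventually.of_forall fun x => ?_)).trans (by gcongr)
    rw [norm_smul, mul_comm]
    exact mul_le_mul_of_nonneg_right (hN x) (norm_nonneg _)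
  have b2 := ltwo_mul_le_of_le_one hη0 hη1 hf
  refine le_of_sq_le_add hm hb0 (hen.trans ?_)
  have b3 : τ i * ltwo volume (gradient fun x => η x ^ 2 * w x) ≤
      ltwo volume (gradient fun x => η x ^ 2 * w x) :=
    mul_le_of_le_one_left (ltwo_nonneg _) hτ.le
  have b4 : 2 * N * ltwo volume w ≤ 2 * N * G := by gcongr
  have c1 : (4 * M ^ 2 / m + m) * ltwo volume (fun x => w x • gradient η x) ^ 2 ≤
      (4 * M ^ 2 / m + m) * (N * G) ^ 2 := by
    have := ltwo_nonneg (μ := volume) (fun x => w x • gradient η x)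
    gcongr
  have c2 : 2 / m * ltwo volume (fun x => η x * f x) ^ 2 ≤ 2 / m * ltwo volume f ^ 2 := by
    have := ltwo_nonneg (μ := volume) (fun x => η x * f x)
    gcongr
  have := (le_abs_self _).trans h1
  rw [hb]
  linarith

end SecondOrderBound

section Domination

open Filter Topology

variable {E : Type*} [NormedAddCommGroup E] [InnerProductSpace ℝ E] [FiniteDimensional ℝ E]
  [MeasurableSpace E] [BorelSpace E]

variable {A : E → E} {m M N : ℝ} {B : Set E} {f : E → ℝ} {g : E → E} {φ Θ η w : E → ℝ} {e : E}
  {h : ℝ}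

theorem diffQuot_smul (η : E → ℝ) (g : E → E) (x : E) :
    diffQuot h e (fun x => η x • g x) x =
      η x • diffQuot h e g x + diffQuot h e η x • g (x + h • e) := by
  simp only [diffQuot, smul_eq_mul]
  module

theorem IsTestFunction.abs_diffQuot_le (hη : IsTestFunction η) (hN : ∀ x, ‖gradient η x‖ ≤ N)
    (he : ‖e‖ ≤ 1) (hh : 0 < h) (x : E) : |_root_.diffQuot h e η x| ≤ N := by
  have hN0 : 0 ≤ N := (norm_nonneg _).trans (hN 0)
  have h1 := Convex.norm_image_sub_le_of_norm_fderiv_le (f := η) (s := univ) (C := N) (x := x)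
    (y := x + h • e) (fun y _ => hη.contDiff.differentiable (by norm_num) y)
    (fun y _ => by
      have := hN y
      rwa [gradient, LinearIsometryEquiv.norm_map] at this) convex_univ (mem_univ _) (mem_univ _)
  rw [add_sub_cancel_left, norm_smul, Real.norm_eq_abs, Real.norm_eq_abs, abs_of_pos hh] at h1
  simp only [_root_.diffQuot, smul_eq_mul, abs_mul]
  rw [abs_of_pos (inv_pos.2 hh), inv_mul_le_iff₀ hh]
  refine h1.trans ?_
  calc N * (h * ‖e‖) ≤ N * (h * 1) := by gcongr
    _ = h * N := by ring

theorem ltwo_diffQuot_le_two_mul {F : E → E} (hF : MemLp F 2 volume) (hh : 0 < h) :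
    ltwo volume (diffQuot h e F) ≤ 2 * ltwo volume F / h := by
  have h1 := ltwo_smul (μ := volume) h⁻¹ (fun x => F (x + h • e) - F x)
  have h2 := ltwo_sub_le (hF.comp_add_right (h • e)) hF
  rw [ltwo_comp_add_right hF] at h2
  rw [abs_of_pos (inv_pos.2 hh)] at h1
  have h3 : ltwo volume (diffQuot h e F) =
    ltwo volume fun x => h⁻¹ • (F (x + h • e) - F x) := rfl
  rw [h3, h1, div_eq_inv_mul]
  gcongr
  linarith

theorem exists_ltwo_tendsto_diffQuot {F : E → E} (hF : MemLp F 2 volume) (e : E) {C : ℝ}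
    (hC : ∀ i : ℕ, ltwo volume (diffQuot ((1 / 2) ^ i) e F) ≤ C) :
    ∃ Y : E → E, MemLp Y 2 volume ∧
      Tendsto (fun i : ℕ => ltwo volume fun x => diffQuot ((1 / 2) ^ i) e F x - Y x) atTop (𝓝 0) := by
  let T : ℕ → Lp E 2 (volume : Measure E) →ₗ[ℝ] Lp E 2 (volume : Measure E) :=
    fun i => (lpTranslate (((1 / 2 : ℝ) ^ i) • e)).toLinearMap
  have hD : ∀ i, MemLp (diffQuot ((1 / 2) ^ i) e F) 2 volume := fun i => IsWeakGradient.memLp_diffQuot hF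
  have hTX : ∀ i, (2 : ℝ) ^ i • (T i (hF.toLp F) - hF.toLp F) = (hD i).toLp _ := by
    intro i
    change (2 : ℝ) ^ i • (lpTranslate (((1 / 2 : ℝ) ^ i) • e) (hF.toLp F) - hF.toLp F) = _
    rw [lpTranslate_toLp]
    rw [← MemLp.toLp_sub, ← MemLp.toLp_const_smul]
    congr 1
    funext x
    simp [diffQuot]
  have hnorm : ∀ {G : E → E} (hG : MemLp G 2 volume), ‖hG.toLp G‖ = ltwo volume G :=
    fun hG => Lp.norm_toLp _ hG
  obtain ⟨y, hy⟩ := exists_tendsto_dyadic_diffQuot T (x := hF.toLp F) (C := C)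
    (fun i x => (lpTranslate _).norm_map x)
    (fun i j x => by
      change lpTranslate _ (lpTranslate _ x) = lpTranslate _ (lpTranslate _ x)
      rw [lpTranslate_lpTranslate, lpTranslate_lpTranslate, add_comm])
    (fun i x => by
      change lpTranslate _ x = lpTranslate _ (lpTranslate _ x)
      have : (1 / 2 : ℝ) ^ i = (1 / 2) ^ (i + 1) + (1 / 2) ^ (i + 1) := by rw [pow_succ]; ring
      rw [lpTranslate_lpTranslate, ← add_smul, ← this])
    (fun i => by rw [hTX, hnorm]; exact hC i)
  refine ⟨y, Lp.memLp y, ?_⟩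
  have h1 := tendsto_iff_norm_sub_tendsto_zero.1 hy
  refine h1.congr fun i => ?_
  have h2 := hnorm ((hD i).sub (Lp.memLp y))
  rw [MemLp.toLp_sub (hD i) (Lp.memLp y), Lp.toLp_coeFn] at h2
  rw [hTX, h2]
  rfl

theorem IsWeakGradient.exists_dominated (H : IsWeakGradient A m M B f g)
    (hη : IsTestFunction η) (he : ‖e‖ ≤ 1) (hη0 : ∀ x, 0 ≤ η x) (hη1 : ∀ x, η x ≤ 1)
    {φ : ℕ → E → ℝ} {τ : ℕ → ℝ} (S : IsApproxSeq A f g η e φ τ) :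
    ∃ (W : E → ℝ) (R : ℕ → E → ℝ), MemLp W 2 volume ∧ (∀ i, MemLp (R i) 2 volume) ∧
      (∀ x, 0 ≤ W x) ∧ (∀ i x, 0 ≤ R i x) ∧
      Tendsto (fun i => ltwo volume (R i)) atTop (𝓝 0) ∧
      ∀ i x, η x * ‖gradient (diffQuot ((1 / 2) ^ i) e (φ i)) x‖ ≤ W x + R i x := by
  obtain ⟨N, hN⟩ := hη.exists_bound
  have hN0 : 0 ≤ N := (norm_nonneg _).trans (hN 0)
  have hg := H.memLp
  have hF : MemLp (fun x => η x • g x) 2 volume := by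
    refine hg.of_le (hη.continuous.aestronglyMeasurable.smul hg.1) (Eventually.of_forall fun x => ?_)
    rw [norm_smul, Real.norm_of_nonneg (hη0 x)]
    exact mul_le_of_le_one_left (norm_nonneg _) (hη1 x)
  set D : ℕ → E → E := fun i x => gradient (φ i) x - g x with hDdef
  have hD : ∀ i, MemLp (D i) 2 volume := fun i => (S.test i).memLp_gradient.sub hg
  have hpos : ∀ i : ℕ, (0 : ℝ) < (1 / 2) ^ i := fun i => by positivity
  have hDq : ∀ i, ltwo volume (diffQuot ((1 / 2) ^ i) e (D i)) ≤ 2 * (1 / 2) ^ i := fun i => by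
    refine (ltwo_diffQuot_le_two_mul (hD i) (hpos i)).trans ?_
    rw [div_le_iff₀ (hpos i), mul_assoc, ← mul_pow]
    norm_num
    simpa using S.close i
  have hz : ∀ i x, gradient (diffQuot ((1 / 2) ^ i) e (φ i)) x =
      diffQuot ((1 / 2) ^ i) e g x + diffQuot ((1 / 2) ^ i) e (D i) x := by
    intro i x
    rw [(S.test i).gradient_diffQuot]
    simp only [diffQuot, hDdef]
    module
  have hlip : ∀ (i : ℕ) (x : E), |diffQuot ((1 / 2) ^ i) e η x| ≤ N :=
    fun i x => hη.abs_diffQuot_le hN he (hpos i) x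
  obtain ⟨C, hC⟩ := H.ltwo_smul_gradient_diffQuot_bdd hη he hη0 hη1 S
  have hYb : ∀ᶠ i : ℕ in atTop, ltwo volume (diffQuot ((1 / 2) ^ i) e fun x => η x • g x) ≤
      C + (2 + N * ltwo volume g) := by
    filter_upwards [hC] with i hi
    have a1 := hη.memLp_smul_gradient ((S.test i).diffQuot ((1 / 2) ^ i) e)
    have a2 : MemLp (diffQuot ((1 / 2) ^ i) e (D i)) 2 volume := memLp_diffQuot (hD i)
    have a3 : MemLp (fun x => N • g (x + (1 / 2 : ℝ) ^ i • e)) 2 volume :=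
      (hg.comp_add_right _).const_smul N
    have a4 : ltwo volume (diffQuot ((1 / 2) ^ i) e fun x => η x • g x) ≤ ltwo volume fun x =>
        ‖η x • gradient (diffQuot ((1 / 2) ^ i) e (φ i)) x‖ +
          (‖diffQuot ((1 / 2) ^ i) e (D i) x‖ + ‖N • g (x + (1 / 2 : ℝ) ^ i • e)‖) := by
      refine ltwo_mono (a1.norm.add (a2.norm.add a3.norm)) (Eventually.of_forall fun x => ?_)
      rw [Real.norm_of_nonneg (by positivity), diffQuot_smul]
      have e1 : η x • diffQuot ((1 / 2) ^ i) e g x =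
          η x • gradient (diffQuot ((1 / 2) ^ i) e (φ i)) x -
            η x • diffQuot ((1 / 2) ^ i) e (D i) x := by
        rw [hz]; module
      refine (norm_add_le _ _).trans ?_
      rw [e1]
      have e2 := norm_sub_le (η x • gradient (diffQuot ((1 / 2) ^ i) e (φ i)) x)
        (η x • diffQuot ((1 / 2) ^ i) e (D i) x)
      have e3 : ‖η x • diffQuot ((1 / 2) ^ i) e (D i) x‖ ≤ ‖diffQuot ((1 / 2) ^ i) e (D i) x‖ := by
        rw [norm_smul, Real.norm_of_nonneg (hη0 x)]
        exact mul_le_of_le_one_left (norm_nonneg _) (hη1 x)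
      have e4 : ‖diffQuot ((1 / 2) ^ i) e η x • g (x + (1 / 2 : ℝ) ^ i • e)‖ ≤
          ‖N • g (x + (1 / 2 : ℝ) ^ i • e)‖ := by
        rw [norm_smul, norm_smul, Real.norm_eq_abs, Real.norm_of_nonneg hN0]
        exact mul_le_mul_of_nonneg_right (hlip i x) (norm_nonneg _)
      linarith
    have a5 : ltwo volume _ ≤ ltwo volume _ + ltwo volume fun x =>
        ‖diffQuot ((1 / 2) ^ i) e (D i) x‖ + ‖N • g (x + (1 / 2 : ℝ) ^ i • e)‖ :=
      ltwo_add_le a1.norm (a2.norm.add a3.norm)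
    have a6 := ltwo_add_le a2.norm a3.norm
    rw [ltwo_norm] at a5
    rw [ltwo_norm, ltwo_norm, ltwo_smul, abs_of_nonneg hN0, ltwo_comp_add_right hg] at a6
    have a7 : (1 / 2 : ℝ) ^ i ≤ 1 := pow_le_one₀ (by norm_num) (by norm_num)
    have := hDq i
    linarith
  obtain ⟨I, hI⟩ := eventually_atTop.1 hYb
  obtain ⟨Y, hY, hYlim⟩ := exists_ltwo_tendsto_diffQuot hF e
    (C := max (C + (2 + N * ltwo volume g)) (2 * ltwo volume (fun x => η x • g x) / (1 / 2) ^ I))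
    (fun i => by
      rcases le_total I i with hi | hi
      · exact (hI i hi).trans (le_max_left _ _)
      · refine ((ltwo_diffQuot_le_two_mul hF (hpos i)).trans ?_).trans (le_max_right _ _)
        have := ltwo_nonneg (μ := volume) (fun x => η x • g x)
        have : (1 / 2 : ℝ) ^ I ≤ (1 / 2) ^ i :=
          pow_le_pow_of_le_one (by norm_num) (by norm_num) hi
        gcongr)
  have r1 : ∀ i, MemLp (fun x => ‖diffQuot ((1 / 2) ^ i) e (D i) x‖) 2 volume :=
    fun i => (memLp_diffQuot (hD i)).norm
  have r2 : ∀ i : ℕ, MemLp (fun x => ‖diffQuot ((1 / 2) ^ i) e (fun x => η x • g x) x - Y x‖) 2 volume :=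
    fun i => ((memLp_diffQuot hF).sub hY).norm
  have r3' : ∀ i : ℕ, MemLp (fun x => g (x + (1 / 2 : ℝ) ^ i • e) - g x) 2 volume :=
    fun i => (hg.comp_add_right _).sub hg
  have r3 : ∀ i : ℕ, MemLp (fun x => N * ‖g (x + (1 / 2 : ℝ) ^ i • e) - g x‖) 2 volume :=
    fun i => (r3' i).norm.const_mul N
  refine ⟨fun x => ‖Y x‖ + N * ‖g x‖, fun i x => ‖diffQuot ((1 / 2) ^ i) e (D i) x‖ +
    ‖diffQuot ((1 / 2) ^ i) e (fun x => η x • g x) x - Y x‖ +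
    N * ‖g (x + (1 / 2 : ℝ) ^ i • e) - g x‖, hY.norm.add (hg.norm.const_mul N),
    fun i => ((r1 i).add (r2 i)).add (r3 i), fun x => by positivity, fun i x => by positivity, ?_, ?_⟩
  · have h2 := tendsto_half_pow.mono_right nhdsWithin_le_nhds
    have l1 : Tendsto (fun i : ℕ => ltwo volume (diffQuot ((1 / 2) ^ i) e (D i))) atTop (𝓝 0) :=
      squeeze_zero (fun i => ltwo_nonneg _) hDq (by simpa using h2.const_mul 2)
    have l3 : Tendsto (fun i : ℕ => N * ltwo volume fun x => g (x + (1 / 2 : ℝ) ^ i • e) - g x)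
        atTop (𝓝 0) := by
      have : Tendsto (fun i : ℕ => ((1 / 2 : ℝ) ^ i) • e) atTop (𝓝 0) := by
        simpa using h2.smul_const e
      simpa only [mul_zero, Function.comp_def] using
        ((tendsto_ltwo_translate_sub hg).comp this).const_mul N
    refine squeeze_zero (fun i => ltwo_nonneg _) (fun i => ?_)
      (by simpa only [add_zero] using (l1.add hYlim).add l3)
    refine (ltwo_add_le ((r1 i).add (r2 i)) (r3 i)).trans ?_
    refine add_le_add ((ltwo_add_le (r1 i) (r2 i)).trans ?_) ?_
    · rw [ltwo_norm, ltwo_norm]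
    · have := ltwo_smul (μ := volume) N fun x => ‖g (x + (1 / 2 : ℝ) ^ i • e) - g x‖
      rw [ltwo_norm, abs_of_nonneg hN0] at this
      exact this.le
  · intro i x
    have e1 : η x • gradient (diffQuot ((1 / 2) ^ i) e (φ i)) x =
        Y x + (diffQuot ((1 / 2) ^ i) e (fun x => η x • g x) x - Y x)
          - diffQuot ((1 / 2) ^ i) e η x • g (x + (1 / 2 : ℝ) ^ i • e)
          + η x • diffQuot ((1 / 2) ^ i) e (D i) x := by
      rw [hz, diffQuot_smul]; module
    have e0 : η x * ‖gradient (diffQuot ((1 / 2) ^ i) e (φ i)) x‖ =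
        ‖η x • gradient (diffQuot ((1 / 2) ^ i) e (φ i)) x‖ := by
      rw [norm_smul, Real.norm_of_nonneg (hη0 x)]
    rw [e0, e1]
    have e3 : ‖η x • diffQuot ((1 / 2) ^ i) e (D i) x‖ ≤ ‖diffQuot ((1 / 2) ^ i) e (D i) x‖ := by
      rw [norm_smul, Real.norm_of_nonneg (hη0 x)]
      exact mul_le_of_le_one_left (norm_nonneg _) (hη1 x)
    have e4 : ‖diffQuot ((1 / 2) ^ i) e η x • g (x + (1 / 2 : ℝ) ^ i • e)‖ ≤
        N * ‖g x‖ + N * ‖g (x + (1 / 2 : ℝ) ^ i • e) - g x‖ := by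
      rw [norm_smul, Real.norm_eq_abs, ← mul_add]
      refine mul_le_mul (hlip i x) ?_ (norm_nonneg _) hN0
      have := norm_add_le (g x) (g (x + (1 / 2 : ℝ) ^ i • e) - g x)
      rwa [add_sub_cancel] at this
    have e5 := norm_add_le (Y x) (diffQuot ((1 / 2) ^ i) e (fun x => η x • g x) x - Y x)
    have e6 := norm_sub_le (Y x + (diffQuot ((1 / 2) ^ i) e (fun x => η x • g x) x - Y x))
      (diffQuot ((1 / 2) ^ i) e η x • g (x + (1 / 2 : ℝ) ^ i • e))
    refine (norm_add_le _ _).trans ?_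
    linarith

end Domination

section TruncatedEnergy

open Filter Topology

variable {E : Type*} [NormedAddCommGroup E] [InnerProductSpace ℝ E] [FiniteDimensional ℝ E]
  [MeasurableSpace E] [BorelSpace E]

variable {A : E → E} {m M N k d k₀ l L : ℝ} {B D : Set E} {f V : E → ℝ} {g a : E → E}
  {φ Θ η w : E → ℝ} {e : E} {h : ℝ}

theorem IsTestFunction.integrable_sq_mul_comp_mul_gradient (hη : IsTestFunction η)
    (hw : IsTestFunction w) {σ : ℝ → ℝ} (hσ : Continuous σ) :
    Integrable fun x => η x ^ 2 * σ (w x) * ‖gradient w x‖ ^ 2 := by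
  have hc : Continuous fun x => η x ^ 2 * σ (w x) * ‖gradient w x‖ ^ 2 :=
    ((hη.continuous.pow 2).mul (hσ.comp hw.continuous)).mul (hw.continuous_gradient.norm.pow 2)
  refine hc.integrable_of_hasCompactSupport (hη.compact.mono fun x hx h0 => hx ?_)
  simp [h0]

theorem truncated_energy_le (hl : 0 < l) (hL : 0 ≤ L) (hM : 0 ≤ M) (hd : 0 < d)
    (hη : IsTestFunction η) (hw : IsTestFunction w) (hη0 : ∀ x, 0 ≤ η x) (hη1 : ∀ x, η x ≤ 1)
    (he : ‖e‖ ≤ 1) (hf : MemLp f 2 volume) (haL : MemLp a 2 volume) (hD : MeasurableSet D)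
    (hV : MemLp V 2 volume)
    (ha : ∀ x, ‖a x‖ ≤ M * ‖gradient w x‖) (ha' : ∀ x, 0 ≤ inner ℝ (a x) (gradient w x))
    (hgood : ∀ x, k < w x → x ∉ D → ‖a x‖ ≤ L * ‖gradient w x‖ ∧
      l * ‖gradient w x‖ ^ 2 ≤ inner ℝ (a x) (gradient w x))
    (hV1 : ∀ x, η x * ‖gradient w x‖ ≤ V x) (hV2 : ∀ x, max (w x - k) 0 * ‖gradient η x‖ ≤ V x)
    (hV3 : ∀ x, |f x| ≤ V x) :
    l / 2 * (∫ x, η x ^ 2 * huberDeriv k d (w x) * ‖gradient w x‖ ^ 2) ≤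
      ((∫ x, inner ℝ (a x) (gradient (fun x => η x ^ 2 * huber k d (w x)) x)) +
        ∫ x, f x * inner ℝ (gradient (fun x => η x ^ 2 * huber k d (w x)) x) e) +
      (4 * L ^ 2 / l + l) * (∫ x, max (w x - k) 0 ^ 2 * ‖gradient η x‖ ^ 2) +
        2 / l * (∫ x in {x | k < w x}, (η x * f x) ^ 2) +
        (l + 2 * M + 3) * ∫ x in D, V x ^ 2 := by
  have hσ := hasDerivAt_huber (k := k) hd
  have hΘ := hη.sq_mul_comp (w := w) (Ψ := huber k d) hw (contDiff_huber hd)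
  have hgr := hη.gradient_sq_mul_comp (w := w) hw hσ
  have hfL := hη.memLp_mul hη0 hη1 hf
  have hS : MeasurableSet {x | k < w x} := (isOpen_lt continuous_const hw.continuous).measurableSet
  have i0 := hη.integrable_sq_mul_comp_mul_gradient hw (continuous_huberDeriv (k := k) (d := d))
  have i1 := haL.integrable_inner' hΘ.memLp_gradient
  have i2 := hf.integrable_mul' (hΘ.memLp_inner_gradient e)
  have i3 : Integrable fun x => max (w x - k) 0 ^ 2 * ‖gradient η x‖ ^ 2 := by
    have hc : Continuous fun x => max (w x - k) 0 ^ 2 * ‖gradient η x‖ ^ 2 :=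
      (((hw.continuous.sub continuous_const).max continuous_const).pow 2).mul
        (hη.continuous_gradient.norm.pow 2)
    refine hc.integrable_of_hasCompactSupport (hη.hasCompactSupport_gradient.mono
      fun x hx h0 => hx ?_)
    simp [h0]
  have i4 : Integrable ({x | k < w x}.indicator fun x => (η x * f x) ^ 2) :=
    hfL.integrable_sq.indicator hS
  have i5 : Integrable (D.indicator fun x => V x ^ 2) := hV.integrable_sq.indicator hD
  have i3' := i3.const_mul (4 * L ^ 2 / l + l)
  have i4' := i4.const_mul (2 / l)
  have i5' := i5.const_mul (l + 2 * M + 3)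
  rw [← integral_indicator hS, ← integral_indicator hD, ← integral_const_mul, ← integral_const_mul,
    ← integral_const_mul, ← integral_const_mul, ← integral_add' i1 i2,
    ← integral_add' (i1.add i2) i3', ← integral_add' ((i1.add i2).add i3') i4',
    ← integral_add' (((i1.add i2).add i3').add i4') i5']
  refine integral_mono (i0.const_mul (l / 2)) ((((i1.add i2).add i3').add i4').add i5')
    fun x => ?_
  simp only [Pi.add_apply]
  obtain ⟨b1, b2, b3, b4, b5⟩ := huber_bounds (k := k) hd (w x)
  have hI5 : 0 ≤ D.indicator (fun x => V x ^ 2) x := indicator_nonneg (fun _ _ => sq_nonneg _) _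
  have hI4 : 0 ≤ {x | k < w x}.indicator (fun x => (η x * f x) ^ 2) x :=
    indicator_nonneg (fun _ _ => sq_nonneg _) _
  have n1 : 0 ≤ max (w x - k) 0 ^ 2 * ‖gradient η x‖ ^ 2 := by positivity
  have n3 : 0 ≤ (4 * L ^ 2 / l + l) * (max (w x - k) 0 ^ 2 * ‖gradient η x‖ ^ 2) := by positivity
  have n4 : 0 ≤ 2 / l * {x | k < w x}.indicator (fun x => (η x * f x) ^ 2) x := by positivity
  have n5 : 0 ≤ (l + 2 * M + 3) * D.indicator (fun x => V x ^ 2) x := by positivity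
  rcases le_or_gt (w x) k with hwk | hwk
  · have g0 : gradient (fun x => η x ^ 2 * huber k d (w x)) x = 0 := by
      rw [hgr, huber_of_le hd hwk, huberDeriv_of_le hd hwk]; simp
    rw [g0, huberDeriv_of_le hd hwk]
    simp only [inner_zero_right, inner_zero_left, mul_zero, zero_mul, zero_add]
    linarith
  · rw [hgr]
    by_cases hxD : x ∈ D
    · have := caccioppoli_pointwise_of_monotone (v := gradient η x) hl.le hM he (hη0 x) (hη1 x) b1
        b2 (le_max_right (w x - k) 0) b5 (ha x) (ha' x) (hV1 x) (hV2 x) (hV3 x)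
      rw [indicator_of_mem hxD]
      linarith
    · have := caccioppoli_pointwise (v := gradient η x) (f := f x) hl hL he (hη0 x) b1
        b2 (le_max_right (w x - k) 0) b5 (hgood x hwk hxD).1 (hgood x hwk hxD).2
      rw [indicator_of_mem (s := {x | k < w x}) hwk, mul_pow]
      linarith

end TruncatedEnergy

section Caccioppoli

open Filter Topology

variable {E : Type*} [NormedAddCommGroup E] [InnerProductSpace ℝ E] [FiniteDimensional ℝ E]
  [MeasurableSpace E] [BorelSpace E]

variable {A : E → E} {m M N k k₀ d l L : ℝ} {B : Set E} {f η : E → ℝ} {g : E → E} {e : E}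

theorem tendsto_setIntegral_of_ltwo_tendsto {F : ℕ → E → ℝ} (hF : ∀ i, MemLp (F i) 2 volume)
    (h0 : Tendsto (fun i => ltwo volume (F i)) atTop (𝓝 0)) {c : ℝ} (hc : 0 < c) {D : ℕ → Set E}
    (hD : ∀ i, ∀ x ∈ D i, c ≤ F i x) {G : E → ℝ} (hG : Integrable G) :
    Tendsto (fun i => ∫ x in D i, G x) atTop (𝓝 0) := by
  have h1 := (ltwo_tendsto_iff hF).1 h0
  have h2 : TendstoInMeasure volume F atTop (fun _ => 0) := by
    refine tendstoInMeasure_of_tendsto_eLpNorm (p := 2) (by norm_num) (fun i => (hF i).1)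
      aestronglyMeasurable_const ?_
    simpa [Pi.sub_def] using h1
  refine hG.tendsto_setIntegral_nhds_zero ?_
  have h3 := h2 (ENNReal.ofReal c) (by simpa using hc)
  refine tendsto_of_tendsto_of_tendsto_of_le_of_le tendsto_const_nhds h3 (fun i => zero_le) ?_
  intro i
  refine measure_mono fun x hx => ?_
  have := (hD i x hx).trans (le_abs_self _)
  simp only [mem_ofPred_eq]
  rw [edist_eq_enorm_sub, sub_zero, ← ofReal_norm, Real.norm_eq_abs]
  exact ENNReal.ofReal_le_ofReal this

theorem tendsto_setIntegral_add_sq {F R : ℕ → E → ℝ} {W : E → ℝ} (hF : ∀ i, MemLp (F i) 2 volume)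
    (h0 : Tendsto (fun i => ltwo volume (F i)) atTop (𝓝 0)) {c : ℝ} (hc : 0 < c) {D : ℕ → Set E}
    (hD : ∀ i, ∀ x ∈ D i, c ≤ F i x) (hW : MemLp W 2 volume) (hR : ∀ i, MemLp (R i) 2 volume)
    (hR0 : Tendsto (fun i => ltwo volume (R i)) atTop (𝓝 0)) :
    Tendsto (fun i => ∫ x in D i, (W x + R i x) ^ 2) atTop (𝓝 0) := by
  have h1 := tendsto_setIntegral_of_ltwo_tendsto hF h0 hc hD hW.integrable_sq
  have h2 : Tendsto (fun i => 2 * (∫ x in D i, W x ^ 2) + 2 * ltwo volume (R i) ^ 2) atTop (𝓝 0) := by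
    simpa using (h1.const_mul 2).add ((hR0.pow 2).const_mul 2)
  refine squeeze_zero (fun i => integral_nonneg fun x => sq_nonneg _) (fun i => ?_) h2
  have hWi := hW.integrable_sq
  have hRi := (hR i).integrable_sq
  have e1 : 2 * ltwo volume (R i) ^ 2 ≥ 2 * ∫ x in D i, R i x ^ 2 := by
    rw [ltwo_sq (hR i)]
    simp only [Real.norm_eq_abs, sq_abs]
    have := setIntegral_le_integral (s := D i) hRi (Eventually.of_forall fun x => sq_nonneg _)
    linarith
  have e2 : ∫ x in D i, (W x + R i x) ^ 2 ≤ ∫ x in D i, (2 * W x ^ 2 + 2 * R i x ^ 2) := by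
    refine integral_mono ((hW.add (hR i)).integrable_sq.integrableOn)
      ((hWi.const_mul 2).add (hRi.const_mul 2)).integrableOn fun x => ?_
    simp only
    nlinarith [sq_nonneg (W x - R i x)]
  rw [integral_add (hWi.const_mul 2).integrableOn (hRi.const_mul 2).integrableOn,
    integral_const_mul, integral_const_mul] at e2
  linarith

theorem abs_huber_le (hd : 0 < d) (hk : 0 ≤ k) (t : ℝ) : |huber k d t| ≤ |t| := by
  obtain ⟨b1, b2, b3, b4, b5⟩ := huber_bounds (k := k) hd t
  rw [abs_of_nonneg ((le_max_right _ _).trans b3)]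
  refine b4.trans (max_le ?_ (abs_nonneg _))
  have := le_abs_self t
  linarith

theorem sub_le_of_slow {g₀ g₁ z₀ z₁ e : E} {w : ℝ} (he : ‖e‖ ≤ 1) (hw : k < w)
    (h : ‖z₀‖ < k₀ ∨ ‖z₁‖ < k₀) :
    k - k₀ ≤ ‖z₀ - g₀‖ + ‖z₁ - g₁‖ + ‖g₁ - g₀‖ + |w - inner ℝ g₀ e| := by
  have h1 : inner ℝ g₀ e ≤ ‖g₀‖ :=
    (real_inner_le_norm _ _).trans (mul_le_of_le_one_right (norm_nonneg _) he)
  have h2 := le_abs_self (w - inner ℝ g₀ e)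
  rcases h with h | h
  · have := norm_sub_norm_le g₀ z₀
    rw [norm_sub_rev] at this
    have := norm_nonneg (z₁ - g₁)
    have := norm_nonneg (g₁ - g₀)
    linarith
  · have := norm_sub_norm_le g₀ g₁
    rw [norm_sub_rev] at this
    have h3 := norm_sub_norm_le g₁ z₁
    rw [norm_sub_rev] at h3
    have := norm_nonneg (z₀ - g₀)
    linarith

/-- The set where the difference quotient is large although the gradient is small at one of the
two points involved. -/
def slowSet (k k₀ h : ℝ) (e : E) (φ : E → ℝ) : Set E :=
  {x | k < diffQuot h e φ x} ∩ {x | ‖gradient φ x‖ < k₀ ∨ ‖gradient φ (x + h • e)‖ < k₀}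

theorem IsTestFunction.measurableSet_slowSet {φ : E → ℝ} (hφ : IsTestFunction φ) (k k₀ h : ℝ)
    (e : E) : MeasurableSet (slowSet k k₀ h e φ) := by
  have hc := hφ.continuous_gradient
  have hc' : Continuous fun x => gradient φ (x + h • e) := hc.comp (by fun_prop)
  exact ((isOpen_lt continuous_const (hφ.diffQuot h e).continuous).measurableSet).inter
    (((isOpen_lt hc.norm continuous_const).union (isOpen_lt hc'.norm continuous_const)).measurableSet)

theorem IsApproxSeq.tendsto_setIntegral_slowSet {φ : ℕ → E → ℝ} {τ : ℕ → ℝ}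
    (S : IsApproxSeq A f g η e φ τ) (hg : MemLp g 2 volume) (he : ‖e‖ ≤ 1) (hk : k₀ < k)
    {R : ℕ → E → ℝ} {W : E → ℝ} (hW : MemLp W 2 volume) (hR : ∀ i, MemLp (R i) 2 volume)
    (hR0 : Tendsto (fun i => ltwo volume (R i)) atTop (𝓝 0)) :
    Tendsto (fun i => ∫ x in slowSet k k₀ ((1 / 2) ^ i) e (φ i), (W x + R i x) ^ 2) atTop
      (𝓝 0) := by
  have hz : ∀ i, MemLp (fun x => gradient (φ i) x - g x) 2 volume :=
    fun i => (S.test i).memLp_gradient.sub hg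
  have hge : MemLp (fun x => inner ℝ (g x) e) 2 volume := hg.inner_const e
  have hw : ∀ i, MemLp (fun x => diffQuot ((1 / 2) ^ i) e (φ i) x - inner ℝ (g x) e) 2 volume :=
    fun i => ((S.test i).diffQuot _ _).memLp.sub hge
  have hz0 : Tendsto (fun i => ltwo volume fun x => gradient (φ i) x - g x) atTop (𝓝 0) :=
    squeeze_zero (fun i => ltwo_nonneg _) S.close
      (tendsto_pow_atTop_nhds_zero_of_lt_one (by norm_num) (by norm_num))
  have hg0 : Tendsto (fun i : ℕ => ltwo volume fun x => g (x + ((1 / 2 : ℝ) ^ i) • e) - g x) atTop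
      (𝓝 0) := by
    refine (tendsto_ltwo_translate_sub hg).comp ?_
    simpa using (tendsto_half_pow.mono_right nhdsWithin_le_nhds).smul_const e
  have hgt : ∀ i : ℕ, MemLp (fun x => g (x + ((1 / 2 : ℝ) ^ i) • e) - g x) 2 volume :=
    fun i => (hg.comp_add_right _).sub hg
  have hzt := fun i : ℕ => (hz i).comp_add_right (((1 / 2 : ℝ) ^ i) • e)
  refine tendsto_setIntegral_add_sq
    (F := fun i x => ‖gradient (φ i) x - g x‖ + ‖gradient (φ i) (x + ((1 / 2 : ℝ) ^ i) • e) -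
      g (x + ((1 / 2 : ℝ) ^ i) • e)‖ + ‖g (x + ((1 / 2 : ℝ) ^ i) • e) - g x‖ +
      |diffQuot ((1 / 2) ^ i) e (φ i) x - inner ℝ (g x) e|) (fun i => ?_) ?_ (sub_pos.2 hk) ?_ hW hR hR0
  · exact ((((hz i).norm).add (hzt i).norm).add (hgt i).norm).add (hw i).norm
  · have hsum : Tendsto (fun i => ltwo volume (fun x => gradient (φ i) x - g x) +
        ltwo volume (fun x => gradient (φ i) x - g x) +
        ltwo volume (fun x => g (x + ((1 / 2 : ℝ) ^ i) • e) - g x) +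
        ltwo volume fun x => diffQuot ((1 / 2) ^ i) e (φ i) x - inner ℝ (g x) e) atTop (𝓝 0) := by
      simpa using ((hz0.add hz0).add hg0).add S.tendsto_diffQuot
    refine squeeze_zero (fun i => ltwo_nonneg _) (fun i => ?_) hsum
    have e1 := ltwo_add_le ((((hz i).norm).add (hzt i).norm).add (hgt i).norm) (hw i).norm
    have e2 := ltwo_add_le (((hz i).norm).add (hzt i).norm) (hgt i).norm
    have e3 := ltwo_add_le ((hz i).norm) (hzt i).norm
    have e4 := ltwo_comp_add_right (hz i) (((1 / 2 : ℝ) ^ i) • e)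
    have n1 := ltwo_norm (μ := volume) fun x => diffQuot ((1 / 2) ^ i) e (φ i) x - inner ℝ (g x) e
    have n2 := ltwo_norm (μ := volume) fun x => g (x + ((1 / 2 : ℝ) ^ i) • e) - g x
    have n3 := ltwo_norm (μ := volume) fun x => gradient (φ i) x - g x
    have n4 := ltwo_norm (μ := volume) fun x => gradient (φ i) (x + ((1 / 2 : ℝ) ^ i) • e) -
      g (x + ((1 / 2 : ℝ) ^ i) • e)
    simp only [Pi.add_def, Real.norm_eq_abs] at e1 e2 e3 n1 ⊢
    linarith
  · rintro i x ⟨hx1, hx2⟩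
    exact sub_le_of_slow he hx1 hx2

theorem IsWeakGradient.caccioppoli (H : IsWeakGradient A m M B f g)
    (hη : IsTestFunction η) (hηB : tsupport η ⊆ B) (hη0 : ∀ x, 0 ≤ η x) (hη1 : ∀ x, η x ≤ 1)
    (he : ‖e‖ ≤ 1) (hk₀ : 0 ≤ k₀) (hk : k₀ < k) (hd : 0 < d) (hl : 0 < l) (hL : 0 ≤ L)
    (hA : ∀ z w, k₀ ≤ ‖z‖ → k₀ ≤ ‖w‖ →
      l * ‖z - w‖ ^ 2 ≤ inner ℝ (A z - A w) (z - w) ∧ ‖A z - A w‖ ≤ L * ‖z - w‖)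
    {δ : ℝ} (hδ : 0 < δ) :
    ∃ w : E → ℝ, IsTestFunction w ∧ ltwo volume (fun x => w x - inner ℝ (g x) e) ≤ δ ∧
      l / 2 * (∫ x, η x ^ 2 * huberDeriv k d (w x) * ‖gradient w x‖ ^ 2) ≤
        (4 * L ^ 2 / l + l) * (∫ x, max (w x - k) 0 ^ 2 * ‖gradient η x‖ ^ 2) +
        2 / l * (∫ x in {x | k < w x}, (η x * f x) ^ 2) + δ := by
  obtain ⟨φ, τ, S⟩ := H.exists_approxSeq hη hηB he
  obtain ⟨W, R, hW, hR, hW0, hR0, hRt, hWR⟩ := H.exists_dominated hη he hη0 hη1 S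
  obtain ⟨C, hC⟩ := H.ltwo_smul_gradient_diffQuot_bdd hη he hη0 hη1 S
  obtain ⟨N, hN⟩ := hη.exists_bound
  have hN0 : 0 ≤ N := (norm_nonneg _).trans (hN 0)
  have hg := H.memLp
  have hf := H.memLp_rhs
  have hge : MemLp (fun x => inner ℝ (g x) e) 2 volume := hg.inner_const e
  have hw : ∀ i, MemLp (fun x => diffQuot ((1 / 2) ^ i) e (φ i) x - inner ℝ (g x) e) 2 volume :=
    fun i => ((S.test i).diffQuot _ _).memLp.sub hge
  have hW' : MemLp (fun x => W x + N * |inner ℝ (g x) e| + |f x|) 2 volume :=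
    (hW.add (hge.norm.const_mul N)).add hf.norm
  have hR' : ∀ i, MemLp (fun x => R i x +
      N * |diffQuot ((1 / 2) ^ i) e (φ i) x - inner ℝ (g x) e|) 2 volume :=
    fun i => (hR i).add ((hw i).norm.const_mul N)
  have hR't : Tendsto (fun i => ltwo volume fun x => R i x +
      N * |diffQuot ((1 / 2) ^ i) e (φ i) x - inner ℝ (g x) e|) atTop (𝓝 0) := by
    refine squeeze_zero (fun i => ltwo_nonneg _) (fun i => ?_)
      (g := fun i => ltwo volume (R i) + N * ltwo volume fun x =>
        diffQuot ((1 / 2) ^ i) e (φ i) x - inner ℝ (g x) e)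
      (by simpa using hRt.add (S.tendsto_diffQuot.const_mul N))
    refine (ltwo_add_le (hR i) ((hw i).norm.const_mul N)).trans ?_
    gcongr
    refine ltwo_mono' (hw i) hN0 (Eventually.of_forall fun x => ?_)
    rw [norm_mul, norm_norm, Real.norm_of_nonneg hN0]
  have T1 := (S.tendsto_setIntegral_slowSet hg he hk hW' hR' hR't).const_mul (l + 2 * M + 3)
  have T2 := S.tendsto.mul_const (C + 2 * N * (ltwo volume g + 1))
  have T3 := T2.abs.add T1
  rw [zero_mul, mul_zero, abs_zero, zero_add] at T3
  have T4 := T3.eventually (gt_mem_nhds hδ)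
  have T5 := S.tendsto_diffQuot.eventually (gt_mem_nhds hδ)
  have T6 : ∀ᶠ i in atTop, 0 ≤ τ i ∨ τ i < 0 := Eventually.of_forall fun i => le_or_gt _ _
  obtain ⟨i, hi4, hi5, hiC, hiw⟩ := (T4.and (T5.and (hC.and S.weak))).exists
  refine ⟨diffQuot ((1 / 2) ^ i) e (φ i), (S.test i).diffQuot _ _, hi5.le, ?_⟩
  clear T1 T2 T3 T4 T5 T6 hR't hRt hC
  have hWR := hWR i
  have hpos : (0 : ℝ) < (1 / 2) ^ i := by positivity
  have hV := hW'.add (hR' i)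
  replace hR0 := hR0 i
  have hS := S.ltwo_gradient_le hg i
  have hφ := S.test i
  generalize ((1 : ℝ) / 2) ^ i = h at *
  have hq := hφ.gradient_diffQuot h e
  have hwT := hφ.diffQuot h e
  have hzL := hφ.memLp_gradient
  have haL : MemLp (diffQuot h e (fun y => A (gradient (φ i) y))) 2 volume :=
    memLp_diffQuot (H.memLp_comp hzL)
  have key := truncated_energy_le (k := k) (V := fun x => W x + N * |inner ℝ (g x) e| + |f x| +
      (R i x + N * |diffQuot h e (φ i) x - inner ℝ (g x) e|))
    (a := diffQuot h e (fun y => A (gradient (φ i) y))) hl hL H.nonneg hd hη hwT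
    hη0 hη1 he hf haL (hφ.measurableSet_slowSet k k₀ h e) hV
    (fun x => by rw [hq]; exact H.norm_diffQuot_comp_le _ x)
    (fun x => by
      rw [hq]
      have := le_inner_diffQuot (h := h) (e := e) x (H.mono (gradient (φ i) (x + h • e)) (gradient (φ i) x))
      have hm := H.pos
      exact le_trans (by positivity) this)
    (fun x hx hxD => by
      have hx' : k₀ ≤ ‖gradient (φ i) x‖ ∧ k₀ ≤ ‖gradient (φ i) (x + h • e)‖ := by
        by_contra hcon
        refine hxD ⟨hx, ?_⟩
        rw [mem_ofPred_eq]
        by_contra! hcon2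
        exact hcon hcon2
      rw [hq]
      refine ⟨?_, le_inner_diffQuot x (hA _ _ hx'.2 hx'.1).1⟩
      simp only [diffQuot, norm_smul]
      calc _ ≤ ‖h⁻¹‖ * (L * ‖gradient (φ i) (x + h • e) - gradient (φ i) x‖) := by
            gcongr; exact (hA _ _ hx'.2 hx'.1).2
        _ = _ := by ring)
    (fun x => by
      have := hWR x
      have : 0 ≤ N * |inner ℝ (g x) e| := by positivity
      have : 0 ≤ N * |diffQuot h e (φ i) x - inner ℝ (g x) e| := by positivity
      have := abs_nonneg (f x)
      linarith)
    (fun x => by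
      have h1 : max (diffQuot h e (φ i) x - k) 0 ≤
          |inner ℝ (g x) e| + |diffQuot h e (φ i) x - inner ℝ (g x) e| := by
        refine max_le ?_ (by positivity)
        have := le_abs_self (inner ℝ (g x) e)
        have := le_abs_self (diffQuot h e (φ i) x - inner ℝ (g x) e)
        linarith
      have h2 := mul_le_mul h1 (hN x) (norm_nonneg _) (by positivity)
      have := hW0 x
      have := hR0 x
      have := abs_nonneg (f x)
      nlinarith)
    (fun x => by
      have := hW0 x
      have := hR0 x
      have : 0 ≤ N * |inner ℝ (g x) e| := by positivity
      have : 0 ≤ N * |diffQuot h e (φ i) x - inner ℝ (g x) e| := by positivity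
      linarith)
  refine key.trans ?_
  have hΘ := hη.sq_mul_comp (w := diffQuot h e (φ i)) (Ψ := huber k d) hwT (contDiff_huber hd)
  have h1 := hiw _ hΘ IsTestFunction.tsupport_sq_mul_comp
  have h2 := hη.ltwo_gradient_sq_mul_comp_le (w := diffQuot h e (φ i)) hwT
    (hasDerivAt_huber (k := k) hd)
    (fun t => (huber_bounds hd t).1) (fun t => (huber_bounds hd t).2.1)
      (abs_huber_le hd (hk₀.trans hk.le)) hη0 hη1 hN
  have h3 : ltwo volume (diffQuot h e (φ i)) ≤ ltwo volume g + 1 :=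
    (ltwo_diffQuot_le hφ he hpos).trans hS
  have h4 : ltwo volume (gradient fun x => η x ^ 2 * huber k d (diffQuot h e (φ i) x)) ≤
      C + 2 * N * (ltwo volume g + 1) :=
    h2.trans (add_le_add hiC (mul_le_mul_of_nonneg_left h3 (by positivity)))
  have h5 : τ i * ltwo volume (gradient fun x => η x ^ 2 * huber k d (diffQuot h e (φ i) x)) ≤
      |τ i * (C + 2 * N * (ltwo volume g + 1))| := by
    rw [abs_mul]
    exact mul_le_mul (le_abs_self _) (h4.trans (le_abs_self _)) (ltwo_nonneg _) (abs_nonneg _)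
  have h6 := ((le_abs_self _).trans h1).trans h5
  linarith

end Caccioppoli

section SobolevStep

open Filter Topology

variable {E : Type*} [NormedAddCommGroup E] [InnerProductSpace ℝ E] [FiniteDimensional ℝ E]
  [MeasurableSpace E] [BorelSpace E]

variable {A : E → E} {m M k k₀ d l L : ℝ} {B : Set E} {f η w w₀ : E → ℝ} {g : E → E} {e : E}
  {q : ℝ≥0}

/-- The constant of the Gagliardo–Nirenberg–Sobolev inequality for gradients in `L²`. -/
def sobolevConst (E : Type*) [NormedAddCommGroup E] [InnerProductSpace ℝ E] [FiniteDimensional ℝ E]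
    [MeasurableSpace E] [BorelSpace E] : ℝ :=
  eLpNormLESNormFDerivOfEqInnerConst (volume : Measure E) 2

theorem sobolevConst_nonneg : 0 ≤ sobolevConst E := NNReal.coe_nonneg _

theorem IsTestFunction.eLpNorm_le {φ : E → ℝ} (hφ : IsTestFunction φ)
    (hn : 0 < Module.finrank ℝ E) (hq : (q : ℝ)⁻¹ = 2⁻¹ - (Module.finrank ℝ E : ℝ)⁻¹) :
    eLpNorm φ q volume ≤ ENNReal.ofReal (sobolevConst E * ltwo volume (gradient φ)) := by
  have h := eLpNorm_le_eLpNorm_fderiv_of_eq_inner (volume : Measure E) hφ.contDiff hφ.compact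
    (p := 2) (p' := q) (by norm_num) hn (by rw [hq]; norm_num)
  rw [ENNReal.ofReal_mul sobolevConst_nonneg, ofReal_ltwo hφ.memLp_gradient]
  have e1 : eLpNorm (fderiv ℝ φ) (2 : ℝ≥0) volume = eLpNorm (gradient φ) 2 volume := by
    refine eLpNorm_congr_norm_ae (Eventually.of_forall fun x => ?_)
    rw [gradient_eq, LinearIsometryEquiv.norm_map]
  rw [e1] at h
  refine h.trans_eq ?_
  rw [sobolevConst, ENNReal.ofReal_coe_nnreal]
  rfl

theorem IsTestFunction.gradient_mul_comp (hη : IsTestFunction η) (hw : IsTestFunction w)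
    {Ψ σ : ℝ → ℝ} (hσ : ∀ t, HasDerivAt Ψ (σ t) t) (x : E) :
    gradient (fun x => η x * Ψ (w x)) x =
      η x • (σ (w x) • gradient w x) + Ψ (w x) • gradient η x :=
  ((hη.hasGradientAt x).mul' ((hσ (w x)).comp_hasGradientAt (hw.hasGradientAt x))).gradient

theorem IsTestFunction.ltwo_gradient_mul_huber_sq_le (hη : IsTestFunction η)
    (hw : IsTestFunction w) (hd : 0 < d) :
    ltwo volume (gradient fun x => η x * huber k d (w x)) ^ 2 ≤
      2 * ltwo volume (fun x => max (w x - k) 0 • gradient η x) ^ 2 +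
        2 * ∫ x, η x ^ 2 * huberDeriv k d (w x) * ‖gradient w x‖ ^ 2 := by
  have hT : IsTestFunction fun x => η x * huber k d (w x) :=
    hη.mul ((contDiff_huber hd).comp hw.contDiff)
  have hP : MemLp (fun x => max (w x - k) 0 • gradient η x) 2 volume := by
    refine Continuous.memLp_of_hasCompactSupport ?_ (hη.hasCompactSupport_gradient.smul_left)
    exact ((hw.continuous.sub continuous_const).max continuous_const).smul hη.continuous_gradient
  have i0 := hη.integrable_sq_mul_comp_mul_gradient hw (continuous_huberDeriv (k := k) (d := d))
  have i1 := hP.norm.integrable_sq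
  rw [ltwo_sq hT.memLp_gradient, ltwo_sq hP, ← integral_const_mul, ← integral_const_mul,
    ← integral_add' (i1.const_mul 2) (i0.const_mul 2)]
  refine integral_mono hT.memLp_gradient.norm.integrable_sq ((i1.const_mul 2).add (i0.const_mul 2))
    fun x => ?_
  simp only [Pi.add_apply]
  rw [hη.gradient_mul_comp hw (hasDerivAt_huber hd)]
  obtain ⟨b1, b2, b3, b4, b5⟩ := huber_bounds (k := k) hd (w x)
  have h1 := norm_add_le (η x • (huberDeriv k d (w x) • gradient w x)) (huber k d (w x) • gradient η x)
  have h2 : ‖η x • (huberDeriv k d (w x) • gradient w x)‖ ^ 2 ≤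
      η x ^ 2 * huberDeriv k d (w x) * ‖gradient w x‖ ^ 2 := by
    rw [norm_smul, norm_smul, mul_pow, mul_pow, Real.norm_eq_abs, Real.norm_eq_abs, sq_abs, sq_abs,
      mul_assoc]
    gcongr
    nlinarith
  have h3 : ‖huber k d (w x) • gradient η x‖ ^ 2 ≤ ‖max (w x - k) 0 • gradient η x‖ ^ 2 := by
    rw [norm_smul, norm_smul, mul_pow, mul_pow, Real.norm_eq_abs, Real.norm_eq_abs, sq_abs, sq_abs]
    have : 0 ≤ huber k d (w x) := (le_max_right _ _).trans b3
    gcongr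
  have h4 := pow_le_pow_left₀ (norm_nonneg _) h1 2
  nlinarith [sq_nonneg (‖η x • (huberDeriv k d (w x) • gradient w x)‖ -
    ‖huber k d (w x) • gradient η x‖)]

/-- Constant in the truncated Sobolev inequality. -/
def energyConst (l L : ℝ) : ℝ := 6 + 16 * L ^ 2 / l ^ 2 + 8 / l ^ 2 + 4 / l

theorem le_energyConst_mul {X P Q I s : ℝ} (hl : 0 < l) (hP : 0 ≤ P) (hQ : 0 ≤ Q)
    (hs : 0 ≤ s) (h1 : X ^ 2 ≤ 2 * P ^ 2 + 2 * I)
    (h2 : l / 2 * I ≤ (4 * L ^ 2 / l + l) * P ^ 2 + 2 / l * Q ^ 2 + s ^ 2) :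
    X ≤ energyConst l L * (P + Q + s) := by
  set C := energyConst l L with hC
  have hI : 2 * I ≤ (16 * L ^ 2 / l ^ 2 + 4) * P ^ 2 + 8 / l ^ 2 * Q ^ 2 + 4 / l * s ^ 2 := by
    have := mul_le_mul_of_nonneg_left h2 (by positivity : (0 : ℝ) ≤ 4 / l)
    have e1 : 4 / l * (l / 2 * I) = 2 * I := by field_simp; norm_num
    rw [e1] at this
    refine this.trans_eq ?_
    field_simp
    ring
  have p1 : 0 ≤ 16 * L ^ 2 / l ^ 2 := by positivity
  have p2 : 0 ≤ 8 / l ^ 2 := by positivity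
  have p3 : 0 ≤ 4 / l := by positivity
  have c0 : 1 ≤ C := by rw [hC, energyConst]; linarith
  have c1 : 16 * L ^ 2 / l ^ 2 + 6 ≤ C := by rw [hC, energyConst]; linarith
  have c2 : 8 / l ^ 2 ≤ C := by rw [hC, energyConst]; linarith
  have c3 : 4 / l ≤ C := by rw [hC, energyConst]; linarith
  refine le_of_sq_le_sq ?_ (by positivity)
  have q1 := mul_le_mul_of_nonneg_right c1 (sq_nonneg P)
  have q2 := mul_le_mul_of_nonneg_right c2 (sq_nonneg Q)
  have q3 := mul_le_mul_of_nonneg_right c3 (sq_nonneg s)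
  have q4 : X ^ 2 ≤ C * (P ^ 2 + Q ^ 2 + s ^ 2) := by nlinarith
  have q5 : C * (P ^ 2 + Q ^ 2 + s ^ 2) ≤ C ^ 2 * (P + Q + s) ^ 2 := by
    have : C ≤ C ^ 2 := by nlinarith
    have : P ^ 2 + Q ^ 2 + s ^ 2 ≤ (P + Q + s) ^ 2 := by nlinarith [mul_nonneg hP hQ, mul_nonneg hP hs, mul_nonneg hQ hs]
    gcongr
  rw [mul_pow]
  exact q4.trans q5

theorem IsWeakGradient.exists_sobolev_le (H : IsWeakGradient A m M B f g)
    (hη : IsTestFunction η) (hηB : tsupport η ⊆ B) (hη0 : ∀ x, 0 ≤ η x) (hη1 : ∀ x, η x ≤ 1)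
    (he : ‖e‖ ≤ 1) (hk₀ : 0 ≤ k₀) (hk : k₀ < k) (hl : 0 < l) (hL : 0 ≤ L)
    (hA : ∀ z w, k₀ ≤ ‖z‖ → k₀ ≤ ‖w‖ →
      l * ‖z - w‖ ^ 2 ≤ inner ℝ (A z - A w) (z - w) ∧ ‖A z - A w‖ ≤ L * ‖z - w‖)
    (hn : 0 < Module.finrank ℝ E) (hq : (q : ℝ)⁻¹ = 2⁻¹ - (Module.finrank ℝ E : ℝ)⁻¹)
    {s : ℝ} (hs : 0 < s) :
    ∃ w : E → ℝ, IsTestFunction w ∧ ltwo volume (fun x => w x - inner ℝ (g x) e) ≤ s ∧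
      eLpNorm (fun x => η x * max (w x - k - s) 0) q volume ≤
        ENNReal.ofReal (sobolevConst E * energyConst l L *
          (ltwo volume (fun x => max (w x - k) 0 • gradient η x) +
            ltwo volume ({x | k < w x}.indicator fun x => η x * f x) + s)) := by
  obtain ⟨w, hw, hw1, hw2⟩ := H.caccioppoli hη hηB hη0 hη1 he hk₀ hk hs hl hL hA
    (δ := min s (s ^ 2)) (lt_min hs (by positivity))
  refine ⟨w, hw, hw1.trans (min_le_left _ _), ?_⟩
  have hS : MeasurableSet {x | k < w x} := (isOpen_lt continuous_const hw.continuous).measurableSet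
  have hT : IsTestFunction fun x => η x * huber k s (w x) :=
    hη.mul ((contDiff_huber hs).comp hw.contDiff)
  have hP : MemLp (fun x => max (w x - k) 0 • gradient η x) 2 volume := by
    refine Continuous.memLp_of_hasCompactSupport ?_ (hη.hasCompactSupport_gradient.smul_left)
    exact ((hw.continuous.sub continuous_const).max continuous_const).smul hη.continuous_gradient
  have hfL := hη.memLp_mul hη0 hη1 H.memLp_rhs
  have e1 : ∫ x, max (w x - k) 0 ^ 2 * ‖gradient η x‖ ^ 2 =
      ltwo volume (fun x => max (w x - k) 0 • gradient η x) ^ 2 := by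
    rw [ltwo_sq hP]
    simp only [norm_smul, mul_pow, Real.norm_eq_abs, sq_abs]
  have e2 : ∫ x in {x | k < w x}, (η x * f x) ^ 2 =
      ltwo volume ({x | k < w x}.indicator fun x => η x * f x) ^ 2 := by
    have hI : MemLp ({x | k < w x}.indicator fun x => η x * f x) 2 volume := hfL.indicator hS
    rw [ltwo_sq hI, ← integral_indicator hS]
    refine integral_congr_ae (Eventually.of_forall fun x => ?_)
    beta_reduce
    by_cases hx : x ∈ {x | k < w x}
    · simp only [indicator_of_mem hx, Real.norm_eq_abs, sq_abs]
    · simp [indicator_of_notMem hx]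
  rw [e1, e2] at hw2
  have g1 := hη.ltwo_gradient_mul_huber_sq_le (k := k) hw hs
  have g2 := min_le_right s (s ^ 2)
  have h4 : ltwo volume (gradient fun x => η x * huber k s (w x)) ≤ energyConst l L *
      (ltwo volume (fun x => max (w x - k) 0 • gradient η x) +
        ltwo volume ({x | k < w x}.indicator fun x => η x * f x) + s) := by
    have n1 := ltwo_nonneg (μ := volume) fun x => max (w x - k) 0 • gradient η x
    have n2 := ltwo_nonneg (μ := volume) ({x | k < w x}.indicator fun x => η x * f x)
    clear e1 e2 hP
    generalize ltwo volume (fun x => max (w x - k) 0 • gradient η x) = P at *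
    generalize ltwo volume ({x | k < w x}.indicator fun x => η x * f x) = Q at *
    generalize (∫ x, η x ^ 2 * huberDeriv k s (w x) * ‖gradient w x‖ ^ 2) = I at *
    exact le_energyConst_mul hl n1 n2 hs.le g1 (by linarith)
  refine (eLpNorm_mono fun x => ?_).trans ((hT.eLpNorm_le hn hq).trans ?_)
  · have b3 := (huber_bounds (k := k) hs (w x)).2.2.1
    rw [norm_mul, norm_mul, Real.norm_of_nonneg (le_max_right (w x - k - s) 0),
      Real.norm_of_nonneg ((le_max_right _ _).trans b3)]
    gcongr
  · rw [mul_assoc]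
    exact ENNReal.ofReal_le_ofReal (mul_le_mul_of_nonneg_left h4 sobolevConst_nonneg)

theorem eLpNorm_le_of_forall_approx {F : E → ℝ} {C : ℝ} (hC : 0 ≤ C) (hη : IsTestFunction η)
    (hF : MemLp F 2 volume) (hw₀ : MemLp w₀ 2 volume) (hwm : Measurable w₀)
    (h : ∀ s > 0, ∃ w : E → ℝ, IsTestFunction w ∧ ltwo volume (fun x => w x - w₀ x) ≤ s ∧
      eLpNorm (fun x => η x * max (w x - k - s) 0) q volume ≤
        ENNReal.ofReal (C * (ltwo volume (fun x => max (w x - k) 0 • gradient η x) +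
            ltwo volume ({x | k < w x}.indicator F) + s))) :
    eLpNorm (fun x => η x * max (w₀ x - k) 0) q volume ≤
        ENNReal.ofReal (C * (ltwo volume (fun x => max (w₀ x - k) 0 • gradient η x) +
            ltwo volume ({x | k ≤ w₀ x}.indicator F))) := by
  choose w hw hw1 hw2 using fun i : ℕ => h ((1 / 2) ^ i) (by positivity)
  obtain ⟨N, hN⟩ := hη.exists_bound
  have hN0 : 0 ≤ N := (norm_nonneg _).trans (hN 0)
  have hws : ∀ i, MemLp (fun x => w i x - w₀ x) 2 volume := fun i => (hw i).memLp.sub hw₀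
  have t0 := tendsto_half_pow.mono_right nhdsWithin_le_nhds
  have t1 : Tendsto (fun i => ltwo volume fun x => w i x - w₀ x) atTop (𝓝 0) :=
    squeeze_zero (fun i => ltwo_nonneg _) hw1 t0
  have t2 : TendstoInMeasure volume w atTop w₀ :=
    tendstoInMeasure_of_tendsto_eLpNorm (p := 2) (by norm_num) (fun i => (hw i).memLp.1) hw₀.1
      ((ltwo_tendsto_iff hws).1 t1)
  obtain ⟨ns, hns, hae⟩ := t2.exists_seq_tendsto_ae
  have t0' := t0.comp hns.tendsto_atTop
  have hS₀ : MeasurableSet {x | k ≤ w₀ x} := measurableSet_le measurable_const hwm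
  have hSi : ∀ i, MeasurableSet {x | k < w i x} := fun i =>
    (isOpen_lt continuous_const (hw i).continuous).measurableSet
  have hP : ∀ {v : E → ℝ}, MemLp v 2 volume → MemLp (fun x => max (v x - k) 0 • gradient η x) 2 volume := by
    intro v hv
    have h1 : MemLp (fun x => N * (|v x|)) 2 volume := hv.norm.const_mul N
    have h2 : MemLp (fun x => |k| * ‖gradient η x‖) 2 volume := hη.memLp_gradient.norm.const_mul _
    refine (h1.add h2).of_le ?_ (Eventually.of_forall fun x => ?_)
    · exact ((hv.1.sub aestronglyMeasurable_const).sup aestronglyMeasurable_const).smul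
        hη.continuous_gradient.aestronglyMeasurable
    · rw [norm_smul, Real.norm_of_nonneg (le_max_right _ _), Real.norm_of_nonneg (by
        simp only [Pi.add_apply]; positivity)]
      have : max (v x - k) 0 ≤ |v x| + |k| := by
        refine max_le ?_ (by positivity)
        have := le_abs_self (v x)
        have := neg_abs_le k
        linarith
      calc _ ≤ (|v x| + |k|) * ‖gradient η x‖ := by gcongr
        _ = |v x| * ‖gradient η x‖ + |k| * ‖gradient η x‖ := by ring
        _ ≤ |v x| * N + |k| * ‖gradient η x‖ := by gcongr; exact hN x
        _ = _ := by simp only [Pi.add_apply]; ring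
  have b1 : ∀ i, ltwo volume (fun x => max (w i x - k) 0 • gradient η x) ≤
      ltwo volume (fun x => max (w₀ x - k) 0 • gradient η x) +
        N * ltwo volume (fun x => w i x - w₀ x) := by
    intro i
    refine (ltwo_le_add_sub (hP (hw i).memLp) (hP hw₀)).trans ?_
    rw [add_comm]
    gcongr
    refine ltwo_mono' (hws i) hN0 (Eventually.of_forall fun x => ?_)
    rw [← sub_smul, norm_smul, mul_comm]
    gcongr
    · exact hN x
    · have := abs_max_sub_max_le_abs (w i x - k) (w₀ x - k) 0
      simpa using this
  let G : ℕ → E → ℝ := fun i => ({x | k < w i x} \ {x | k ≤ w₀ x}).indicator F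
  have hG : ∀ i, MemLp (G i) 2 volume := fun i => hF.indicator ((hSi i).diff hS₀)
  have b2 : ∀ i, ltwo volume ({x | k < w i x}.indicator F) ≤
      ltwo volume ({x | k ≤ w₀ x}.indicator F) + ltwo volume (G i) := by
    intro i
    have h1 := ltwo_add_le (hF.indicator hS₀).norm (hG i).norm
    rw [ltwo_norm, ltwo_norm] at h1
    refine (ltwo_mono ((hF.indicator hS₀).norm.add (hG i).norm)
      (Eventually.of_forall fun x => ?_)).trans h1
    simp only [Pi.add_apply, G]
    rw [Real.norm_of_nonneg (by positivity : (0 : ℝ) ≤ ‖({x | k ≤ w₀ x}.indicator F) x‖ +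
      ‖(({x | k < w i x} \ {x | k ≤ w₀ x}).indicator F) x‖)]
    by_cases h0 : x ∈ {x | k ≤ w₀ x}
    · rw [indicator_of_mem h0]
      exact (norm_indicator_le_norm_self _ _).trans (le_add_of_nonneg_right (norm_nonneg _))
    · by_cases h1 : x ∈ {x | k < w i x}
      · rw [indicator_of_mem h1, indicator_of_mem (mem_sdiff_of_mem h1 h0)]
        exact le_add_of_nonneg_left (norm_nonneg _)
      · rw [indicator_of_notMem h1, norm_zero]; positivity
  have t3 : Tendsto (fun i => ltwo volume (G (ns i)) ^ 2) atTop (𝓝 0) := by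
    have : Tendsto (fun i => ∫ x, ‖G (ns i) x‖ ^ 2) atTop (𝓝 (∫ _ : E, (0 : ℝ))) := by
      refine tendsto_integral_of_dominated_convergence (fun x => ‖F x‖ ^ 2)
        (fun i => ((hG _).norm.integrable_sq).1) hF.norm.integrable_sq (fun i =>
          Eventually.of_forall fun x => ?_) ?_
      · rw [Real.norm_of_nonneg (by positivity)]
        gcongr
        exact norm_indicator_le_norm_self _ _
      · filter_upwards [hae] with x hx
        by_cases h0 : k ≤ w₀ x
        · have : ∀ i, G i x = 0 := fun i => indicator_of_notMem (fun hc => hc.2 h0) _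
          simp [this]
        · refine tendsto_const_nhds.congr' ?_
          filter_upwards [hx.eventually (gt_mem_nhds (not_le.1 h0))] with i hi
          have : G (ns i) x = 0 := indicator_of_notMem (fun hc => lt_asymm hi hc.1) _
          simp [this]
    rw [integral_zero] at this
    exact this.congr fun i => (ltwo_sq (hG _)).symm
  have t4 : Tendsto (fun i => ltwo volume (G (ns i))) atTop (𝓝 0) := by
    have := t3.sqrt
    simpa [Real.sqrt_sq (ltwo_nonneg _)] using this
  have t5 : Tendsto (fun i => ENNReal.ofReal (C * ((ltwo volume (fun x => max (w₀ x - k) 0 • gradient η x) +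
        N * ltwo volume (fun x => w (ns i) x - w₀ x)) + (ltwo volume ({x | k ≤ w₀ x}.indicator F) +
        ltwo volume (G (ns i))) + (1 / 2) ^ ns i))) atTop
      (𝓝 (ENNReal.ofReal (C * (ltwo volume (fun x => max (w₀ x - k) 0 • gradient η x) +
            ltwo volume ({x | k ≤ w₀ x}.indicator F))))) := by
    refine (ENNReal.continuous_ofReal.tendsto _).comp ?_
    have := ((((t1.comp hns.tendsto_atTop).const_mul N).const_add
      (ltwo volume (fun x => max (w₀ x - k) 0 • gradient η x))).add
      (t4.const_add (ltwo volume ({x | k ≤ w₀ x}.indicator F)))).add t0' |>.const_mul C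
    simpa using this
  refine (Lp.eLpNorm_lim_le_liminf_eLpNorm
    (f := fun i x => η x * max (w (ns i) x - k - (1 / 2) ^ ns i) 0) (fun i => ?_) _ ?_).trans ?_
  · exact (hη.continuous.mul (((((hw _).continuous.sub continuous_const).sub
      continuous_const).max continuous_const))).aestronglyMeasurable
  · filter_upwards [hae] with x hx
    have := ((hx.sub_const k).sub t0').max (tendsto_const_nhds (x := (0 : ℝ)))
    simpa using this.const_mul (η x)
  · rw [← t5.liminf_eq]
    refine liminf_le_liminf (Eventually.of_forall fun i => (hw2 (ns i)).trans ?_)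
    refine ENNReal.ofReal_le_ofReal (mul_le_mul_of_nonneg_left ?_ hC)
    exact add_le_add (add_le_add (b1 _) (b2 _)) le_rfl

end SobolevStep

section Regularization

open Filter Topology

theorem exists_perturbed_of_strongly_monotone {H : Type*} [NormedAddCommGroup H]
    [InnerProductSpace ℝ H] [CompleteSpace H] (K : Submodule ℝ H) (hK : IsClosed (K : Set H))
    (T : H → H) {L m : ℝ} (hm : 0 < m) (hL : ∀ x y, ‖T x - T y‖ ≤ L * ‖x - y‖)
    (hT : ∀ x y, m * ‖x - y‖ ^ 2 ≤ inner ℝ (T x - T y) (x - y)) {G : H} (hG : G ∈ K) (R : H) :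
    ∃ g ∈ K, (∀ ψ ∈ K, inner ℝ (T g) ψ = inner ℝ (T G + R) ψ) ∧ m * ‖g - G‖ ≤ ‖R‖ := by
  obtain ⟨g, hg, h⟩ := exists_weak_zero_of_strongly_monotone K hK (fun x => T x - (T G + R)) hm
    (fun x y => by simpa using hL x y) (fun x y => by simpa using hT x y)
  refine ⟨g, hg, fun ψ hψ => ?_, ?_⟩
  · have := h ψ hψ
    rwa [inner_sub_left, sub_eq_zero] at this
  · have h1 := h _ (K.sub_mem hg hG)
    have h2 := hT g G
    have h3 : inner ℝ (T g - T G) (g - G) = inner ℝ R (g - G) := by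
      rw [← sub_eq_zero, ← inner_sub_left, ← h1]
      congr 1
      abel
    rw [h3] at h2
    have h4 := h2.trans (real_inner_le_norm _ _)
    rcases eq_or_lt_of_le (norm_nonneg (g - G)) with h0 | h0
    · rw [← h0, mul_zero]; exact norm_nonneg _
    · exact le_of_mul_le_mul_right (by linarith) h0

variable {E : Type*} [NormedAddCommGroup E] [InnerProductSpace ℝ E] [FiniteDimensional ℝ E]
  [MeasurableSpace E] [BorelSpace E]

variable {p ε : ℝ} {B : Set E} {f : E → ℝ} {G : E → E}

theorem IsTestFunction.add {φ ψ : E → ℝ} (hφ : IsTestFunction φ) (hψ : IsTestFunction ψ) :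
    IsTestFunction fun x => φ x + ψ x :=
  ⟨hφ.contDiff.add hψ.contDiff, hφ.compact.add hψ.compact⟩

theorem isTestFunction_zero : IsTestFunction (fun _ : E => (0 : ℝ)) :=
  ⟨contDiff_const, HasCompactSupport.zero⟩

/-- Gradients of test functions, as a subspace of `L²`. -/
def testGradients (E : Type*) [NormedAddCommGroup E] [InnerProductSpace ℝ E]
    [FiniteDimensional ℝ E] [MeasurableSpace E] [BorelSpace E] :
    Submodule ℝ (Lp E 2 (volume : Measure E)) where
  carrier := {F | ∃ φ : E → ℝ, IsTestFunction φ ∧ F =ᵐ[volume] gradient φ}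
  add_mem' := by
    rintro F₁ F₂ ⟨φ, hφ, h1⟩ ⟨ψ, hψ, h2⟩
    refine ⟨_, hφ.add hψ, ?_⟩
    filter_upwards [Lp.coeFn_add F₁ F₂, h1, h2] with x h3 h1 h2
    rw [h3, Pi.add_apply, h1, h2]
    exact ((hφ.hasGradientAt x).add' (hψ.hasGradientAt x)).gradient.symm
  zero_mem' := by
    refine ⟨_, isTestFunction_zero, ?_⟩
    filter_upwards [Lp.coeFn_zero E 2 (volume : Measure E)] with x hx
    rw [hx, Pi.zero_apply]
    exact (hasGradientAt_const x 0).gradient.symm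
  smul_mem' := by
    rintro c F ⟨φ, hφ, h1⟩
    refine ⟨_, hφ.const_mul c, ?_⟩
    filter_upwards [Lp.coeFn_smul c F, h1] with x h3 h1
    rw [h3, Pi.smul_apply, h1]
    exact ((hφ.hasGradientAt x).const_mul' c).gradient.symm

theorem norm_sub_toLp {F : Lp E 2 (volume : Measure E)} {g : E → E} (hg : MemLp g 2 volume) :
    ‖F - hg.toLp g‖ = ltwo volume fun x => F x - g x := by
  conv_lhs => rw [← Lp.toLp_coeFn F (Lp.memLp F)]
  rw [← MemLp.toLp_sub, Lp.norm_toLp]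
  rfl

theorem mem_closure_testGradients_iff {F : Lp E 2 (volume : Measure E)} :
    F ∈ (testGradients E).topologicalClosure ↔ ∀ δ > 0, ∃ φ : E → ℝ, IsTestFunction φ ∧
      ltwo volume (fun x => gradient φ x - F x) ≤ δ := by
  rw [← SetLike.mem_coe, Submodule.topologicalClosure_coe, Metric.mem_closure_iff]
  constructor
  · intro h δ hδ
    obtain ⟨F', ⟨φ, hφ, h1⟩, h2⟩ := h δ hδ
    refine ⟨φ, hφ, ?_⟩
    rw [dist_eq_norm] at h2
    have e : F' = hφ.memLp_gradient.toLp _ := by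
      rw [← Lp.toLp_coeFn F' (Lp.memLp F')]
      exact MemLp.toLp_congr _ _ h1
    rw [e, norm_sub_toLp, ltwo_sub_comm] at h2
    exact h2.le
  · intro h δ hδ
    obtain ⟨φ, hφ, h1⟩ := h (δ / 2) (by positivity)
    refine ⟨hφ.memLp_gradient.toLp _, ⟨φ, hφ, hφ.memLp_gradient.coeFn_toLp⟩, ?_⟩
    rw [dist_eq_norm, norm_sub_toLp, ltwo_sub_comm]
    exact h1.trans_lt (by linarith)

theorem exists_field_solution {A : E → E} {m M : ℝ} (hm : 0 < m) (hM : 0 ≤ M)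
    (mono : ∀ z w, m * ‖z - w‖ ^ 2 ≤ inner ℝ (A z - A w) (z - w))
    (lip : ∀ z w, ‖A z - A w‖ ≤ M * ‖z - w‖) (zero : A 0 = 0) (hG : MemLp G 2 volume)
    (happ : ∀ δ > 0, ∃ φ : E → ℝ, IsTestFunction φ ∧
      ltwo volume (fun x => gradient φ x - G x) ≤ δ) {R : E → E} (hR : MemLp R 2 volume) :
    ∃ g : E → E, MemLp g 2 volume ∧ (∀ δ > 0, ∃ φ : E → ℝ, IsTestFunction φ ∧
      ltwo volume (fun x => gradient φ x - g x) ≤ δ) ∧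
      (∀ ψ : E → ℝ, IsTestFunction ψ → ∫ x, inner ℝ (A (g x)) (gradient ψ x) =
        ∫ x, inner ℝ (A (G x) + R x) (gradient ψ x)) ∧
      m * ltwo volume (fun x => g x - G x) ≤ ltwo volume R := by
  have hlip : LipschitzWith M.toNNReal A := LipschitzWith.of_dist_le_mul fun x y => by
    rw [dist_eq_norm, dist_eq_norm, Real.coe_toNNReal _ hM]; exact lip x y
  let T : Lp E 2 (volume : Measure E) → Lp E 2 (volume : Measure E) := hlip.compLp zero
  have hT : ∀ F, T F =ᵐ[volume] fun x => A (F x) := fun F => hlip.coeFn_compLp zero F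
  have hGK : hG.toLp G ∈ (testGradients E).topologicalClosure := by
    refine mem_closure_testGradients_iff.2 fun δ hδ => ?_
    obtain ⟨φ, hφ, h⟩ := happ δ hδ
    refine ⟨φ, hφ, (ltwo_congr ?_).trans_le h⟩
    filter_upwards [hG.coeFn_toLp] with x hx
    rw [hx]
  obtain ⟨g, hgK, hg1, hg2⟩ := exists_perturbed_of_strongly_monotone
    (testGradients E).topologicalClosure (Submodule.isClosed_topologicalClosure _) T hm (L := M)
    (fun x y => by
      have := hlip.norm_compLp_sub_le zero x y
      rwa [Real.coe_toNNReal _ hM] at this)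
    (fun x y => by
      have hxy : MemLp (fun a => x a - y a) 2 volume := (Lp.memLp x).sub (Lp.memLp y)
      have e1 : ‖x - y‖ ^ 2 = ∫ a, ‖x a - y a‖ ^ 2 := by
        rw [← ltwo_sq hxy, Lp.norm_def]
        congr 1
        exact ltwo_congr (Lp.coeFn_sub x y)
      rw [e1, L2.inner_def, ← integral_const_mul]
      refine integral_mono_ae (hxy.norm.integrable_sq.const_mul m) (L2.integrable_inner _ _) ?_
      filter_upwards [Lp.coeFn_sub x y, Lp.coeFn_sub (T x) (T y), hT x, hT y] with a h1 h2 h3 h4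
      rw [h1, h2, Pi.sub_apply, Pi.sub_apply, h3, h4]
      exact mono _ _) hGK (hR.toLp R)
  refine ⟨g, Lp.memLp g, mem_closure_testGradients_iff.1 hgK, fun ψ hψ => ?_, ?_⟩
  · have h := hg1 (hψ.memLp_gradient.toLp _)
      ((testGradients E).le_topologicalClosure ⟨ψ, hψ, hψ.memLp_gradient.coeFn_toLp⟩)
    rw [L2.inner_def, L2.inner_def] at h
    convert h using 1
    · refine integral_congr_ae ?_
      filter_upwards [hT g, hψ.memLp_gradient.coeFn_toLp] with x h1 h2
      rw [h1, h2]
    · refine integral_congr_ae ?_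
      filter_upwards [hT (hG.toLp G), hψ.memLp_gradient.coeFn_toLp, hR.coeFn_toLp, hG.coeFn_toLp,
        Lp.coeFn_add (T (hG.toLp G)) (hR.toLp R)] with x h1 h2 h3 h4 h5
      rw [h5, Pi.add_apply, h1, h2, h3, h4]
  · rw [norm_sub_toLp, Lp.norm_toLp] at hg2
    exact hg2

/-- The vector field of the `p`-Laplacean. -/
def pField (p : ℝ) (z : E) : E := ‖z‖ ^ (p - 2) • z

theorem measurable_pField : Measurable (pField p : E → E) :=
  (measurable_norm.pow_const _).smul measurable_id

theorem exists_regularized (hp : 1 < p) (hε : 0 < ε) (hε1 : ε ≤ 1) (hB : IsOpen B)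
    (hBfin : volume B ≠ ⊤) (hf : MemLp f 2 volume) (hG : MemLp G 2 volume)
    (happ : ∀ δ > 0, ∃ φ : E → ℝ, IsTestFunction φ ∧
      ltwo volume (fun x => gradient φ x - G x) ≤ δ) (hG1 : ∀ᵐ x, x ∈ B → ‖G x‖ ≤ 1)
    (hweak : ∀ ψ : E → ℝ, IsTestFunction ψ → tsupport ψ ⊆ B →
      ∫ x, inner ℝ (pField p (G x)) (gradient ψ x) = ∫ x, f x * ψ x) :
    ∃ g : E → E, IsWeakGradient (truncField p ε) (ellLow p ε) (ellUp p ε) B f g ∧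
      ltwo volume (fun x => g x - G x) ≤
        2 * (volume B).toReal ^ (1 / 2 : ℝ) * ((ε ^ (p - 1) + ε) / min 1 (p - 1)) := by
  have hb := truncField_bounds (E := E) hp hε hε1
  have hm := ellLow_pos hp hε
  have hM : 0 ≤ ellUp p ε := zero_le_one.trans one_le_ellUp
  have hcont : Continuous (truncField p ε : E → E) :=
    (LipschitzWith.of_dist_le_mul (K := (ellUp p ε).toNNReal) fun x y => by
      rw [dist_eq_norm, dist_eq_norm, Real.coe_toNNReal _ hM]; exact (hb x y).2).continuous
  let R : E → E := B.indicator fun x => pField p (G x) - truncField p ε (G x)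
  have hRm : AEStronglyMeasurable R volume := by
    refine AEStronglyMeasurable.indicator ?_ hB.measurableSet
    exact ((measurable_pField.comp_aemeasurable hG.1.aemeasurable).aestronglyMeasurable).sub
      (hcont.comp_aestronglyMeasurable hG.1)
  have hc : 0 ≤ 2 * ε ^ (p - 1) := by positivity
  have hRb : ∀ᵐ x, ‖R x‖ ≤ ‖B.indicator (fun _ => 2 * ε ^ (p - 1)) x‖ := by
    filter_upwards [hG1] with x hx
    by_cases hxB : x ∈ B
    · simp only [R, indicator_of_mem hxB]
      rw [Real.norm_of_nonneg hc]
      exact norm_truncField_sub_le hp hε hε1 (hx hxB)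
    · simp [R, indicator_of_notMem hxB]
  have hI : MemLp (B.indicator fun _ => 2 * ε ^ (p - 1)) 2 (volume : Measure E) :=
    memLp_indicator_const 2 hB.measurableSet _ (Or.inr hBfin)
  have hR : MemLp R 2 volume := hI.of_le hRm hRb
  have hRn : ltwo volume R ≤ 2 * ε ^ (p - 1) * (volume B).toReal ^ (1 / 2 : ℝ) := by
    refine (ltwo_mono hI hRb).trans ?_
    have h1 := eLpNorm_indicator_const_le (μ := (volume : Measure E)) (s := B) (2 * ε ^ (p - 1)) 2
    have h2 := ENNReal.toReal_mono (ENNReal.mul_ne_top enorm_ne_top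
      (ENNReal.rpow_ne_top_of_nonneg (by positivity) hBfin)) h1
    rw [ENNReal.toReal_mul, toReal_enorm, Real.norm_of_nonneg hc, ← ENNReal.toReal_rpow] at h2
    exact h2
  obtain ⟨g, hg, hga, hgw, hgn⟩ := exists_field_solution hm hM (fun z w => (hb z w).1)
    (fun z w => (hb z w).2) truncField_zero hG happ hR
  refine ⟨g, ⟨hm, hM, fun z w => (hb z w).1, fun z w => (hb z w).2, truncField_zero, hB, hf, hg, hga,
    fun ψ hψ hψB => ?_⟩, ?_⟩
  · rw [hgw ψ hψ, ← hweak ψ hψ hψB]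
    refine integral_congr_ae (Eventually.of_forall fun x => ?_)
    beta_reduce
    by_cases hxB : x ∈ B
    · simp only [R, indicator_of_mem hxB, add_sub_cancel]
    · rw [IsTestFunction.gradient_eq_zero fun h => hxB (hψB h), inner_zero_right, inner_zero_right]
  · have h1 := rpow_div_ellLow_le hp hε
    have h2 : ltwo volume (fun x => g x - G x) ≤
        2 * ε ^ (p - 1) * (volume B).toReal ^ (1 / 2 : ℝ) / ellLow p ε := by
      rw [le_div_iff₀ hm, mul_comm]; exact hgn.trans hRn
    calc _ ≤ _ := h2
      _ = 2 * (volume B).toReal ^ (1 / 2 : ℝ) * (ε ^ (p - 1) / ellLow p ε) := by ring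
      _ ≤ _ := by gcongr

/-- Reverse Sobolev inequality on superlevel sets of a directional derivative of a solution. -/
theorem eLpNorm_superlevel_le (hp : 1 < p) (hB : IsOpen B)
    (hBfin : volume B ≠ ⊤) (hf : MemLp f 2 volume) (hG : MemLp G 2 volume) (hGm : Measurable G)
    (happ : ∀ δ > 0, ∃ φ : E → ℝ, IsTestFunction φ ∧
      ltwo volume (fun x => gradient φ x - G x) ≤ δ) (hG1 : ∀ᵐ x, x ∈ B → ‖G x‖ ≤ 1)
    (hweak : ∀ ψ : E → ℝ, IsTestFunction ψ → tsupport ψ ⊆ B →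
      ∫ x, inner ℝ (pField p (G x)) (gradient ψ x) = ∫ x, f x * ψ x)
    {η : E → ℝ} (hη : IsTestFunction η) (hηB : tsupport η ⊆ B) (hη0 : ∀ x, 0 ≤ η x)
    (hη1 : ∀ x, η x ≤ 1) {e : E} (he : ‖e‖ ≤ 1) {k₀ k : ℝ} (hk₀ : 0 < k₀) (hk₁ : k₀ ≤ 1)
    (hk : k₀ < k) (hn : 0 < Module.finrank ℝ E) {q : ℝ≥0}
    (hq : (q : ℝ)⁻¹ = 2⁻¹ - (Module.finrank ℝ E : ℝ)⁻¹) :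
    eLpNorm (fun x => η x * max (inner ℝ (G x) e - k) 0) q volume ≤
      ENNReal.ofReal (sobolevConst E * energyConst (ellLow p k₀) (ellUp p k₀) *
        (ltwo volume (fun x => max (inner ℝ (G x) e - k) 0 • gradient η x) +
          ltwo volume ({x | k ≤ inner ℝ (G x) e}.indicator fun x => η x * f x))) := by
  have hl : 0 < ellLow p k₀ := ellLow_pos hp hk₀
  have hL : 0 ≤ ellUp p k₀ := zero_le_one.trans one_le_ellUp
  have hC : 0 ≤ energyConst (ellLow p k₀) (ellUp p k₀) := by unfold energyConst; positivity
  refine eLpNorm_le_of_forall_approx (mul_nonneg sobolevConst_nonneg hC) hη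
    (hη.memLp_mul hη0 hη1 hf) (hG.inner_const e) (hGm.inner_const) fun s hs => ?_
  have hmin : 0 < min 1 (p - 1) := lt_min one_pos (by linarith)
  have T : Tendsto (fun ε : ℝ => 2 * (volume B).toReal ^ (1 / 2 : ℝ) *
      ((ε ^ (p - 1) + ε) / min 1 (p - 1))) (𝓝[>] 0) (𝓝 0) := by
    refine Tendsto.mono_left ?_ nhdsWithin_le_nhds
    have : ContinuousAt (fun ε : ℝ => 2 * (volume B).toReal ^ (1 / 2 : ℝ) *
      ((ε ^ (p - 1) + ε) / min 1 (p - 1))) 0 := by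
      refine ContinuousAt.mul continuousAt_const (ContinuousAt.div_const (ContinuousAt.add ?_
        continuousAt_id) _)
      exact Real.continuousAt_rpow_const _ _ (Or.inr (by linarith))
    have h0 := this.tendsto
    rwa [Real.zero_rpow (by linarith : p - 1 ≠ 0), add_zero, zero_div, mul_zero] at h0
  have T1 : ∀ᶠ ε : ℝ in 𝓝[>] 0, ε ∈ Ioc 0 k₀ := Ioc_mem_nhdsGT hk₀
  obtain ⟨ε, hεs, hε0, hεk⟩ := ((T.eventually (gt_mem_nhds (half_pos hs))).and T1).exists
  obtain ⟨g, Hg, hgG⟩ := exists_regularized hp hε0 (hεk.trans hk₁) hB hBfin hf hG happ hG1 hweak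
  obtain ⟨w, hw, hw1, hw2⟩ := Hg.exists_sobolev_le (s := s / 2) hη hηB hη0 hη1 he hk₀.le hk hl hL
    (fun z w hz hw => truncField_bounds_of_le hp hε0 hεk hk₁ hz hw) hn hq (half_pos hs)
  refine ⟨w, hw, ?_, ?_⟩
  · have hge : MemLp (fun x => inner ℝ (g x) e) 2 volume := Hg.memLp.inner_const e
    have hGe : MemLp (fun x => inner ℝ (G x) e) 2 volume := hG.inner_const e
    have h1 := ltwo_triangle hw.memLp hge hGe
    have h2 : ltwo volume (fun x => inner ℝ (g x) e - inner ℝ (G x) e) ≤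
        ltwo volume (fun x => g x - G x) := by
      refine ltwo_mono (Hg.memLp.sub hG) (Eventually.of_forall fun x => ?_)
      rw [← inner_sub_left]
      exact (norm_inner_le_norm _ _).trans (mul_le_of_le_one_right (norm_nonneg _) he)
    linarith
  · refine (eLpNorm_mono fun x => ?_).trans (hw2.trans (ENNReal.ofReal_le_ofReal ?_))
    · rw [norm_mul, norm_mul, Real.norm_of_nonneg (le_max_right (w x - k - s) 0),
        Real.norm_of_nonneg (le_max_right (w x - k - s / 2) 0)]
      refine mul_le_mul_of_nonneg_left (max_le_max ?_ le_rfl) (norm_nonneg _)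
      linarith
    · refine mul_le_mul_of_nonneg_left ?_ (mul_nonneg sobolevConst_nonneg hC)
      linarith

end Regularization

section Mollification

open Filter Topology
open scoped Convolution

variable {E : Type*} [NormedAddCommGroup E] [InnerProductSpace ℝ E] [FiniteDimensional ℝ E]
  [MeasurableSpace E] [BorelSpace E]

theorem measurable_gradient (v : E → ℝ) : Measurable (gradient v) :=
  (InnerProductSpace.toDual ℝ E).symm.continuous.measurable.comp (measurable_fderiv ℝ v)

theorem norm_gradient (v : E → ℝ) (x : E) : ‖gradient v x‖ = ‖fderiv ℝ v x‖ :=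
  LinearIsometryEquiv.norm_map _ _

theorem norm_gradient_sub (v w : E → ℝ) (x : E) :
    ‖gradient v x - gradient w x‖ = ‖fderiv ℝ v x - fderiv ℝ w x‖ := by
  rw [gradient, gradient, ← map_sub, LinearIsometryEquiv.norm_map]

theorem LipschitzWith.norm_gradient_le {v : E → ℝ} {C : ℝ≥0} (hv : LipschitzWith C v) (x : E) :
    ‖gradient v x‖ ≤ C := by
  rw [norm_gradient]
  exact norm_fderiv_le_of_lipschitz ℝ hv

theorem LipschitzWith.memLp_gradient {v : E → ℝ} {C : ℝ≥0} (hv : LipschitzWith C v)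
    (hc : HasCompactSupport v) : MemLp (gradient v) 2 volume := by
  have hcg : HasCompactSupport (gradient v) :=
    HasCompactSupport.intro hc fun x hx => by
      rw [gradient, Function.notMem_support.1 fun h => hx (support_fderiv_subset ℝ h), map_zero]
  have h1 : MemLp (gradient v) ⊤ (volume.restrict (tsupport (gradient v))) :=
    memLp_top_of_bound (measurable_gradient v).aestronglyMeasurable C
      (ae_of_all _ hv.norm_gradient_le)
  have : IsFiniteMeasure (volume.restrict (tsupport (gradient v))) :=
    ⟨by simpa using hcg.isCompact.measure_lt_top⟩
  have h2 : MemLp (gradient v) 2 (volume.restrict (tsupport (gradient v))) :=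
    h1.mono_exponent le_top
  rw [← memLp_indicator_iff_restrict (isClosed_tsupport _).measurableSet] at h2
  rwa [indicator_eq_self.2 (subset_tsupport _)] at h2

theorem LipschitzWith.hasFDerivAt_convolution {v ρ : E → ℝ} {C : ℝ≥0} (hv : LipschitzWith C v)
    (hρ : Continuous ρ) (hρc : HasCompactSupport ρ) (x : E) :
    HasFDerivAt (ρ ⋆[ContinuousLinearMap.lsmul ℝ ℝ, volume] v)
      ((ρ ⋆[ContinuousLinearMap.lsmul ℝ ℝ, volume] (fderiv ℝ v)) x) x := by
  have hd : ∀ᵐ t, DifferentiableAt ℝ v (x - t) := by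
    have h0 := hv.ae_differentiableAt (μ := (volume : Measure E))
    exact (Measure.measurePreserving_sub_left volume x).quasiMeasurePreserving.ae h0
  have hmt : Measurable fun t : E => x - t := measurable_const.sub measurable_id
  refine (hasFDerivAt_integral_of_dominated_loc_of_lip (s := univ) (bound := fun t => C * ρ t)
    (F := fun y t => ContinuousLinearMap.lsmul ℝ ℝ (ρ t) (v (y - t)))
    (F' := fun t => ContinuousLinearMap.lsmul ℝ ℝ (ρ t) (fderiv ℝ v (x - t)))
    univ_mem ?_ ?_ ?_ ?_ ?_ ?_).2
  · refine Eventually.of_forall fun y => Continuous.aestronglyMeasurable ?_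
    have := hv.continuous
    simp only [ContinuousLinearMap.lsmul_apply]
    fun_prop
  · have := hv.continuous
    simp only [ContinuousLinearMap.lsmul_apply, smul_eq_mul]
    refine Continuous.integrable_of_hasCompactSupport (by fun_prop) ?_
    exact hρc.mul_right
  · simp only [ContinuousLinearMap.lsmul_apply]
    exact (hρ.measurable.smul ((measurable_fderiv ℝ v).comp hmt)).aestronglyMeasurable
  · refine ae_of_all _ fun t => ?_
    refine LipschitzOnWith.of_dist_le_mul fun y _ z _ => ?_
    simp only [ContinuousLinearMap.lsmul_apply, smul_eq_mul]
    rw [dist_eq_norm, ← mul_sub, norm_mul]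
    have := hv.dist_le_mul (y - t) (z - t)
    rw [dist_eq_norm, dist_sub_right] at this
    calc _ ≤ ‖ρ t‖ * (C * dist y z) := by gcongr
      _ = _ := by simp; ring
  · exact (hρ.integrable_of_hasCompactSupport hρc).const_mul _
  · filter_upwards [hd] with t ht
    simp only [ContinuousLinearMap.lsmul_apply]
    have h1 : HasFDerivAt (fun y => v (y - t)) (fderiv ℝ v (x - t)) x :=
      (HasFDerivAt.comp x ht.hasFDerivAt ((hasFDerivAt_id x).sub_const t)).congr_fderiv
        (ContinuousLinearMap.comp_id _)
    exact h1.const_smul (ρ t)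

theorem LipschitzWith.exists_testFunction_gradient {v : E → ℝ} {C : ℝ≥0} (hv : LipschitzWith C v)
    (hc : HasCompactSupport v) {δ : ℝ} (hδ : 0 < δ) :
    ∃ φ, IsTestFunction φ ∧ ltwo volume (fun x => gradient φ x - gradient v x) ≤ δ := by
  let b : ℕ → ContDiffBump (0 : E) := fun i =>
    ⟨(1 / 2) ^ (i + 1), 2 * (1 / 2) ^ (i + 1), by positivity, by
      have : (0 : ℝ) < (1 / 2) ^ (i + 1) := by positivity
      linarith⟩
  let φ : ℕ → E → ℝ := fun i =>
    ((b i).normed volume) ⋆[ContinuousLinearMap.lsmul ℝ ℝ, volume] v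
  have hli : LocallyIntegrable v volume := hv.continuous.locallyIntegrable
  have hcf : HasCompactSupport (fderiv ℝ v) := hc.fderiv ℝ
  have hb1 : ∀ i, (b i).rOut ≤ 2 := fun i => by
    have : (1 / 2 : ℝ) ^ (i + 1) ≤ 1 := pow_le_one₀ (by norm_num) (by norm_num)
    change 2 * (1 / 2 : ℝ) ^ (i + 1) ≤ 2
    linarith
  have hsub : ∀ i, tsupport (φ i) ⊆ cthickening 2 (tsupport v) := fun i => by
    refine closure_minimal ?_ isClosed_cthickening
    refine (support_convolution_subset _).trans ?_
    rintro _ ⟨a, ha, y, hy, rfl⟩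
    rw [(b i).support_normed_eq, mem_ball_zero_iff] at ha
    refine mem_cthickening_of_dist_le _ y _ _ (subset_tsupport v hy) ?_
    simpa [dist_eq_norm] using ha.le.trans (hb1 i)
  have hT : ∀ i, IsTestFunction (φ i) := fun i =>
    ⟨(b i).hasCompactSupport_normed.contDiff_convolution_left (n := 1) _
      (b i).contDiff_normed hli,
      HasCompactSupport.convolution _ (b i).hasCompactSupport_normed hc⟩
  have hfd : ∀ i x, fderiv ℝ (φ i) x =
      (((b i).normed volume) ⋆[ContinuousLinearMap.lsmul ℝ ℝ, volume] (fderiv ℝ v)) x := fun i x =>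
    (hv.hasFDerivAt_convolution ((b i).contDiff_normed (n := 0)).continuous
      (b i).hasCompactSupport_normed x).fderiv
  have hlif : LocallyIntegrable (fderiv ℝ v) volume := by
    have hb : MemLp (fderiv ℝ v) ⊤ volume :=
      memLp_top_of_bound (measurable_fderiv ℝ v).aestronglyMeasurable C
        (ae_of_all _ fun x => norm_fderiv_le_of_lipschitz ℝ hv)
    exact hb.locallyIntegrable le_top
  have hae : ∀ᵐ x, Tendsto (fun i => fderiv ℝ (φ i) x) atTop (𝓝 (fderiv ℝ v x)) := by
    simp_rw [hfd]
    refine ContDiffBump.ae_convolution_tendsto_right_of_locallyIntegrable (K := 2) ?_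
      (Eventually.of_forall fun i => le_rfl) hlif
    have : Tendsto (fun i : ℕ => 2 * (1 / 2 : ℝ) ^ (i + 1)) atTop (𝓝 (2 * 0)) :=
      ((tendsto_add_atTop_iff_nat 1).2
        (tendsto_pow_atTop_nhds_zero_of_lt_one (by norm_num) (by norm_num))).const_mul _
    rw [mul_zero] at this
    exact this
  have hlip : ∀ i x, ‖gradient (φ i) x‖ ≤ C := fun i x => by
    rw [norm_gradient, hfd]
    have h1 : Integrable (fun t => C * (b i).normed volume t) :=
      (((b i).contDiff_normed (n := 0)).continuous.integrable_of_hasCompactSupport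
        (b i).hasCompactSupport_normed).const_mul _
    refine (norm_integral_le_of_norm_le h1 (ae_of_all _ fun t => ?_)).trans ?_
    · rw [ContinuousLinearMap.lsmul_apply, norm_smul, mul_comm,
        Real.norm_of_nonneg ((b i).nonneg_normed t)]
      exact mul_le_mul_of_nonneg_right (norm_fderiv_le_of_lipschitz ℝ hv) ((b i).nonneg_normed t)
    · rw [integral_const_mul, (b i).integral_normed, mul_one]
  have hK : IsCompact (cthickening 2 (tsupport v)) := hc.isCompact.cthickening
  have hmemi : ∀ i, MemLp (fun x => gradient (φ i) x - gradient v x) 2 volume := fun i =>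
    (hT i).memLp_gradient.sub (hv.memLp_gradient hc)
  have hlim : Tendsto (fun i => ∫ x, ‖gradient (φ i) x - gradient v x‖ ^ 2) atTop
      (𝓝 (∫ _ : E, (0 : ℝ))) := by
    refine tendsto_integral_of_dominated_convergence
      ((cthickening 2 (tsupport v)).indicator fun _ => (2 * (C : ℝ)) ^ 2)
      (fun i => ((measurable_gradient _).sub (measurable_gradient v)).norm.pow_const 2
        |>.aestronglyMeasurable) ?_ ?_ ?_
    · exact (integrable_indicator_iff hK.measurableSet).2
        (integrableOn_const hK.measure_lt_top.ne)
    · intro i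
      refine ae_of_all _ fun x => ?_
      by_cases hx : x ∈ cthickening 2 (tsupport v)
      · rw [indicator_of_mem hx, norm_pow, norm_norm]
        have := _root_.norm_sub_le (gradient (φ i) x) (gradient v x)
        have h1 := hlip i x
        have h2 := hv.norm_gradient_le x
        gcongr
        linarith
      · have h1 : gradient (φ i) x = 0 :=
          IsTestFunction.gradient_eq_zero fun h => hx (hsub i h)
        have h2 : gradient v x = 0 :=
          IsTestFunction.gradient_eq_zero fun h => hx (self_subset_cthickening _ h)
        simp [indicator_of_notMem hx, h1, h2]
    · filter_upwards [hae] with x hx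
      simp_rw [norm_gradient_sub]
      have := (hx.sub_const (fderiv ℝ v x)).norm.pow 2
      simpa using this
  simp only [integral_zero] at hlim
  obtain ⟨i, hi⟩ := ((hlim.eventually (gt_mem_nhds (show (0 : ℝ) < δ ^ 2 by positivity)))).exists
  refine ⟨φ i, hT i, ?_⟩
  rw [← ltwo_sq (hmemi i)] at hi
  exact (lt_of_pow_lt_pow_left₀ 2 hδ.le hi).le

theorem LipschitzOnWith.exists_compactSupport_eqOn {u : E → ℝ} {C : ℝ≥0} {x₀ : E} {r : ℝ}
    (hu : LipschitzOnWith C u (closedBall x₀ r)) :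
    ∃ (v : E → ℝ) (C' : ℝ≥0), LipschitzWith C' v ∧ HasCompactSupport v ∧
      EqOn v u (closedBall x₀ r) := by
  obtain ⟨w, hw, hwu⟩ := hu.extend_real
  obtain ⟨M, hM⟩ := (isCompact_closedBall x₀ r).exists_bound_of_continuousOn
    hw.continuous.continuousOn
  let ζ : E → ℝ := fun x => max (|M| * (r + 1 - dist x x₀)) 0
  have hζ : LipschitzWith ‖|M|‖₊ ζ := by
    refine LipschitzWith.max_const ?_ 0
    refine LipschitzWith.of_dist_le_mul fun x y => ?_
    rw [Real.dist_eq, ← mul_sub, abs_mul, coe_nnnorm, Real.norm_eq_abs]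
    gcongr
    have := abs_dist_sub_le y x x₀
    rwa [dist_comm y x, show dist y x₀ - dist x x₀ = r + 1 - dist x x₀ - (r + 1 - dist y x₀) by
      ring] at this
  refine ⟨fun x => max (min (w x) (ζ x)) (-ζ x), _, (hw.min hζ).max hζ.neg, ?_, fun x hx => ?_⟩
  · refine HasCompactSupport.intro (isCompact_closedBall x₀ (r + 1)) fun x hx => ?_
    have : ζ x = 0 := by
      rw [mem_closedBall, not_le] at hx
      exact max_eq_right (mul_nonpos_of_nonneg_of_nonpos (abs_nonneg _) (by linarith))
    simp [this]
  · have h1 : |M| ≤ ζ x := by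
      rw [mem_closedBall] at hx
      refine le_max_of_le_left ?_
      nlinarith [abs_nonneg M]
    have h2 := (hM x hx).trans ((le_abs_self M).trans h1)
    rw [Real.norm_eq_abs, abs_le] at h2
    simp only
    rw [min_eq_left h2.2, max_eq_left h2.1, hwu hx]

theorem gradient_eq_of_eqOn {u v : E → ℝ} {s : Set E} (hs : IsOpen s) (h : EqOn u v s) {x : E}
    (hx : x ∈ s) : gradient u x = gradient v x := by
  have : u =ᶠ[𝓝 x] v := h.eventuallyEq_of_mem (hs.mem_nhds hx)
  rw [gradient, gradient, this.fderiv_eq]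

end Mollification

section EulerLagrange

open Filter Topology

variable {E : Type*} [NormedAddCommGroup E] [InnerProductSpace ℝ E] [FiniteDimensional ℝ E]
  [MeasurableSpace E] [BorelSpace E]

theorem norm_pField_le {p : ℝ} (z : E) : ‖pField p z‖ ≤ ‖z‖ ^ (p - 1) := by
  rw [pField, norm_smul, Real.norm_of_nonneg (by positivity)]
  rcases eq_or_ne z 0 with rfl | hz
  · simp only [norm_zero, mul_zero]
    positivity
  · rw [← Real.rpow_add_one (norm_ne_zero_iff.2 hz)]
    apply le_of_eq
    congr 1
    ring

theorem hasDerivAt_norm_rpow_div {p : ℝ} (hp : 1 < p) (a b : E) (t : ℝ) :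
    HasDerivAt (fun t : ℝ => ‖a + t • b‖ ^ p / p) (inner ℝ (pField p (a + t • b)) b) t := by
  have h1 : HasDerivAt (fun t : ℝ => a + t • b) b t := by
    simpa using ((hasDerivAt_id t).smul_const b).const_add a
  have h2 := ((hasFDerivAt_norm_rpow (a + t • b) hp).comp_hasDerivAt t h1).div_const p
  refine h2.congr_deriv ?_
  have : p ≠ 0 := by positivity
  simp only [FunLike.coe_smul, Pi.smul_apply, innerSL_apply_apply, smul_eq_mul, pField,
    real_inner_smul_left]
  field_simp

theorem integral_inner_pField_eq {α : Type*} [MeasurableSpace α] {ν : Measure α}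
    [IsFiniteMeasure ν] {p C M : ℝ} (hp : 1 < p) {G D : α → E} (hG : Measurable G)
    (hD : Measurable D) (hGC : ∀ᵐ x ∂ν, ‖G x‖ ≤ C) (hDM : ∀ᵐ x ∂ν, ‖D x‖ ≤ M) {f u ψ : α → ℝ}
    (hfu : Integrable (fun x => f x * u x) ν) (hfψ : Integrable (fun x => f x * ψ x) ν)
    (hmin : ∀ t : ℝ, ∫ x, (‖G x‖ ^ p / p - f x * u x) ∂ν ≤
      ∫ x, (‖G x + t • D x‖ ^ p / p - f x * (u x + t * ψ x)) ∂ν) :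
    ∫ x, inner ℝ (pField p (G x)) (D x) ∂ν = ∫ x, f x * ψ x ∂ν := by
  have hp0 : 0 < p := by positivity
  have hb : ∀ᵐ x ∂ν, ∀ t ∈ ball (0 : ℝ) 1, ‖G x + t • D x‖ ≤ |C| + |M| := by
    filter_upwards [hGC, hDM] with x h1 h2 t ht
    rw [mem_ball_zero_iff, Real.norm_eq_abs] at ht
    calc _ ≤ ‖G x‖ + ‖t • D x‖ := norm_add_le _ _
      _ = ‖G x‖ + |t| * ‖D x‖ := by rw [norm_smul, Real.norm_eq_abs]
      _ ≤ |C| + 1 * |M| := by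
        have := le_abs_self C
        have := le_abs_self M
        gcongr <;> linarith
      _ = _ := by ring
  have hder := hasDerivAt_integral_of_dominated_loc_of_deriv_le (μ := ν) (x₀ := (0 : ℝ))
    (s := ball 0 1)
    (F := fun t x => ‖G x + t • D x‖ ^ p / p - f x * (u x + t * ψ x))
    (F' := fun t x => inner ℝ (pField p (G x + t • D x)) (D x) - f x * ψ x)
    (bound := fun x => (|C| + |M|) ^ (p - 1) * |M| + ‖f x * ψ x‖)
    (ball_mem_nhds _ one_pos) ?_ ?_ ?_ ?_ ?_ ?_
  · have h0 : IsLocalMin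
        (fun t => ∫ x, (‖G x + t • D x‖ ^ p / p - f x * (u x + t * ψ x)) ∂ν) 0 :=
      Eventually.of_forall fun t => by simpa using hmin t
    have h1 := h0.hasDerivAt_eq_zero hder.2
    have h2 := hder.1
    simp only [zero_smul, add_zero] at h1 h2
    have h3 : Integrable (fun x => inner ℝ (pField p (G x)) (D x)) ν := by
      simpa [Pi.add_def] using h2.add hfψ
    rw [integral_sub h3 hfψ] at h1
    linarith
  · refine Eventually.of_forall fun t => ?_
    have h1 : (fun x => ‖G x + t • D x‖ ^ p / p - f x * (u x + t * ψ x)) =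
        fun x => ‖G x + t • D x‖ ^ p / p - (f x * u x + t * (f x * ψ x)) := by
      ext x
      ring
    rw [h1]
    exact ((hG.add (hD.const_smul t)).norm.pow_const p |>.div_const p).aestronglyMeasurable.sub
      (hfu.aestronglyMeasurable.add (hfψ.aestronglyMeasurable.const_mul t))
  · simp only [zero_smul, add_zero, zero_mul]
    refine Integrable.sub ?_ hfu
    refine Integrable.of_bound ((hG.norm.pow_const p).div_const p).aestronglyMeasurable
      (|C| ^ p / p) ?_
    filter_upwards [hGC] with x hx
    rw [Real.norm_of_nonneg (by positivity)]
    have := hx.trans (le_abs_self C)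
    gcongr
  · simp only [zero_smul, add_zero]
    exact ((measurable_pField.comp hG).inner hD).aestronglyMeasurable.sub
      hfψ.aestronglyMeasurable
  · filter_upwards [hb, hDM] with x hx hx2 t ht
    refine (norm_sub_le _ _).trans ?_
    gcongr
    refine (norm_inner_le_norm _ _).trans ?_
    have := hx2.trans (le_abs_self M)
    have h3 := (norm_pField_le (p := p) (G x + t • D x)).trans
      (Real.rpow_le_rpow (norm_nonneg _) (hx t ht) (by linarith))
    gcongr
  · exact (integrable_const _).add hfψ.norm
  · refine ae_of_all _ fun x t _ => (hasDerivAt_norm_rpow_div hp _ _ t).sub ?_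
    simpa using (((hasDerivAt_id t).mul_const (ψ x)).const_add (u x)).const_mul (f x)

end EulerLagrange

section Lorentz

open Filter Topology

variable {α V : Type*} [MeasurableSpace α] [NormedAddCommGroup V] [MeasurableSpace V] [BorelSpace V]

theorem eLpNorm_two_le {ν : Measure α} {f : α → V} (hf : Measurable f) :
    eLpNorm f 2 ν ≤ 2 * ∫⁻ lam in Ioi (0 : ℝ), (ν {x | lam < ‖f x‖}) ^ (2⁻¹ : ℝ) := by
  set I := ∫⁻ lam in Ioi (0 : ℝ), (ν {x | lam < ‖f x‖}) ^ (2⁻¹ : ℝ) with hI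
  have h1 : ∀ t : ℝ, ENNReal.ofReal t * (ν {x | t < ‖f x‖}) ^ (2⁻¹ : ℝ) ≤ I := fun t => by
    calc _ = ∫⁻ lam in Ioc (0 : ℝ) t, (ν {x | t < ‖f x‖}) ^ (2⁻¹ : ℝ) := by
          rw [setLIntegral_const, Real.volume_Ioc, sub_zero, mul_comm]
      _ ≤ ∫⁻ lam in Ioc (0 : ℝ) t, (ν {x | lam < ‖f x‖}) ^ (2⁻¹ : ℝ) := by
          refine setLIntegral_mono' measurableSet_Ioc fun s hs => ?_
          gcongr
          exact hs.2
      _ ≤ I := lintegral_mono_set Ioc_subset_Ioi_self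
  have h2 : ∫⁻ x, ‖f x‖ₑ ^ (2 : ℝ) ∂ν ≤ (2 * I) ^ (2 : ℝ) := by
    have e1 : ∀ x, ‖f x‖ₑ ^ (2 : ℝ) = ENNReal.ofReal (‖f x‖ ^ (2 : ℝ)) := fun x => by
      rw [← ENNReal.ofReal_rpow_of_nonneg (norm_nonneg _) (by norm_num), ofReal_norm]
    simp_rw [e1]
    rw [lintegral_rpow_eq_lintegral_meas_lt_mul ν (ae_of_all _ fun x => norm_nonneg _)
      hf.norm.aemeasurable (by norm_num)]
    have e2 : ∫⁻ t in Ioi (0 : ℝ), ν {x | t < ‖f x‖} * ENNReal.ofReal (t ^ ((2 : ℝ) - 1)) ≤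
        ∫⁻ t in Ioi (0 : ℝ), I * (ν {x | t < ‖f x‖}) ^ (2⁻¹ : ℝ) := by
      refine lintegral_mono fun t => ?_
      have := h1 t
      have e3 : (2 : ℝ) - 1 = 1 := by norm_num
      simp only [e3, Real.rpow_one]
      calc _ = (ENNReal.ofReal t * (ν {x | t < ‖f x‖}) ^ (2⁻¹ : ℝ)) *
            (ν {x | t < ‖f x‖}) ^ (2⁻¹ : ℝ) := by
            rw [mul_assoc, ← ENNReal.rpow_add_of_nonneg _ _ (by norm_num) (by norm_num)]
            norm_num [mul_comm]
        _ ≤ _ := by gcongr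
    have hm : Measurable fun t : ℝ => (ν {x | t < ‖f x‖}) ^ (2⁻¹ : ℝ) := by
      refine Measurable.pow_const (Antitone.measurable fun s t hst => ?_) _
      exact measure_mono fun x hx => hst.trans_lt hx
    rw [lintegral_const_mul _ hm, ← hI] at e2
    calc _ ≤ ENNReal.ofReal 2 * (I * I) := by gcongr
      _ ≤ _ := by
        rw [ENNReal.rpow_two, mul_pow, sq I, ENNReal.ofReal_ofNat]
        gcongr
        norm_num
  rw [eLpNorm_eq_lintegral_rpow_enorm_toReal (by simp) (by simp)]
  simp only [ENNReal.toReal_ofNat]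
  rw [one_div, ENNReal.rpow_inv_le_iff (by norm_num)]
  exact h2

end Lorentz

section Cutoff

open Filter Topology

theorem exists_abs_deriv_smoothTransition_le :
    ∃ M : ℝ, 0 < M ∧ ∀ t, |deriv Real.smoothTransition t| ≤ M := by
  have hc : Continuous (deriv Real.smoothTransition) :=
    (Real.smoothTransition.contDiff (n := 1)).continuous_deriv le_rfl
  obtain ⟨M, hM⟩ := (isCompact_Icc (a := (0 : ℝ)) (b := 1)).exists_bound_of_continuousOn
    hc.continuousOn
  refine ⟨|M| + 1, by positivity, fun t => ?_⟩
  by_cases ht : t ∈ Icc (0 : ℝ) 1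
  · have := hM t ht
    rw [Real.norm_eq_abs] at this
    linarith [le_abs_self M]
  · have h0 : deriv Real.smoothTransition t = 0 := by
      rcases not_and_or.1 ht with h | h
      · rw [not_le] at h
        have : Real.smoothTransition =ᶠ[𝓝 t] fun _ => 0 := by
          filter_upwards [Iio_mem_nhds h] with s hs
          exact Real.smoothTransition.zero_of_nonpos (le_of_lt hs)
        rw [this.deriv_eq, deriv_const]
      · rw [not_le] at h
        have : Real.smoothTransition =ᶠ[𝓝 t] fun _ => 1 := by
          filter_upwards [Ioi_mem_nhds h] with s hs
          exact Real.smoothTransition.one_of_one_le (le_of_lt hs)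
        rw [this.deriv_eq, deriv_const]
    rw [h0, abs_zero]
    positivity

variable {E : Type*} [NormedAddCommGroup E] [InnerProductSpace ℝ E] [FiniteDimensional ℝ E]
  [MeasurableSpace E] [BorelSpace E]

/-- `η` is a cut-off function between `ball x₀ a` and `closedBall x₀ b`. -/
structure IsCutoff (η : E → ℝ) (x₀ : E) (a b M : ℝ) : Prop where
  isTestFunction : IsTestFunction η
  tsupport_subset : tsupport η ⊆ closedBall x₀ b
  nonneg : ∀ x, 0 ≤ η x
  le_one : ∀ x, η x ≤ 1
  eq_one : ∀ x ∈ ball x₀ a, η x = 1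
  norm_gradient_le : ∀ x, ‖gradient η x‖ ≤ M / (b - a)

variable (E) in
theorem exists_isCutoff : ∃ M : ℝ, 0 < M ∧ ∀ (x₀ : E) (a b : ℝ), 0 < a → a < b →
    ∃ η, IsCutoff η x₀ a b M := by
  obtain ⟨M, hM0, hM⟩ := exists_abs_deriv_smoothTransition_le
  refine ⟨2 * M, by positivity, fun x₀ a b ha hab => ?_⟩
  have hb : 0 < b := ha.trans hab
  have hd : 0 < b ^ 2 - a ^ 2 := by nlinarith
  let η : E → ℝ := fun x => Real.smoothTransition ((b ^ 2 - ‖x - x₀‖ ^ 2) / (b ^ 2 - a ^ 2))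
  have hsupp : tsupport η ⊆ closedBall x₀ b := by
    refine closure_minimal (fun x hx => ?_) isClosed_closedBall
    by_contra h
    rw [mem_closedBall, dist_eq_norm, not_le] at h
    refine hx (Real.smoothTransition.zero_of_nonpos (div_nonpos_of_nonpos_of_nonneg ?_ hd.le))
    nlinarith
  have hη : IsTestFunction η :=
    ⟨Real.smoothTransition.contDiff.comp
      ((contDiff_const.sub ((contDiff_id.sub contDiff_const).norm_sq ℝ)).div_const _),
      (isCompact_closedBall x₀ b).of_isClosed_subset (isClosed_tsupport _) hsupp⟩
  refine ⟨η, hη, hsupp, fun x => Real.smoothTransition.nonneg _,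
    fun x => Real.smoothTransition.le_one _, fun x hx => ?_, fun x => ?_⟩
  · refine Real.smoothTransition.one_of_one_le ((one_le_div hd).2 ?_)
    rw [mem_ball, dist_eq_norm] at hx
    nlinarith [norm_nonneg (x - x₀)]
  · by_cases hx : x ∈ closedBall x₀ b
    · rw [mem_closedBall, dist_eq_norm] at hx
      have h1 : HasFDerivAt (fun x : E => ‖x - x₀‖ ^ 2) ((2 : ℝ) • innerSL ℝ (x - x₀) : E →L[ℝ] ℝ) x := by
        simpa [ofNat_smul_eq_nsmul] using ((hasFDerivAt_id x).sub_const x₀).norm_sq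
      have h2 : HasFDerivAt (fun x : E => (b ^ 2 - ‖x - x₀‖ ^ 2) / (b ^ 2 - a ^ 2))
          ((b ^ 2 - a ^ 2)⁻¹ • -((2 : ℝ) • innerSL ℝ (x - x₀)) : E →L[ℝ] ℝ) x := by
        simpa [div_eq_inv_mul] using (h1.const_sub (b ^ 2)).const_mul (b ^ 2 - a ^ 2)⁻¹
      have h3 := (((Real.smoothTransition.contDiff (n := 1)).differentiable one_ne_zero
        ((b ^ 2 - ‖x - x₀‖ ^ 2) / (b ^ 2 - a ^ 2))).hasDerivAt).comp_hasFDerivAt x h2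
      rw [norm_gradient]
      have h4 : fderiv ℝ η x = _ := h3.fderiv
      rw [h4, norm_smul, norm_smul, norm_neg, norm_smul, innerSL_apply_norm, Real.norm_eq_abs,
        norm_inv, Real.norm_of_nonneg hd.le]
      have h5 : (b ^ 2 - a ^ 2)⁻¹ * (‖(2 : ℝ)‖ * ‖x - x₀‖) ≤ 2 / (b - a) := by
        rw [inv_mul_le_iff₀ hd, mul_div_assoc', le_div_iff₀ (by linarith)]
        rw [Real.norm_of_nonneg zero_le_two]
        nlinarith
      calc _ ≤ M * (2 / (b - a)) := by
            refine mul_le_mul (hM _) ?_ (by positivity) hM0.le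
            convert h5 using 3
        _ = _ := by ring
    · rw [IsTestFunction.gradient_eq_zero fun h => hx (hsupp h), norm_zero]
      have : 0 < b - a := by linarith
      positivity

end Cutoff

section DyadicSums

open Filter Topology

theorem rpow_mul_min_rpow_le_dyadic_diff {n : ℕ} (hn : 2 < n) {M : ℝ} (hM : 0 < M) :
    ∃ H : ℝ → ℝ, (∀ r, 0 < r → 0 ≤ H r ∧ H r ≤ 6 * M) ∧ ∀ r, 0 < r →
      r ^ (1 - (n : ℝ) / 2) * (min (M ^ (n : ℝ)) (r ^ (n : ℝ))) ^ (2⁻¹ : ℝ) ≤ H r - H (r / 2) := by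
  have hn3 : (3 : ℝ) ≤ n := by exact_mod_cast hn
  refine ⟨fun r => if r ≤ M then 2 * r else 6 * M - 3 * M * √(M / r), fun r hr => ?_,
    fun r hr => ?_⟩
  · beta_reduce
    split_ifs with h
    · exact ⟨by positivity, by linarith⟩
    · have h1 : √(M / r) ≤ 1 := Real.sqrt_le_one.2 ((div_le_one hr).2 (not_le.1 h).le)
      have h2 := Real.sqrt_nonneg (M / r)
      constructor <;> nlinarith
  · beta_reduce
    by_cases h : r ≤ M
    · have h2 : r / 2 ≤ M := by linarith
      have h3 : r ^ (n : ℝ) ≤ M ^ (n : ℝ) := by gcongr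
      rw [if_pos h, if_pos h2, min_eq_right h3, ← Real.rpow_mul hr.le, ← Real.rpow_add hr]
      have : 1 - (n : ℝ) / 2 + n * 2⁻¹ = 1 := by ring
      rw [this, Real.rpow_one]
      linarith
    · have h' := not_le.1 h
      have h3 : M ^ (n : ℝ) ≤ r ^ (n : ℝ) := by gcongr
      have hs0 : 0 ≤ √(M / r) := Real.sqrt_nonneg _
      have hs1 : √(M / r) ≤ 1 := Real.sqrt_le_one.2 ((div_le_one hr).2 h'.le)
      have hg : r ^ (1 - (n : ℝ) / 2) * (min (M ^ (n : ℝ)) (r ^ (n : ℝ))) ^ (2⁻¹ : ℝ) ≤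
          M * √(M / r) := by
        rw [min_eq_left h3, ← Real.rpow_mul hM.le]
        have e1 : r ^ (1 - (n : ℝ) / 2) * M ^ ((n : ℝ) * 2⁻¹) = M * (M / r) ^ ((n : ℝ) / 2 - 1) := by
          rw [Real.div_rpow hM.le hr.le, show 1 - (n : ℝ) / 2 = -((n : ℝ) / 2 - 1) by ring,
            Real.rpow_neg hr.le, show (n : ℝ) * 2⁻¹ = 1 + ((n : ℝ) / 2 - 1) by ring,
            Real.rpow_add hM, Real.rpow_one]
          field_simp
        rw [e1, Real.sqrt_eq_rpow]
        refine mul_le_mul_of_nonneg_left ?_ hM.le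
        exact Real.rpow_le_rpow_of_exponent_ge (by positivity) ((div_le_one hr).2 h'.le)
          (by linarith)
      refine hg.trans ?_
      rw [if_neg h]
      split_ifs with h2
      · nlinarith
      · have e2 : √(M / (r / 2)) = √2 * √(M / r) := by
          rw [← Real.sqrt_mul (by norm_num)]
          congr 1
          field_simp
        rw [e2]
        have : (4 / 3 : ℝ) ≤ √2 := Real.le_sqrt_of_sq_le (by norm_num)
        have h4 : 0 ≤ M * √(M / r) := by positivity
        nlinarith

theorem sum_rpow_mul_min_rpow_le {n : ℕ} (hn : 2 < n) {m ρ : ℝ} (hm : 0 ≤ m) (hρ : 0 < ρ)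
    (J : ℕ) : ∑ j ∈ Finset.range J, (ρ / 2 ^ j) ^ (1 - (n : ℝ) / 2) *
      (min m ((ρ / 2 ^ j) ^ (n : ℝ))) ^ (2⁻¹ : ℝ) ≤ 6 * m ^ (1 / (n : ℝ)) := by
  have hn0 : (n : ℝ) ≠ 0 := by positivity
  rcases hm.eq_or_lt with rfl | hm
  · rw [Finset.sum_eq_zero]
    · positivity
    · intro j _
      rw [min_eq_left (by positivity), Real.zero_rpow (by norm_num), mul_zero]
  · obtain ⟨H, hH, hd⟩ := rpow_mul_min_rpow_le_dyadic_diff hn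
      (show 0 < m ^ (1 / (n : ℝ)) by positivity)
    rw [← Real.rpow_mul hm.le, one_div_mul_cancel hn0, Real.rpow_one] at hd
    have h1 : ∀ j : ℕ, 0 < ρ / 2 ^ j := fun j => by positivity
    calc _ ≤ ∑ j ∈ Finset.range J, (H (ρ / 2 ^ j) - H (ρ / 2 ^ (j + 1))) := by
          refine Finset.sum_le_sum fun j _ => ?_
          have := hd _ (h1 j)
          rwa [div_div, ← pow_succ] at this
      _ = H (ρ / 2 ^ 0) - H (ρ / 2 ^ J) := Finset.sum_range_sub' (fun j => H (ρ / 2 ^ j)) J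
      _ ≤ _ := by linarith [(hH _ (h1 0)).2, (hH _ (h1 J)).1]

theorem ENNReal.sum_rpow_mul_min_rpow_le {n : ℕ} (hn : 2 < n) (m : ℝ≥0∞) {ρ : ℝ} (hρ : 0 < ρ)
    (J : ℕ) : ∑ j ∈ Finset.range J, ENNReal.ofReal ((ρ / 2 ^ j) ^ (1 - (n : ℝ) / 2)) *
      (min m (ENNReal.ofReal ((ρ / 2 ^ j) ^ (n : ℝ)))) ^ (2⁻¹ : ℝ) ≤ 6 * m ^ (1 / (n : ℝ)) := by
  have hn0 : (0 : ℝ) < n := by positivity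
  rcases eq_or_ne m ⊤ with rfl | hm
  · rw [ENNReal.top_rpow_of_pos (by positivity), ENNReal.mul_top (by norm_num)]
    exact le_top
  · lift m to ℝ≥0 using hm
    have h1 : ∀ j : ℕ, 0 < ρ / 2 ^ j := fun j => by positivity
    have h2 := _root_.sum_rpow_mul_min_rpow_le hn m.2 hρ J
    have h3 := ENNReal.ofReal_le_ofReal h2
    rw [ENNReal.ofReal_sum_of_nonneg fun j _ => by have := m.2; positivity] at h3
    refine (le_of_eq ?_).trans (h3.trans (le_of_eq ?_))
    · refine Finset.sum_congr rfl fun j _ => ?_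
      rw [ENNReal.ofReal_mul (by positivity),
        ← ENNReal.ofReal_rpow_of_nonneg (le_min m.2 (by positivity)) (by norm_num),
        ENNReal.ofReal_min]
      simp
    · rw [ENNReal.ofReal_mul (by norm_num), ← ENNReal.ofReal_rpow_of_nonneg m.2 (by positivity)]
      simp

theorem exists_dyadic_levels {D : ℝ} (hD : 0 < D) {b : ℕ → ℝ} (hb : ∀ j, 0 ≤ b j) :
    ∃ d : ℕ → ℝ, d 0 = D ∧ (∀ j, d (j + 1) = (d j + b j) / 2) ∧ (∀ j, 0 < d j) ∧
      ∀ J, ∑ j ∈ Finset.range J, d j + 2 * d J = 2 * D + ∑ j ∈ Finset.range J, b j := by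
  let d : ℕ → ℝ := fun j => Nat.rec D (fun j x => (x + b j) / 2) j
  have hs : ∀ j, d (j + 1) = (d j + b j) / 2 := fun j => rfl
  refine ⟨d, rfl, hs, fun j => ?_, fun J => ?_⟩
  · induction j with
    | zero => exact hD
    | succ j ih =>
      rw [hs]
      linarith [hb j]
  · induction J with
    | zero => simp [d]
    | succ J ih =>
      rw [Finset.sum_range_succ, Finset.sum_range_succ, hs]
      linarith

end DyadicSums

section OneStep

open Filter Topology

variable {E : Type*} [NormedAddCommGroup E] [InnerProductSpace ℝ E] [FiniteDimensional ℝ E]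
  [MeasurableSpace E] [BorelSpace E]

/-- The `L²` norm of the excess of `w` over the level `k` on a ball. -/
def excess (w : E → ℝ) (x₀ : E) (k R : ℝ) : ℝ :=
  ltwo volume ((ball x₀ R).indicator fun x => max (w x - k) 0)

/-- Sobolev-type inequality for the truncations of `w` at levels above `κ`. -/
def SuperlevelEstimate (w f : E → ℝ) (B : Set E) (κ C : ℝ) : Prop :=
  ∀ η, IsTestFunction η → tsupport η ⊆ B → (∀ x, 0 ≤ η x) → (∀ x, η x ≤ 1) → ∀ k, κ < k →
    ∀ q : ℝ≥0, (q : ℝ)⁻¹ = 2⁻¹ - (Module.finrank ℝ E : ℝ)⁻¹ →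
      eLpNorm (fun x => η x * max (w x - k) 0) q volume ≤
        ENNReal.ofReal (C * (ltwo volume (fun x => max (w x - k) 0 • gradient η x) +
          ltwo volume ({x | k ≤ w x}.indicator fun x => η x * f x)))

variable {w f : E → ℝ} {x₀ : E}

theorem memLp_excess (hw : Measurable w) (hw2 : MemLp w 2 volume) (k R : ℝ) :
    MemLp ((ball x₀ R).indicator fun x => max (w x - k) 0) 2 volume := by
  have h1 : MemLp ((ball x₀ R).indicator w) 2 volume := hw2.indicator measurableSet_ball
  have h2 : MemLp ((ball x₀ R).indicator fun _ => k) 2 volume :=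
    memLp_indicator_const 2 measurableSet_ball k (Or.inr measure_ball_lt_top.ne)
  refine (h1.sub h2).norm.mono
    (((hw.sub_const k).max measurable_const).indicator measurableSet_ball).aestronglyMeasurable
    (ae_of_all _ fun x => ?_)
  by_cases hx : x ∈ ball x₀ R
  · simp only [indicator_of_mem hx, Pi.sub_apply, Real.norm_eq_abs, abs_abs]
    rw [abs_of_nonneg (le_max_right _ _)]
    exact max_le (le_abs_self _) (abs_nonneg _)
  · simp [indicator_of_notMem hx]

theorem excess_nonneg (k R : ℝ) : 0 ≤ excess w x₀ k R := ltwo_nonneg _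

theorem excess_mono (hw : Measurable w) (hw2 : MemLp w 2 volume) {k k' R R' : ℝ} (hk : k ≤ k')
    (hR : R ≤ R') : excess w x₀ k' R ≤ excess w x₀ k R' := by
  refine ltwo_mono (memLp_excess hw hw2 k R') (ae_of_all _ fun x => ?_)
  by_cases hx : x ∈ ball x₀ R
  · rw [indicator_of_mem hx, indicator_of_mem (ball_subset_ball hR hx),
      Real.norm_of_nonneg (le_max_right _ _), Real.norm_of_nonneg (le_max_right _ _)]
    gcongr
  · rw [indicator_of_notMem hx, norm_zero]
    positivity

theorem volume_superlevel_le (hw : Measurable w) (hw2 : MemLp w 2 volume) {k d R : ℝ}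
    (hd : 0 < d) : volume (ball x₀ R ∩ {x | k + d ≤ w x}) ≤
      ENNReal.ofReal ((excess w x₀ k R / d) ^ 2) := by
  set S := ball x₀ R ∩ {x | k + d ≤ w x} with hS
  have hSm : MeasurableSet S := measurableSet_ball.inter (measurableSet_le measurable_const hw)
  have hfin : volume S ≠ ⊤ := (measure_mono inter_subset_left).trans_lt measure_ball_lt_top |>.ne
  have h1 : d * (volume S).toReal ^ (2⁻¹ : ℝ) ≤ excess w x₀ k R := by
    have h2 : ltwo volume (S.indicator fun _ => d) ≤ excess w x₀ k R := by
      refine ltwo_mono (memLp_excess hw hw2 k R) (ae_of_all _ fun x => ?_)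
      by_cases hx : x ∈ S
      · rw [indicator_of_mem hx, indicator_of_mem hx.1, Real.norm_of_nonneg hd.le,
          Real.norm_of_nonneg (le_max_right _ _)]
        refine le_max_of_le_left ?_
        have := hx.2
        simp only [mem_ofPred_eq] at this
        linarith
      · rw [indicator_of_notMem hx, norm_zero]
        positivity
    refine le_trans (le_of_eq ?_) h2
    rw [ltwo, eLpNorm_indicator_const hSm (by simp) (by simp), ENNReal.toReal_mul,
      ← ENNReal.toReal_rpow]
    simp [abs_of_pos hd]
  rw [← ENNReal.ofReal_toReal hfin]
  refine ENNReal.ofReal_le_ofReal ?_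
  rw [div_pow, le_div_iff₀ (by positivity)]
  have h3 : 0 ≤ (volume S).toReal := ENNReal.toReal_nonneg
  have h4 : ((volume S).toReal ^ (2⁻¹ : ℝ)) ^ 2 = (volume S).toReal := by
    rw [← Real.rpow_natCast, ← Real.rpow_mul h3]
    norm_num
  calc _ = (d * (volume S).toReal ^ (2⁻¹ : ℝ)) ^ 2 := by rw [mul_pow, h4]; ring
    _ ≤ _ := by gcongr

theorem excess_le_of_superlevelEstimate (hn : 2 < Module.finrank ℝ E) {B : Set E} {κ C M : ℝ}
    (hw : Measurable w) (hw2 : MemLp w 2 volume) (hf2 : MemLp f 2 volume)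
    (hC : 0 ≤ C) (hM : 0 ≤ M)
    (hest : SuperlevelEstimate w f B κ C) {a b : ℝ} {η : E → ℝ} (hab : a < b)
    (hη : IsCutoff η x₀ a ((a + b) / 2) M) (hbB : ball x₀ b ⊆ B) {k : ℝ} (hk : κ < k) {v : ℝ}
    (hv : 0 ≤ v) (hv2 : volume (ball x₀ b ∩ {x | k ≤ w x}) ≤ ENNReal.ofReal v) :
    excess w x₀ k a ≤ v ^ (1 / (Module.finrank ℝ E : ℝ)) * (C * (2 * M / (b - a) *
      excess w x₀ k b + ltwo volume ((ball x₀ b ∩ {x | k ≤ w x}).indicator f))) := by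
  set n := Module.finrank ℝ E with hndef
  have hn3 : (3 : ℝ) ≤ n := by exact_mod_cast hn
  have hn' : (n : ℝ)⁻¹ ≤ 3⁻¹ := inv_anti₀ (by norm_num) hn3
  have hn0 : (0 : ℝ) < (n : ℝ)⁻¹ := by positivity
  have hqpos : (0 : ℝ) < (2⁻¹ - (n : ℝ)⁻¹)⁻¹ := inv_pos.2 (by norm_num at hn' ⊢; linarith)
  let q : ℝ≥0 := ⟨(2⁻¹ - (n : ℝ)⁻¹)⁻¹, hqpos.le⟩
  have hq : (q : ℝ)⁻¹ = 2⁻¹ - (n : ℝ)⁻¹ := inv_inv _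
  have hq2 : (2 : ℝ≥0∞) ≤ q := by
    have : (2 : ℝ≥0) ≤ q := by
      rw [← NNReal.coe_le_coe]
      change (2 : ℝ) ≤ (2⁻¹ - (n : ℝ)⁻¹)⁻¹
      rw [le_inv_comm₀ (by norm_num) (inv_pos.1 hqpos)]
      linarith
    exact_mod_cast this
  have hsub : tsupport η ⊆ ball x₀ b :=
    hη.tsupport_subset.trans (closedBall_subset_ball (by linarith))
  have hA : MeasurableSet {x | k ≤ w x} := measurableSet_le measurable_const hw
  have h1 := hest η hη.isTestFunction (hsub.trans hbB) hη.nonneg hη.le_one k hk q hq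
  have hgm : Measurable fun x => η x * max (w x - k) 0 :=
    hη.isTestFunction.continuous.measurable.mul ((hw.sub_const k).max measurable_const)
  have h2 : ltwo volume (fun x => max (w x - k) 0 • gradient η x) ≤
      2 * M / (b - a) * excess w x₀ k b := by
    have hc : 0 ≤ 2 * M / (b - a) := div_nonneg (by positivity) (by linarith)
    refine ltwo_mono' (memLp_excess hw hw2 k b) hc (ae_of_all _ fun x => ?_)
    by_cases hx : x ∈ ball x₀ b
    · rw [norm_smul, indicator_of_mem hx, mul_comm]
      refine mul_le_mul_of_nonneg_right ((hη.norm_gradient_le x).trans (le_of_eq ?_))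
        (norm_nonneg _)
      rw [show (a + b) / 2 - a = (b - a) / 2 by ring, div_div_eq_mul_div, mul_comm]
    · rw [IsTestFunction.gradient_eq_zero fun h => hx (hsub h), smul_zero, norm_zero]
      positivity
  have h3 : ltwo volume ({x | k ≤ w x}.indicator fun x => η x * f x) ≤
      ltwo volume ((ball x₀ b ∩ {x | k ≤ w x}).indicator f) := by
    refine ltwo_mono (hf2.indicator (measurableSet_ball.inter hA)) (ae_of_all _ fun x => ?_)
    by_cases hx : x ∈ {x | k ≤ w x}
    · by_cases hxb : x ∈ ball x₀ b
      · rw [indicator_of_mem hx, indicator_of_mem (mem_inter hxb hx),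
          norm_mul, Real.norm_of_nonneg (hη.nonneg x)]
        exact mul_le_of_le_one_left (norm_nonneg _) (hη.le_one x)
      · rw [indicator_of_mem hx, image_eq_zero_of_notMem_tsupport fun h => hxb (hsub h), zero_mul,
          norm_zero]
        positivity
    · rw [indicator_of_notMem hx, norm_zero]
      positivity
  set S := ball x₀ a ∩ {x | k ≤ w x} with hSdef
  have hS : MeasurableSet S := measurableSet_ball.inter hA
  have h4 : eLpNorm ((ball x₀ a).indicator fun x => max (w x - k) 0) 2 volume ≤
      eLpNorm (fun x => η x * max (w x - k) 0) 2 (volume.restrict S) := by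
    rw [← eLpNorm_indicator_eq_eLpNorm_restrict hS]
    refine eLpNorm_mono fun x => ?_
    by_cases hx : x ∈ ball x₀ a
    · by_cases hxk : k ≤ w x
      · rw [indicator_of_mem hx, indicator_of_mem (show x ∈ S from ⟨hx, hxk⟩), hη.eq_one x hx, one_mul]
      · rw [indicator_of_mem hx, max_eq_right (by linarith), norm_zero]
        positivity
    · rw [indicator_of_notMem hx, norm_zero]
      positivity
  have h5 : eLpNorm (fun x => η x * max (w x - k) 0) 2 (volume.restrict S) ≤
      eLpNorm (fun x => η x * max (w x - k) 0) q volume * ENNReal.ofReal (v ^ (1 / (n : ℝ))) := by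
    refine (eLpNorm_le_eLpNorm_mul_rpow_measure_univ hq2 hgm.aestronglyMeasurable).trans ?_
    refine mul_le_mul' (eLpNorm_mono_measure _ Measure.restrict_le_self) ?_
    have e1 : 1 / (2 : ℝ≥0∞).toReal - 1 / (q : ℝ≥0∞).toReal = 1 / (n : ℝ) := by
      rw [ENNReal.toReal_ofNat, ENNReal.coe_toReal, one_div (q : ℝ), hq]
      ring
    rw [e1, Measure.restrict_apply_univ, ← ENNReal.ofReal_rpow_of_nonneg hv (by positivity)]
    gcongr
    exact (measure_mono (inter_subset_inter_left _ (ball_subset_ball hab.le))).trans hv2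
  have h6 : ENNReal.ofReal (excess w x₀ k a) ≤ _ :=
    (ofReal_ltwo (memLp_excess hw hw2 k a)).le.trans ((h4.trans h5).trans (mul_le_mul_left h1 _))
  have h7 : 0 ≤ ltwo volume (fun x => max (w x - k) 0 • gradient η x) +
      ltwo volume ({x | k ≤ w x}.indicator fun x => η x * f x) :=
    add_nonneg (ltwo_nonneg _) (ltwo_nonneg _)
  rw [← ENNReal.ofReal_mul (by positivity), ENNReal.ofReal_le_ofReal_iff (by positivity)] at h6
  refine h6.trans ?_
  rw [mul_comm]
  gcongr

end OneStep

section DeGiorgi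

open Filter Topology

variable {E : Type*} [NormedAddCommGroup E] [InnerProductSpace ℝ E] [FiniteDimensional ℝ E]
  [MeasurableSpace E] [BorelSpace E]

/-- The distribution function of `f` on `B`. -/
def distribution (f : E → ℝ) (B : Set E) (lam : ℝ) : ℝ≥0∞ := volume {x | x ∈ B ∧ lam < ‖f x‖}

theorem antitone_distribution (f : E → ℝ) (B : Set E) : Antitone (distribution f B) :=
  fun _ _ h => measure_mono fun _ hx => ⟨hx.1, h.trans_lt hx.2⟩

/-- The `L(n,1)` functional, for a real exponent. -/
def lorentzIntegral (f : E → ℝ) (B : Set E) (n : ℝ) : ℝ≥0∞ :=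
  ∫⁻ lam in Ioi (0 : ℝ), distribution f B lam ^ (1 / n)

/-- Bound for the `L²` norm of `f` on subsets of `B` of measure at most `v`. -/
def truncatedLorentz (f : E → ℝ) (B : Set E) (v : ℝ) : ℝ≥0∞ :=
  ∫⁻ lam in Ioi (0 : ℝ), (min (distribution f B lam) (ENNReal.ofReal v)) ^ (2⁻¹ : ℝ)

theorem eLpNorm_indicator_le_truncatedLorentz {f : E → ℝ} (hf : Measurable f) {B S : Set E}
    (hS : MeasurableSet S) (hSB : S ⊆ B) {v : ℝ} (hv : volume S ≤ ENNReal.ofReal v) :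
    eLpNorm (S.indicator f) 2 volume ≤ 2 * truncatedLorentz f B v := by
  rw [eLpNorm_indicator_eq_eLpNorm_restrict hS]
  refine (eLpNorm_two_le hf).trans ?_
  unfold truncatedLorentz
  gcongr with lam
  refine le_min ?_ ?_
  · rw [Measure.restrict_apply' hS]
    exact measure_mono fun x hx => ⟨hSB hx.2, hx.1⟩
  · rw [Measure.restrict_apply' hS]
    exact (measure_mono inter_subset_right).trans hv

theorem sum_truncatedLorentz_le (f : E → ℝ) (B : Set E) {n : ℕ} (hn : 2 < n) {ρ : ℝ} (hρ : 0 < ρ)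
    (J : ℕ) : ∑ j ∈ Finset.range J, ENNReal.ofReal ((ρ / 2 ^ j) ^ (1 - (n : ℝ) / 2)) *
      truncatedLorentz f B ((ρ / 2 ^ j) ^ (n : ℝ)) ≤ 6 * lorentzIntegral f B n := by
  have hm : ∀ v, Measurable fun lam : ℝ =>
      (min (distribution f B lam) (ENNReal.ofReal v)) ^ (2⁻¹ : ℝ) := fun v =>
    ((antitone_distribution f B).measurable.min measurable_const).pow_const _
  unfold truncatedLorentz lorentzIntegral
  simp_rw [← lintegral_const_mul _ (hm _)]
  rw [← lintegral_finsetSum _ fun j _ => (hm _).const_mul _,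
    ← lintegral_const_mul _ ((antitone_distribution f B).measurable.pow_const _)]
  exact lintegral_mono fun lam => ENNReal.sum_rpow_mul_min_rpow_le hn _ hρ J

theorem truncatedLorentz_ne_top {f : E → ℝ} {B : Set E} {n : ℕ} (hn : 2 < n)
    (hL : lorentzIntegral f B n ≠ ⊤) {ρ : ℝ} (hρ : 0 < ρ) :
    truncatedLorentz f B (ρ ^ (n : ℝ)) ≠ ⊤ := by
  have h := sum_truncatedLorentz_le f B hn hρ 1
  simp only [Finset.range_one, Finset.sum_singleton, pow_zero, div_one] at h
  intro h0
  rw [h0, ENNReal.mul_top (by simpa using by positivity), top_le_iff] at h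
  exact ENNReal.mul_ne_top (by norm_num) hL h

theorem sum_toReal_truncatedLorentz_le {f : E → ℝ} {B : Set E} {n : ℕ} (hn : 2 < n)
    (hL : lorentzIntegral f B n ≠ ⊤) {ρ : ℝ} (hρ : 0 < ρ) (J : ℕ) :
    ∑ j ∈ Finset.range J, (ρ / 2 ^ j) ^ (1 - (n : ℝ) / 2) *
      (truncatedLorentz f B ((ρ / 2 ^ j) ^ (n : ℝ))).toReal ≤ 6 * (lorentzIntegral f B n).toReal := by
  have h := ENNReal.toReal_mono (ENNReal.mul_ne_top (by norm_num) hL)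
    (sum_truncatedLorentz_le f B hn hρ J)
  have h1 : ∀ j : ℕ, 0 < ρ / 2 ^ j := fun j => by positivity
  rw [ENNReal.toReal_sum fun j _ => ENNReal.mul_ne_top ENNReal.ofReal_ne_top
    (truncatedLorentz_ne_top hn hL (h1 j)), ENNReal.toReal_mul] at h
  refine (le_of_eq (Finset.sum_congr rfl fun j _ => ?_)).trans (h.trans (le_of_eq (by simp)))
  rw [ENNReal.toReal_mul, ENNReal.toReal_ofReal (by have := h1 j; positivity)]

theorem excess_recursion {n C M τ h d F Y X : ℝ} (hn : 0 < n) (hC : 0 ≤ C) (hM : 0 ≤ M)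
    (hτ : 0 < τ) (hτ2 : C * (4 * M + 1) * τ ≤ 2⁻¹ * 2 ^ (-(n / 2))) (hh : 0 < h) (hd : 0 < d)
    (hF : 0 ≤ F) (hY : Y ≤ τ ^ (n / 2) * d * h ^ (n / 2))
    (hX : X ≤ ((τ ^ (n / 2)) ^ 2 * h ^ n) ^ (1 / n) * (C * (4 * M / h * Y + F))) :
    X ≤ τ ^ (n / 2) * ((d + (τ ^ (n / 2))⁻¹ * (h ^ (1 - n / 2) * F)) / 2) * (h / 2) ^ (n / 2) := by
  have e1 : ((τ ^ (n / 2)) ^ 2 * h ^ n) ^ (1 / n) = τ * h := by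
    rw [← Real.rpow_natCast, ← Real.rpow_mul hτ.le, Nat.cast_ofNat, div_mul_cancel₀ _ two_ne_zero,
      ← Real.mul_rpow hτ.le hh.le, ← Real.rpow_mul (by positivity), mul_one_div_cancel hn.ne',
      Real.rpow_one]
  have e2 : (h / 2) ^ (n / 2) = h ^ (n / 2) * 2 ^ (-(n / 2)) := by
    rw [Real.div_rpow hh.le zero_le_two, Real.rpow_neg zero_le_two, div_eq_mul_inv]
  have e3 : h ^ (1 - n / 2) * h ^ (n / 2) = h := by
    rw [← Real.rpow_add hh, sub_add_cancel, Real.rpow_one]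
  set σ := τ ^ (n / 2) with hσ
  have hσ0 : 0 < σ := by positivity
  set P := h ^ (n / 2) with hP
  have hP0 : 0 < P := by positivity
  rw [e1] at hX
  calc X ≤ τ * h * (C * (4 * M / h * (σ * d * P) + F)) := hX.trans (by gcongr)
    _ = τ * C * (4 * M * (σ * d * P) + h * F) := by field_simp
    _ ≤ τ * C * ((4 * M + 1) * (σ * d * P) + (4 * M + 1) * (h * F)) := by
        refine mul_le_mul_of_nonneg_left (add_le_add (mul_le_mul_of_nonneg_right (by linarith)
          (by positivity)) (le_mul_of_one_le_left (by positivity) (by linarith))) (by positivity)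
    _ = (C * (4 * M + 1) * τ) * (σ * d * P + h * F) := by ring
    _ ≤ (2⁻¹ * 2 ^ (-(n / 2))) * (σ * d * P + h * F) := by gcongr
    _ = (2⁻¹ * 2 ^ (-(n / 2))) * (σ * d * P + (h ^ (1 - n / 2) * P) * F) := by rw [e3]
    _ = _ := by
        rw [e2]
        field_simp

theorem ae_le_of_forall_excess_le {w : E → ℝ} {x₀ : E} (hw : Measurable w)
    (hw2 : MemLp w 2 volume) {k s : ℝ} {ε : ℕ → ℝ} (hε : Tendsto ε atTop (𝓝 0))
    (h : ∀ j, excess w x₀ k s ≤ ε j) : ∀ᵐ x, x ∈ ball x₀ s → w x ≤ k := by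
  have h0 : excess w x₀ k s = 0 :=
    le_antisymm (ge_of_tendsto' hε h) (excess_nonneg _ _)
  have hm := memLp_excess (x₀ := x₀) hw hw2 k s
  have h1 : eLpNorm ((ball x₀ s).indicator fun x => max (w x - k) 0) 2 volume = 0 := by
    rw [← ofReal_ltwo hm]
    exact (congrArg ENNReal.ofReal h0).trans ENNReal.ofReal_zero
  rw [eLpNorm_eq_zero_iff hm.1 (by norm_num)] at h1
  filter_upwards [h1] with x hx hxs
  rw [indicator_of_mem hxs, Pi.zero_apply, max_eq_right_iff] at hx
  linarith

end DeGiorgi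

section Iteration

open Filter Topology

variable {E : Type*} [NormedAddCommGroup E] [InnerProductSpace ℝ E] [FiniteDimensional ℝ E]
  [MeasurableSpace E] [BorelSpace E]

theorem excess_step {n : ℕ} (hn : 2 < n) (hE : Module.finrank ℝ E = n) {w f : E → ℝ} {x₀ : E}
    {B : Set E} {κ C M τ : ℝ} (hw : Measurable w) (hw2 : MemLp w 2 volume) (hf : Measurable f)
    (hf2 : MemLp f 2 volume) (hC : 0 ≤ C) (hM : 0 ≤ M)
    (hcut : ∀ (x₀ : E) (a b : ℝ), 0 < a → a < b → ∃ η, IsCutoff η x₀ a b M)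
    (hest : SuperlevelEstimate w f B κ C) (hL : lorentzIntegral f B n ≠ ⊤)
    (hτ : 0 < τ) (hτ1 : τ ≤ 1) (hτ2 : C * (4 * M + 1) * τ ≤ 2⁻¹ * 2 ^ (-((n : ℝ) / 2)))
    {s h k d : ℝ} (hs : 0 < s) (hh : 0 < h) (hd : 0 < d) (hk : κ ≤ k)
    (hB : ball x₀ (s + h) ⊆ B)
    (hY : excess w x₀ k (s + h) ≤ τ ^ ((n : ℝ) / 2) * d * h ^ ((n : ℝ) / 2)) :
    excess w x₀ (k + d) (s + h / 2) ≤ τ ^ ((n : ℝ) / 2) * ((d + (τ ^ ((n : ℝ) / 2))⁻¹ *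
      (h ^ (1 - (n : ℝ) / 2) * (2 * truncatedLorentz f B (h ^ (n : ℝ))).toReal)) / 2) *
        (h / 2) ^ ((n : ℝ) / 2) := by
  obtain ⟨η, hη⟩ := hcut x₀ (s + h / 2) ((s + h / 2 + (s + h)) / 2) (by positivity) (by linarith)
  have hn0 : (0 : ℝ) < n := by positivity
  have hσ1 : τ ^ ((n : ℝ) / 2) ≤ 1 := Real.rpow_le_one hτ.le hτ1 (by positivity)
  have hsq : (h ^ ((n : ℝ) / 2)) ^ 2 = h ^ (n : ℝ) := by
    rw [← Real.rpow_natCast, ← Real.rpow_mul hh.le, Nat.cast_ofNat, div_mul_cancel₀ _ two_ne_zero]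
  set σ := τ ^ ((n : ℝ) / 2) with hσ
  have hσ0 : 0 < σ := by positivity
  set S := ball x₀ (s + h) ∩ {x | k + d ≤ w x} with hS
  have hSm : MeasurableSet S := measurableSet_ball.inter (measurableSet_le measurable_const hw)
  have hvol : volume S ≤ ENNReal.ofReal (σ ^ 2 * h ^ (n : ℝ)) := by
    refine (volume_superlevel_le hw hw2 hd).trans (ENNReal.ofReal_le_ofReal ?_)
    rw [← hsq, ← mul_pow]
    refine pow_le_pow_left₀ (div_nonneg (excess_nonneg _ _) hd.le) ?_ 2
    rw [div_le_iff₀ hd]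
    linarith
  have hvol' : volume S ≤ ENNReal.ofReal (h ^ (n : ℝ)) := by
    refine hvol.trans (ENNReal.ofReal_le_ofReal ?_)
    exact mul_le_of_le_one_left (by positivity) (pow_le_one₀ hσ0.le hσ1)
  have hF : ltwo volume (S.indicator f) ≤ (2 * truncatedLorentz f B (h ^ (n : ℝ))).toReal :=
    ENNReal.toReal_mono (ENNReal.mul_ne_top (by norm_num) (truncatedLorentz_ne_top hn hL hh))
      (eLpNorm_indicator_le_truncatedLorentz hf hSm (inter_subset_left.trans hB) hvol')
  have hX := excess_le_of_superlevelEstimate (x₀ := x₀) (hE ▸ hn) hw hw2 hf2 hC hM hest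
    (a := s + h / 2) (b := s + h) (by linarith) hη hB (k := k + d) (by linarith)
    (v := σ ^ 2 * h ^ (n : ℝ)) (by positivity) hvol
  rw [hE] at hX
  refine excess_recursion hn0 hC hM hτ hτ2 hh hd ENNReal.toReal_nonneg
    ((excess_mono hw hw2 (by linarith : k ≤ k + d) le_rfl).trans hY) (hX.trans ?_)
  have e : 2 * M / (s + h - (s + h / 2)) = 4 * M / h := by
    rw [show s + h - (s + h / 2) = h / 2 by ring, div_div_eq_mul_div]
    ring
  rw [e]
  gcongr

/-- De Giorgi iteration. -/
theorem ae_le_of_superlevelEstimate {n : ℕ} (hn : 2 < n) (hE : Module.finrank ℝ E = n) {C : ℝ}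
    (hC : 0 ≤ C) : ∃ A : ℝ, 0 < A ∧ ∀ (w f : E → ℝ) (x₀ : E) (s t κ : ℝ), 0 < s → s < t →
      Measurable w → MemLp w 2 volume → Measurable f → MemLp f 2 volume →
      SuperlevelEstimate w f (ball x₀ t) κ C → lorentzIntegral f (ball x₀ t) n ≠ ⊤ →
      ∀ D > 0, A * excess w x₀ κ t ≤ D * (t - s) ^ ((n : ℝ) / 2) →
      ∀ᵐ x, x ∈ ball x₀ s →
        w x ≤ κ + 2 * D + A * (lorentzIntegral f (ball x₀ t) n).toReal := by
  obtain ⟨M, hM, hcut⟩ := exists_isCutoff E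
  have hn0 : (0 : ℝ) < n := by positivity
  have hCM : 0 < C * (4 * M + 1) + 1 := by positivity
  set τ := min 1 (2⁻¹ * 2 ^ (-((n : ℝ) / 2)) / (C * (4 * M + 1) + 1)) with hτdef
  have hτ : 0 < τ := lt_min one_pos (by positivity)
  have hτ1 : τ ≤ 1 := min_le_left _ _
  have hτ2 : C * (4 * M + 1) * τ ≤ 2⁻¹ * 2 ^ (-((n : ℝ) / 2)) := by
    have h1 : (C * (4 * M + 1) + 1) * τ ≤ 2⁻¹ * 2 ^ (-((n : ℝ) / 2)) := by
      rw [← le_div_iff₀' hCM]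
      exact min_le_right _ _
    linarith
  have hσ1 : τ ^ ((n : ℝ) / 2) ≤ 1 := Real.rpow_le_one hτ.le hτ1 (by positivity)
  have hσ0 : 0 < τ ^ ((n : ℝ) / 2) := by positivity
  refine ⟨12 / τ ^ ((n : ℝ) / 2), by positivity, ?_⟩
  intro w f x₀ s t κ hs hst hw hw2 hf hf2 hest hL D hD hexc
  set σ := τ ^ ((n : ℝ) / 2) with hσ
  set ρ := t - s with hρdef
  have hρ : 0 < ρ := sub_pos.2 hst
  set L := (lorentzIntegral f (ball x₀ t) n).toReal with hLdef
  have hρj : ∀ j : ℕ, 0 < ρ / 2 ^ j := fun j => by positivity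
  set b : ℕ → ℝ := fun j => σ⁻¹ * ((ρ / 2 ^ j) ^ (1 - (n : ℝ) / 2) *
    (2 * truncatedLorentz f (ball x₀ t) ((ρ / 2 ^ j) ^ (n : ℝ))).toReal) with hb
  have hb0 : ∀ j, 0 ≤ b j := fun j => by
    have := hρj j
    positivity
  have hbsum : ∀ J, ∑ j ∈ Finset.range J, b j ≤ 12 / σ * L := fun J => by
    have := sum_toReal_truncatedLorentz_le hn hL hρ J
    calc ∑ j ∈ Finset.range J, b j
        = 2 * σ⁻¹ * ∑ j ∈ Finset.range J, (ρ / 2 ^ j) ^ (1 - (n : ℝ) / 2) *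
          (truncatedLorentz f (ball x₀ t) ((ρ / 2 ^ j) ^ (n : ℝ))).toReal := by
          rw [Finset.mul_sum]
          refine Finset.sum_congr rfl fun j _ => ?_
          simp only [hb, ENNReal.toReal_mul, ENNReal.toReal_ofNat]
          ring
      _ ≤ 2 * σ⁻¹ * (6 * L) := by gcongr
      _ = 12 / σ * L := by ring
  obtain ⟨d, hd0, hd1, hdpos, hdsum⟩ := exists_dyadic_levels hD hb0
  have key : ∀ j, excess w x₀ (κ + ∑ i ∈ Finset.range j, d i) (s + ρ / 2 ^ j) ≤
      σ * d j * (ρ / 2 ^ j) ^ ((n : ℝ) / 2) := by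
    intro j
    induction j with
    | zero =>
      simp only [Finset.range_zero, Finset.sum_empty, add_zero, pow_zero, div_one, hd0]
      rw [show s + ρ = t by simp [hρdef]]
      have h1 : 12 * excess w x₀ κ t ≤ σ * (D * ρ ^ ((n : ℝ) / 2)) := by
        have := mul_le_mul_of_nonneg_left hexc hσ0.le
        rwa [← mul_assoc, mul_div_cancel₀ _ hσ0.ne'] at this
      have h2 := excess_nonneg (w := w) (x₀ := x₀) κ t
      linarith
    | succ j ih =>
      have h2 : ρ / 2 ^ j ≤ ρ := div_le_self hρ.le (one_le_pow₀ one_le_two)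
      have := excess_step hn hE hw hw2 hf hf2 hC hM.le hcut hest hL hτ hτ1 hτ2 hs (hρj j)
        (hdpos j) (le_add_of_nonneg_right (Finset.sum_nonneg fun i _ => (hdpos i).le))
        (ball_subset_ball (by linarith)) ih
      rw [Finset.sum_range_succ, hd1, pow_succ, ← div_div, ← add_assoc]
      exact this
  have hup : ∀ j, ∑ i ∈ Finset.range j, d i + 2 * d j ≤ 2 * D + 12 / σ * L := fun j =>
    (hdsum j).le.trans (by linarith [hbsum j])
  refine ae_le_of_forall_excess_le hw hw2
    (ε := fun j => (2 * D + 12 / σ * L) * (ρ / 2 ^ j) ^ ((n : ℝ) / 2)) ?_ fun j => ?_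
  · have h1 : Tendsto (fun j : ℕ => ρ / 2 ^ j) atTop (𝓝 0) := by
      have := (tendsto_pow_atTop_nhds_zero_of_lt_one (by norm_num : (0 : ℝ) ≤ 2⁻¹)
        (by norm_num)).const_mul ρ
      simpa [div_eq_mul_inv] using this
    have h2 := (h1.rpow_const (p := (n : ℝ) / 2) (Or.inr (by positivity))).const_mul
      (2 * D + 12 / σ * L)
    rwa [Real.zero_rpow (by positivity), mul_zero] at h2
  · have hdj := hdpos j
    have hsum0 : 0 ≤ ∑ i ∈ Finset.range j, d i := Finset.sum_nonneg fun i _ => (hdpos i).le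
    refine (excess_mono hw hw2 (by linarith [hup j] : κ + ∑ i ∈ Finset.range j, d i ≤ _)
      (by linarith [hρj j] : s ≤ s + ρ / 2 ^ j)).trans ((key j).trans ?_)
    refine mul_le_mul_of_nonneg_right ?_ (by have := hρj j; positivity)
    exact (mul_le_of_le_one_left hdj.le hσ1).trans (by linarith [hup j])

end Iteration

section GradientDecay

open Filter Topology

variable {E : Type*} [NormedAddCommGroup E] [InnerProductSpace ℝ E] [FiniteDimensional ℝ E]
  [MeasurableSpace E] [BorelSpace E]

/-- `G` is an `L²` limit of gradients and solves `-div (|G|^(p-2) G) = f` weakly in `B`. -/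
structure IsWeakSolution (p : ℝ) (G : E → E) (f : E → ℝ) (B : Set E) : Prop where
  measurable : Measurable G
  memLp : MemLp G 2 volume
  measurable_datum : Measurable f
  memLp_datum : MemLp f 2 volume
  exists_testFunction : ∀ δ > 0, ∃ φ, IsTestFunction φ ∧
    ltwo volume (fun x => gradient φ x - G x) ≤ δ
  integral_eq : ∀ ψ, IsTestFunction ψ → tsupport ψ ⊆ B →
    ∫ x, inner ℝ (pField p (G x)) (gradient ψ x) = ∫ x, f x * ψ x

variable {p : ℝ} {G : E → E} {f : E → ℝ} {B : Set E}

theorem IsWeakSolution.mono (h : IsWeakSolution p G f B) {B' : Set E} (hB : B' ⊆ B) :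
    IsWeakSolution p G f B' :=
  { h with integral_eq := fun ψ hψ hψB => h.integral_eq ψ hψ (hψB.trans hB) }

theorem pField_smul {N : ℝ} (hN : 0 < N) (z : E) :
    pField p (N • z) = N ^ (p - 1) • pField p z := by
  unfold pField
  rw [norm_smul, Real.norm_of_nonneg hN.le, Real.mul_rpow hN.le (norm_nonneg _), smul_smul,
    smul_smul, mul_right_comm, show p - 1 = p - 2 + 1 by ring, Real.rpow_add_one hN.ne']

theorem IsWeakSolution.smul (h : IsWeakSolution p G f B) {N : ℝ} (hN : 0 < N) :
    IsWeakSolution p (fun x => N • G x) (fun x => N ^ (p - 1) * f x) B where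
  measurable := h.measurable.const_smul N
  memLp := h.memLp.const_smul N
  measurable_datum := h.measurable_datum.const_mul _
  memLp_datum := h.memLp_datum.const_mul _
  exists_testFunction δ hδ := by
    obtain ⟨φ, hφ, hφδ⟩ := h.exists_testFunction (δ / N) (by positivity)
    refine ⟨fun x => N * φ x, hφ.const_mul N, ?_⟩
    have e : (fun x => gradient (fun y => N * φ y) x - N • G x) =
        fun x => N • (gradient φ x - G x) := by
      funext x
      rw [smul_sub]
      congr 1
      have hd : DifferentiableAt ℝ φ x := hφ.contDiff.differentiable one_ne_zero x
      unfold gradient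
      rw [fderiv_const_mul hd]
      simp
    rw [e, ltwo_smul, abs_of_pos hN]
    calc N * _ ≤ N * (δ / N) := by gcongr
      _ = δ := by field_simp
  integral_eq ψ hψ hψB := by
    simp_rw [pField_smul hN, real_inner_smul_left, mul_assoc]
    rw [integral_const_mul, integral_const_mul, h.integral_eq ψ hψ hψB]

theorem lorentzIntegral_mono {n : ℕ} {B' : Set E} (hB : B' ⊆ B) :
    lorentzIntegral f B' n ≤ lorentzIntegral f B n := by
  unfold lorentzIntegral distribution
  gcongr

theorem lorentzIntegral_const_mul {n : ℝ} {a : ℝ} (ha : 0 < a) :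
    lorentzIntegral (fun x => a * f x) B n = ENNReal.ofReal a * lorentzIntegral f B n := by
  have e : ∀ lam, distribution (fun x => a * f x) B lam = distribution f B (a⁻¹ * lam) := by
    intro lam
    unfold distribution
    congr 1
    ext x
    simp only [mem_ofPred_eq, norm_mul, Real.norm_of_nonneg ha.le, inv_mul_lt_iff₀ ha]
  unfold lorentzIntegral
  simp_rw [e]
  have himg : (fun x : ℝ => a * x) '' Ioi 0 = Ioi 0 := by
    rw [image_const_mul_Ioi_zero ha]
  rw [← lintegral_const_mul _ ((antitone_distribution f B).measurable.pow_const _)]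
  nth_rewrite 1 [← himg]
  rw [lintegral_image_eq_lintegral_abs_deriv_mul (f := fun x => a * x) (f' := fun _ => a * 1)
    measurableSet_Ioi (fun x _ => ((hasDerivAt_id x).const_mul a).hasDerivWithinAt)
    (mul_right_injective₀ ha.ne').injOn]
  simp only [mul_one, abs_of_pos ha, inv_mul_cancel_left₀ ha.ne']

theorem IsWeakSolution.superlevelEstimate (hp : 1 < p) (hn : 0 < Module.finrank ℝ E)
    (hB : IsOpen B) (hBfin : volume B ≠ ⊤) (h : IsWeakSolution p G f B)
    (hG1 : ∀ᵐ x, x ∈ B → ‖G x‖ ≤ 1) {e : E} (he : ‖e‖ ≤ 1) {k₀ : ℝ} (hk₀ : 0 < k₀) (hk₁ : k₀ ≤ 1) :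
    SuperlevelEstimate (fun x => inner ℝ (G x) e) f B k₀
      (sobolevConst E * energyConst (ellLow p k₀) (ellUp p k₀)) :=
  fun _ hη hηB hη0 hη1 _ hk _ hq => eLpNorm_superlevel_le hp hB hBfin h.memLp_datum h.memLp
    h.measurable h.exists_testFunction hG1 h.integral_eq hη hηB hη0 hη1 he hk₀ hk₁ hk hn hq

theorem excess_inner_le {x₀ : E} {t θ : ℝ} (hp : 1 < p) (hG : Measurable G)
    (hG2 : MemLp G 2 volume) (hG1 : ∀ᵐ x, x ∈ ball x₀ t → ‖G x‖ ≤ 1) {e : E} (he : ‖e‖ ≤ 1)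
    (hθ : 0 < θ) : excess (fun x => inner ℝ (G x) e) x₀ θ t ≤
      √(θ ^ (-p) * ∫ x in ball x₀ t, ‖G x‖ ^ p) := by
  have hw : Measurable fun x => (inner ℝ (G x) e : ℝ) := hG.inner measurable_const
  have hw2 : MemLp (fun x => (inner ℝ (G x) e : ℝ)) 2 volume :=
    hG2.mono hw.aestronglyMeasurable (Eventually.of_forall fun x =>
      (norm_inner_le_norm _ _).trans (mul_le_of_le_one_right (norm_nonneg _) he))
  refine Real.le_sqrt_of_sq_le ?_
  unfold excess
  rw [ltwo_sq (memLp_excess hw hw2 θ t), ← integral_const_mul, ← integral_indicator measurableSet_ball]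
  refine integral_mono_of_nonneg (Eventually.of_forall fun x => by positivity) ?_ ?_
  · rw [integrable_indicator_iff measurableSet_ball]
    refine Integrable.const_mul ?_ _
    refine Integrable.mono' (g := fun _ => 1) (integrableOn_const measure_ball_lt_top.ne)
      (hG.norm.pow_const p).aestronglyMeasurable ?_
    rw [ae_restrict_iff' measurableSet_ball]
    filter_upwards [hG1] with x hx hxB
    rw [Real.norm_of_nonneg (by positivity)]
    exact Real.rpow_le_one (norm_nonneg _) (hx hxB) (by linarith)
  · filter_upwards [hG1] with x hx
    by_cases hxB : x ∈ ball x₀ t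
    · rw [indicator_of_mem hxB, indicator_of_mem hxB, Real.norm_eq_abs, sq_abs]
      have h1 : (inner ℝ (G x) e : ℝ) ≤ ‖G x‖ :=
        (real_inner_le_norm _ _).trans (mul_le_of_le_one_right (norm_nonneg _) he)
      rcases le_or_gt (inner ℝ (G x) e : ℝ) θ with h2 | h2
      · rw [max_eq_right (by linarith), sq, mul_zero]
        positivity
      · rw [max_eq_left (by linarith), Real.rpow_neg hθ.le, inv_mul_eq_div, ← Real.div_rpow
          (norm_nonneg _) hθ.le]
        have h3 : (inner ℝ (G x) e - θ : ℝ) ^ 2 ≤ 1 :=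
          pow_le_one₀ (by linarith) (by linarith [hx hxB])
        exact h3.trans (Real.one_le_rpow ((one_le_div hθ).2 (by linarith)) (by linarith))
    · rw [indicator_of_notMem hxB, indicator_of_notMem hxB]
      simp

theorem norm_le_of_forall_inner_le {n : ℕ} (b : OrthonormalBasis (Fin n) ℝ E) {z : E} {a : ℝ}
    (h : ∀ i, inner ℝ z (b i) ≤ a ∧ inner ℝ z (-b i) ≤ a) : ‖z‖ ≤ n * a := by
  calc ‖z‖ = ‖∑ i, inner ℝ (b i) z • b i‖ := by rw [b.sum_repr']
    _ ≤ ∑ i, ‖inner ℝ (b i) z • b i‖ := norm_sum_le _ _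
    _ ≤ ∑ _i : Fin n, a := by
        refine Finset.sum_le_sum fun i _ => ?_
        rw [norm_smul, b.norm_eq_one, mul_one, Real.norm_eq_abs, real_inner_comm, abs_le]
        have := h i
        rw [inner_neg_right] at this
        constructor <;> linarith
    _ = n * a := by simp

theorem IsWeakSolution.exists_decay {n : ℕ} (hn : 2 < n) (hE : Module.finrank ℝ E = n)
    (hp : 1 < p) {δ : ℝ} (hδ : 0 < δ) (hδ1 : δ ≤ 1) : ∃ K : ℝ, 0 < K ∧
      ∀ (G : E → E) (f : E → ℝ) (x₀ : E) (s t : ℝ), 0 < s → s < t →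
        IsWeakSolution p G f (ball x₀ t) → lorentzIntegral f (ball x₀ t) n ≠ ⊤ →
        (∀ᵐ x, x ∈ ball x₀ t → ‖G x‖ ≤ 1) →
        K * ∫ x in ball x₀ t, ‖G x‖ ^ p ≤ (t - s) ^ (n : ℝ) →
        K * (lorentzIntegral f (ball x₀ t) n).toReal ≤ 1 →
        ∀ᵐ x, x ∈ ball x₀ s → ‖G x‖ ≤ δ := by
  have hn0 : (0 : ℝ) < n := by positivity
  have hn1 : (2 : ℝ) < n := by exact_mod_cast hn
  set θ := δ / (4 * n) with hθdef
  have hθ : 0 < θ := by positivity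
  have hθ1 : θ ≤ 1 := (div_le_one (by positivity)).2 (by linarith)
  have hl : 0 < ellLow p θ := ellLow_pos hp hθ
  have hu : 0 ≤ ellUp p θ := zero_le_one.trans one_le_ellUp
  have hC : 0 ≤ energyConst (ellLow p θ) (ellUp p θ) := by
    unfold energyConst
    positivity
  obtain ⟨A, hA, hdg⟩ := ae_le_of_superlevelEstimate (E := E) hn hE
    (mul_nonneg (sobolevConst_nonneg (E := E)) hC)
  refine ⟨max (A ^ 2 * θ ^ (-p) / θ ^ 2) (A / θ), by positivity, ?_⟩
  intro G f x₀ s t hs hst h hL hG1 hI hLK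
  have hI0 : 0 ≤ ∫ x in ball x₀ t, ‖G x‖ ^ p := integral_nonneg fun x => by positivity
  have hfL : A * (lorentzIntegral f (ball x₀ t) n).toReal ≤ θ := by
    have h1 : A / θ * (lorentzIntegral f (ball x₀ t) n).toReal ≤ 1 :=
      (mul_le_mul_of_nonneg_right (le_max_right _ _) ENNReal.toReal_nonneg).trans hLK
    rwa [div_mul_eq_mul_div, div_le_one hθ] at h1
  have hIA : A * √(θ ^ (-p) * ∫ x in ball x₀ t, ‖G x‖ ^ p) ≤ θ * (t - s) ^ ((n : ℝ) / 2) := by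
    have hts : 0 < t - s := sub_pos.2 hst
    have hsq : ((t - s) ^ ((n : ℝ) / 2)) ^ 2 = (t - s) ^ (n : ℝ) := by
      rw [← Real.rpow_natCast, ← Real.rpow_mul hts.le, Nat.cast_ofNat,
        div_mul_cancel₀ _ two_ne_zero]
    refine le_of_sq_le_sq ?_ (by positivity)
    rw [mul_pow, mul_pow, Real.sq_sqrt (by positivity), hsq]
    have h1 : A ^ 2 * θ ^ (-p) / θ ^ 2 * ∫ x in ball x₀ t, ‖G x‖ ^ p ≤ (t - s) ^ (n : ℝ) :=
      (mul_le_mul_of_nonneg_right (le_max_left _ _) hI0).trans hI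
    rw [div_mul_eq_mul_div, div_le_iff₀ (by positivity)] at h1
    linarith
  have hdir : ∀ e : E, ‖e‖ ≤ 1 → ∀ᵐ x, x ∈ ball x₀ s → inner ℝ (G x) e ≤ 4 * θ := by
    intro e he
    have hw : Measurable fun x => (inner ℝ (G x) e : ℝ) := h.measurable.inner measurable_const
    have hw2 : MemLp (fun x => (inner ℝ (G x) e : ℝ)) 2 volume :=
      h.memLp.mono hw.aestronglyMeasurable (Eventually.of_forall fun x =>
        (norm_inner_le_norm _ _).trans (mul_le_of_le_one_right (norm_nonneg _) he))
    have hest := h.superlevelEstimate hp (by omega) isOpen_ball measure_ball_lt_top.ne hG1 he hθ hθ1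
    have := hdg (fun x => inner ℝ (G x) e) f x₀ s t θ hs hst hw hw2 h.measurable_datum
      h.memLp_datum hest hL θ hθ
      ((mul_le_mul_of_nonneg_left (excess_inner_le hp h.measurable h.memLp hG1 he hθ)
        hA.le).trans hIA)
    filter_upwards [this] with x hx hxs
    linarith [hx hxs]
  set b := (stdOrthonormalBasis ℝ E).reindex (finCongr hE) with hb
  have hall : ∀ᵐ x, ∀ i : Fin n, (x ∈ ball x₀ s → inner ℝ (G x) (b i) ≤ 4 * θ) ∧
      (x ∈ ball x₀ s → inner ℝ (G x) (-b i) ≤ 4 * θ) := by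
    rw [ae_all_iff]
    intro i
    exact (hdir (b i) (b.norm_eq_one i).le).and
      (hdir (-b i) (by rw [norm_neg, b.norm_eq_one]))
  filter_upwards [hall] with x hx hxs
  refine (norm_le_of_forall_inner_le b fun i => ⟨(hx i).1 hxs, (hx i).2 hxs⟩).trans (le_of_eq ?_)
  rw [hθdef]
  field_simp

end GradientDecay

section LocalBound

open Filter Topology

variable {E : Type*} [NormedAddCommGroup E] [InnerProductSpace ℝ E] [FiniteDimensional ℝ E]
  [MeasurableSpace E] [BorelSpace E] {p : ℝ}

theorem IsWeakSolution.exists_decay_of_le {n : ℕ} (hn : 2 < n) (hE : Module.finrank ℝ E = n)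
    (hp : 1 < p) {δ : ℝ} (hδ : 0 < δ) (hδ1 : δ ≤ 1) : ∃ K : ℝ, 0 < K ∧
      ∀ (G : E → E) (f : E → ℝ) (x₀ : E) (s t N : ℝ), 0 < s → s < t → 0 < N →
        IsWeakSolution p G f (ball x₀ t) → lorentzIntegral f (ball x₀ t) n ≠ ⊤ →
        (∀ᵐ x, x ∈ ball x₀ t → ‖G x‖ ≤ N) →
        K * ∫ x in ball x₀ t, ‖G x‖ ^ p ≤ N ^ p * (t - s) ^ (n : ℝ) →
        K * (lorentzIntegral f (ball x₀ t) n).toReal ≤ N ^ (p - 1) →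
        ∀ᵐ x, x ∈ ball x₀ s → ‖G x‖ ≤ δ * N := by
  obtain ⟨K, hK, h⟩ := IsWeakSolution.exists_decay hn hE hp hδ hδ1
  refine ⟨K, hK, fun G f x₀ s t N hs hst hN hG hL hGN hI hLN => ?_⟩
  have hN' : 0 < N⁻¹ := inv_pos.2 hN
  have hpow : 0 < N⁻¹ ^ (p - 1) := by positivity
  have hnorm : ∀ x, ‖N⁻¹ • G x‖ = N⁻¹ * ‖G x‖ := fun x => by
    rw [norm_smul, Real.norm_of_nonneg hN'.le]
  have hL' : lorentzIntegral (fun x => N⁻¹ ^ (p - 1) * f x) (ball x₀ t) n =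
      ENNReal.ofReal (N⁻¹ ^ (p - 1)) * lorentzIntegral f (ball x₀ t) n :=
    lorentzIntegral_const_mul hpow
  have := h (fun x => N⁻¹ • G x) (fun x => N⁻¹ ^ (p - 1) * f x) x₀ s t hs hst (hG.smul hN') ?_ ?_
    ?_ ?_
  · filter_upwards [this] with x hx hxs
    have := hx hxs
    rwa [hnorm, inv_mul_le_iff₀ hN, mul_comm] at this
  · rw [hL']
    exact ENNReal.mul_ne_top ENNReal.ofReal_ne_top hL
  · filter_upwards [hGN] with x hx hxs
    rw [hnorm, inv_mul_le_iff₀ hN, mul_one]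
    exact hx hxs
  · simp_rw [hnorm, Real.mul_rpow hN'.le (norm_nonneg _)]
    rw [integral_const_mul, Real.inv_rpow hN.le, mul_left_comm, inv_mul_le_iff₀ (by positivity)]
    exact hI
  · rw [hL', ENNReal.toReal_mul, ENNReal.toReal_ofReal hpow.le, Real.inv_rpow hN.le, mul_left_comm,
      inv_mul_le_iff₀ (by positivity), mul_one]
    exact hLN

theorem integrableOn_norm_rpow (hp : 0 < p) {G : E → E} (hG : Measurable G) {x₀ : E} {r Λ : ℝ}
    (hΛ : ∀ᵐ x, x ∈ ball x₀ r → ‖G x‖ ≤ Λ) :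
    IntegrableOn (fun x => ‖G x‖ ^ p) (ball x₀ r) := by
  refine Integrable.mono' (g := fun _ => Λ ^ p) (integrableOn_const measure_ball_lt_top.ne)
    (hG.norm.pow_const p).aestronglyMeasurable ?_
  rw [ae_restrict_iff' measurableSet_ball]
  filter_upwards [hΛ] with x hx hxB
  rw [Real.norm_of_nonneg (by positivity)]
  exact Real.rpow_le_rpow (norm_nonneg _) (hx hxB) hp.le

/-- The interior gradient bound for weak solutions with bounded gradient. -/
theorem IsWeakSolution.exists_gradient_bound {n : ℕ} (hn : 2 < n) (hE : Module.finrank ℝ E = n)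
    (hp : 1 < p) : ∃ K : ℝ, 0 < K ∧ ∀ (G : E → E) (f : E → ℝ) (x₀ : E) (r Λ : ℝ), 0 < r →
        IsWeakSolution p G f (ball x₀ r) → lorentzIntegral f (ball x₀ r) n ≠ ⊤ →
        (∀ᵐ x, x ∈ ball x₀ r → ‖G x‖ ≤ Λ) →
        ∀ᵐ x, x ∈ ball x₀ (r / 2) → ‖G x‖ ≤
          (K * (∫ x in ball x₀ r, ‖G x‖ ^ p) / r ^ (n : ℝ)) ^ (1 / p) +
          (K * (lorentzIntegral f (ball x₀ r) n).toReal) ^ (1 / (p - 1)) := by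
  have hp0 : 0 < p := by linarith
  have hp1 : 0 < p - 1 := by linarith
  have hn0 : (0 : ℝ) < n := by positivity
  set T : ℝ := 2 ^ ((n : ℝ) / p) with hT
  have hT1 : 1 < T := Real.one_lt_rpow one_lt_two (by positivity)
  have hT0 : 0 < T := one_pos.trans hT1
  have hTp : T ^ p = 2 ^ (n : ℝ) := by
    rw [hT, ← Real.rpow_mul zero_le_two, div_mul_cancel₀ _ hp0.ne']
  obtain ⟨K, hK, hdec⟩ := IsWeakSolution.exists_decay_of_le hn hE hp (inv_pos.2 hT0)
    (inv_le_one_of_one_le₀ hT1.le)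
  refine ⟨4 ^ (n : ℝ) * K, by positivity, fun G f x₀ r Λ hr hG hL hΛ => ?_⟩
  set I := ∫ x in ball x₀ r, ‖G x‖ ^ p with hI
  set L := (lorentzIntegral f (ball x₀ r) n).toReal with hLdef
  have hI0 : 0 ≤ I := integral_nonneg fun x => by positivity
  have hL0 : 0 ≤ L := ENNReal.toReal_nonneg
  have hX : 0 ≤ 4 ^ (n : ℝ) * K * I / r ^ (n : ℝ) := by positivity
  have hY : 0 ≤ 4 ^ (n : ℝ) * K * L := by positivity
  set Q := (4 ^ (n : ℝ) * K * I / r ^ (n : ℝ)) ^ (1 / p) +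
    (4 ^ (n : ℝ) * K * L) ^ (1 / (p - 1)) with hQ
  have hQ0 : 0 ≤ Q := by positivity
  have hQI : 4 ^ (n : ℝ) * K * I ≤ Q ^ p * r ^ (n : ℝ) := by
    rw [← div_le_iff₀ (by positivity)]
    calc _ = ((4 ^ (n : ℝ) * K * I / r ^ (n : ℝ)) ^ (1 / p)) ^ p := by
          rw [← Real.rpow_mul hX, one_div_mul_cancel hp0.ne', Real.rpow_one]
      _ ≤ Q ^ p := by
          gcongr
          exact le_add_of_nonneg_right (by positivity)
  have hQL : K * L ≤ Q ^ (p - 1) := by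
    calc K * L ≤ 4 ^ (n : ℝ) * (K * L) :=
          le_mul_of_one_le_left (by positivity) (Real.one_le_rpow (by norm_num) hn0.le)
      _ = ((4 ^ (n : ℝ) * K * L) ^ (1 / (p - 1))) ^ (p - 1) := by
          rw [← Real.rpow_mul hY, one_div_mul_cancel hp1.ne', Real.rpow_one, mul_assoc]
      _ ≤ Q ^ (p - 1) := by
          gcongr
          exact le_add_of_nonneg_left (by positivity)
  set Λ' := max Λ 1 with hΛ'
  have hΛ0 : 0 < Λ' := lt_max_of_lt_right one_pos
  set R : ℕ → ℝ := fun i => r * (1 - 2⁻¹ * 2⁻¹ ^ i) with hR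
  have hq : ∀ i : ℕ, (0 : ℝ) < 2⁻¹ ^ i := fun i => by positivity
  have hRr : ∀ i, R i ≤ r := fun i => by
    have := mul_pos hr (hq i)
    simp only [hR]
    linarith
  have key : ∀ j i : ℕ, ∀ᵐ x, x ∈ ball x₀ (R i) → ‖G x‖ ≤ max (T⁻¹ ^ j * Λ') (T ^ i * Q) := by
    intro j
    induction j with
    | zero =>
      intro i
      filter_upwards [hΛ] with x hx hxi
      rw [pow_zero, one_mul]
      exact (hx (ball_subset_ball (hRr i) hxi)).trans ((le_max_left _ _).trans (le_max_left _ _))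
    | succ j ih =>
      intro i
      set N := max (T⁻¹ ^ j * Λ') (T ^ (i + 1) * Q) with hN
      have hN0 : 0 < N := lt_max_of_lt_left (by positivity)
      have hNi : T ^ i * Q ≤ N := by
        refine le_trans ?_ (le_max_right _ _)
        gcongr
        · exact hT1.le
        · omega
      have hNQ : Q ≤ N := (le_mul_of_one_le_left hQ0 (one_le_pow₀ hT1.le)).trans hNi
      have hsub : ball x₀ (R (i + 1)) ⊆ ball x₀ r := ball_subset_ball (hRr _)
      have hdiff : R (i + 1) - R i = r * 4⁻¹ * 2⁻¹ ^ i := by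
        simp only [hR, pow_succ]
        ring
      have hRi : 0 < R i := by
        have : (2⁻¹ : ℝ) ^ i ≤ 1 := pow_le_one₀ (by norm_num) (by norm_num)
        simp only [hR]
        exact mul_pos hr (by linarith)
      have hmul : N ^ p * (R (i + 1) - R i) ^ (n : ℝ) ≥ K * I := by
        have e1 : (T ^ i * Q) ^ p * (R (i + 1) - R i) ^ (n : ℝ) =
            Q ^ p * r ^ (n : ℝ) * (4 ^ (n : ℝ))⁻¹ := by
          have h2 : ((2 : ℝ) ^ (n : ℝ)) ^ i * ((2⁻¹ : ℝ) ^ (n : ℝ)) ^ i = 1 := by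
            rw [← mul_pow, ← Real.mul_rpow (by norm_num) (by norm_num),
              mul_inv_cancel₀ two_ne_zero, Real.one_rpow, one_pow]
          rw [hdiff, Real.mul_rpow (by positivity) hQ0, Real.mul_rpow (by positivity)
            (by positivity), Real.mul_rpow hr.le (by norm_num), Real.inv_rpow (by norm_num),
            ← Real.rpow_natCast T, ← Real.rpow_mul hT0.le, mul_comm (i : ℝ) p,
            Real.rpow_mul hT0.le, hTp, Real.rpow_natCast _ i, ← Real.rpow_natCast 2⁻¹ i,
            ← Real.rpow_mul (by norm_num) (i : ℝ), mul_comm (i : ℝ) (n : ℝ),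
            Real.rpow_mul (by norm_num) (n : ℝ) (i : ℝ), Real.rpow_natCast _ i]
          linear_combination (Q ^ p * r ^ (n : ℝ) * (4 ^ (n : ℝ))⁻¹) * h2
        calc K * I = 4 ^ (n : ℝ) * K * I * (4 ^ (n : ℝ))⁻¹ := by field_simp
          _ ≤ Q ^ p * r ^ (n : ℝ) * (4 ^ (n : ℝ))⁻¹ := by gcongr
          _ = (T ^ i * Q) ^ p * (R (i + 1) - R i) ^ (n : ℝ) := e1.symm
          _ ≤ _ := by
            have : 0 ≤ R (i + 1) - R i := by rw [hdiff]; positivity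
            gcongr
      have hst : R i < R (i + 1) := by
        rw [← sub_pos, hdiff]
        positivity
      have hLsub : lorentzIntegral f (ball x₀ (R (i + 1))) n ≤ lorentzIntegral f (ball x₀ r) n :=
        lorentzIntegral_mono hsub
      have := hdec G f x₀ (R i) (R (i + 1)) N hRi hst hN0 (hG.mono hsub)
        (ne_top_of_le_ne_top hL hLsub) (ih (i + 1)) ?_ ?_
      · filter_upwards [this] with x hx hxi
        refine (hx hxi).trans (le_of_eq ?_)
        rw [hN, mul_max_of_nonneg _ _ (by positivity)]
        congr 1
        · ring
        · rw [pow_succ]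
          field_simp
      · refine le_trans ?_ hmul
        gcongr
        refine setIntegral_mono_set (integrableOn_norm_rpow hp0 hG.measurable hΛ)
          (Eventually.of_forall fun x => by positivity) hsub.eventuallyLE
      · refine le_trans ?_ (hQL.trans (Real.rpow_le_rpow hQ0 hNQ hp1.le))
        exact mul_le_mul_of_nonneg_left (ENNReal.toReal_mono hL hLsub) hK.le
  have hR0 : R 0 = r / 2 := by
    simp only [hR, pow_zero]
    ring
  have hall : ∀ᵐ x, ∀ j : ℕ, x ∈ ball x₀ (R 0) → ‖G x‖ ≤ max (T⁻¹ ^ j * Λ') (T ^ 0 * Q) :=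
    ae_all_iff.2 fun j => key j 0
  filter_upwards [hall] with x hx hxr
  have hlim : Tendsto (fun j : ℕ => max (T⁻¹ ^ j * Λ') (T ^ 0 * Q)) atTop (𝓝 (max (0 * Λ') Q)) := by
    have h1 := (tendsto_pow_atTop_nhds_zero_of_lt_one (inv_nonneg.2 hT0.le)
      (inv_lt_one_of_one_lt₀ hT1)).mul_const Λ'
    have h2 := h1.max (tendsto_const_nhds (x := T ^ 0 * Q))
    simpa using h2
  rw [zero_mul, max_eq_right hQ0] at hlim
  exact ge_of_tendsto' hlim fun j => hx j (hR0 ▸ hxr)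

end LocalBound

section Assembly

open Filter Topology

section Auxiliary

variable {E : Type*} [NormedAddCommGroup E] [InnerProductSpace ℝ E] [FiniteDimensional ℝ E]
  [MeasurableSpace E] [BorelSpace E]

theorem memLp_two_indicator_of_lorentzIntegral {f : E → ℝ} (hf : Measurable f) {B : Set E}
    (hB : MeasurableSet B) (hBfin : volume B ≠ ⊤) {n : ℕ} (hn : 2 < n)
    (hL : lorentzIntegral f B n ≠ ⊤) : MemLp (B.indicator f) 2 volume := by
  refine ⟨(hf.indicator hB).aestronglyMeasurable, ?_⟩
  set ρ := 1 + (volume B).toReal with hρ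
  have hV : 0 ≤ (volume B).toReal := ENNReal.toReal_nonneg
  have hρ0 : 0 < ρ := by positivity
  have hv : volume B ≤ ENNReal.ofReal (ρ ^ (n : ℝ)) := by
    rw [← ENNReal.ofReal_toReal hBfin]
    refine ENNReal.ofReal_le_ofReal ?_
    rw [Real.rpow_natCast]
    exact (le_add_of_nonneg_left zero_le_one).trans (le_self_pow₀ (by linarith) (by omega))
  refine (eLpNorm_indicator_le_truncatedLorentz hf hB Subset.rfl hv).trans_lt ?_
  exact (ENNReal.mul_ne_top (by norm_num) (truncatedLorentz_ne_top hn hL hρ0)).lt_top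

theorem lorentzIntegral_indicator {f : E → ℝ} {B : Set E} {n : ℝ} :
    lorentzIntegral (B.indicator f) B n = lorentzIntegral f B n := by
  have e : distribution (B.indicator f) B = distribution f B := by
    funext lam
    unfold distribution
    congr 1
    ext x
    simp +contextual [indicator_of_mem]
  unfold lorentzIntegral
  rw [e]

theorem gradient_add_const_mul {v ψ : E → ℝ} {x : E} (hv : DifferentiableAt ℝ v x)
    (hψ : DifferentiableAt ℝ ψ x) (t : ℝ) :
    gradient (fun y => v y + t * ψ y) x = gradient v x + t • gradient ψ x := by
  unfold gradient
  rw [fderiv_fun_add hv (hψ.const_mul t), fderiv_const_mul hψ, map_add]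
  simp

end Auxiliary

variable {n : ℕ} {Ω : Set (EuclideanSpace ℝ (Fin n))} {u f ψ : EuclideanSpace ℝ (Fin n) → ℝ}

theorem LocLipOn.add_const_mul (hu : LocLipOn Ω u) {C : ℝ≥0} (hψ : LipschitzWith C ψ) (t : ℝ) :
    LocLipOn Ω fun x => u x + t * ψ x := by
  intro K hK hKΩ
  obtain ⟨C', hC'⟩ := hu K hK hKΩ
  exact ⟨_, hC'.add (((lipschitzWith_smul t).comp hψ).lipschitzOnWith (s := K))⟩

theorem IsLocMinimizer.integral_le {Fi : EuclideanSpace ℝ (Fin n) → ℝ}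
    (hmin : IsLocMinimizer Ω Fi f u) (hu : LocLipOn Ω u) (hψ : IsTestFunction ψ)
    {x₀ : EuclideanSpace ℝ (Fin n)} {r : ℝ} (hB : closure (ball x₀ r) ⊆ Ω)
    (hψB : tsupport ψ ⊆ ball x₀ r) {v : EuclideanSpace ℝ (Fin n) → ℝ} {C : ℝ≥0}
    (hv : LipschitzWith C v) (hvu : EqOn v u (ball x₀ r)) (t : ℝ) :
    ∫ x in ball x₀ r, (Fi (gradient v x) - f x * v x) ≤
      ∫ x in ball x₀ r, (Fi (gradient v x + t • gradient ψ x) - f x * (v x + t * ψ x)) := by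
  obtain ⟨C', hC'⟩ := hψ.contDiff.lipschitzWith_of_hasCompactSupport hψ.compact one_ne_zero
  have hsupp : closure {x | u x + t * ψ x ≠ u x} ⊆ tsupport ψ := by
    refine closure_mono fun x hx => ?_
    contrapose! hx
    simp [Function.notMem_support.1 hx]
  have h := hmin (ball x₀ r) isOpen_ball isBounded_ball.isCompact_closure hB
    (fun x => u x + t * ψ x) (hu.add_const_mul hC' t)
    (hψ.compact.of_isClosed_subset isClosed_closure hsupp) (hsupp.trans hψB)
  refine (le_of_eq ?_).trans (h.trans (le_of_eq ?_))
  · refine setIntegral_congr_fun measurableSet_ball fun x hx => ?_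
    beta_reduce
    rw [gradient_eq_of_eqOn isOpen_ball hvu.symm hx, hvu hx]
  · refine setIntegral_congr_ae measurableSet_ball ?_
    filter_upwards [hv.ae_differentiableAt] with x hx hxB
    have hw : EqOn (fun x => u x + t * ψ x) (fun x => v x + t * ψ x) (ball x₀ r) :=
      fun y hy => by
        beta_reduce
        rw [hvu hy]
    rw [gradient_eq_of_eqOn isOpen_ball hw hxB, gradient_add_const_mul hx
      (hψ.contDiff.differentiable one_ne_zero x), hvu hxB]

theorem IsLocMinimizer.isWeakSolution (hn : 2 < n) {p : ℝ} (hp : 1 < p) (hf : Measurable f)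
    (hmin : IsLocMinimizer Ω (fun z => ‖z‖ ^ p / p) f u) (hu : LocLipOn Ω u)
    {x₀ : EuclideanSpace ℝ (Fin n)} {r : ℝ} (hB : closure (ball x₀ r) ⊆ Ω)
    (hL : lorentzIntegral f (ball x₀ r) n ≠ ⊤)
    {v : EuclideanSpace ℝ (Fin n) → ℝ} {C : ℝ≥0} (hv : LipschitzWith C v)
    (hvc : HasCompactSupport v) (hvu : EqOn v u (ball x₀ r)) :
    IsWeakSolution p (gradient v) ((ball x₀ r).indicator f) (ball x₀ r) := by
  have hf2 := memLp_two_indicator_of_lorentzIntegral hf (measurableSet_ball (x := x₀) (ε := r))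
    measure_ball_lt_top.ne hn hL
  refine ⟨measurable_gradient v, hv.memLp_gradient hvc, hf.indicator measurableSet_ball, hf2,
    fun δ hδ => hv.exists_testFunction_gradient hvc hδ, fun ψ hψ hψB => ?_⟩
  obtain ⟨M, hM⟩ := hψ.contDiff.lipschitzWith_of_hasCompactSupport hψ.compact one_ne_zero
  have hmemi : ∀ g : EuclideanSpace ℝ (Fin n) → ℝ, MemLp g 2 volume →
      IntegrableOn (fun x => f x * g x) (ball x₀ r) := fun g hg => by
    rw [← integrable_indicator_iff measurableSet_ball]
    refine (hf2.integrable_mul hg).congr (Eventually.of_forall fun x => ?_)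
    simp [indicator_mul_left]
  have : IsFiniteMeasure (volume.restrict (ball x₀ r)) :=
    isFiniteMeasure_restrict.2 measure_ball_lt_top.ne
  have key := integral_inner_pField_eq (ν := volume.restrict (ball x₀ r)) hp
    (measurable_gradient v) (measurable_gradient ψ)
    (Eventually.of_forall hv.norm_gradient_le) (Eventually.of_forall hM.norm_gradient_le)
    (hmemi v (hv.continuous.memLp_of_hasCompactSupport hvc)) (hmemi ψ hψ.memLp)
    (hmin.integral_le hu hψ hB hψB hv hvu)
  have hout : ∀ x, x ∉ ball x₀ r → x ∉ tsupport ψ := fun x hx h => hx (hψB h)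
  rw [setIntegral_eq_integral_of_forall_compl_eq_zero fun x hx => by
    rw [IsTestFunction.gradient_eq_zero (hout x hx), inner_zero_right]] at key
  rw [key, ← integral_indicator measurableSet_ball]
  simp only [indicator_mul_left]

end Assembly

/-- Optimal local Lipschitz estimate for the `p`-Dirichlet functional with
datum `f ∈ L(n,1)`: `‖Du‖_{L^∞(B/2)} ≤ c(⨍_B |Du|^p)^{1/p} + c‖f‖_{L(n,1)(B)}^{1/(p−1)}`. -/
theorem pLaplace_lipschitz_estimate (n : ℕ) (hn : 2 < n) (p : ℝ) (hp : 1 < p) :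
    ∃ c : ℝ, 0 < c ∧
      ∀ (Ω : Set (EuclideanSpace ℝ (Fin n))), IsOpen Ω →
      ∀ f : EuclideanSpace ℝ (Fin n) → ℝ, Measurable f → lorentzNorm Ω f < ⊤ →
      ∀ u : EuclideanSpace ℝ (Fin n) → ℝ, LocLipOn Ω u →
        IsLocMinimizer Ω (fun z => ‖z‖ ^ p / p) f u →
      ∀ (x₀ : EuclideanSpace ℝ (Fin n)) (r : ℝ), 0 < r → closure (ball x₀ r) ⊆ Ω →
        essSup (fun x => (‖gradient u x‖₊ : ℝ≥0∞)) (volume.restrict (ball x₀ (r / 2))) ≤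
          ENNReal.ofReal
            (c * (⨍ x in ball x₀ r, ‖gradient u x‖ ^ p) ^ (1 / p) +
              c * (lorentzNorm (ball x₀ r) f).toReal ^ (1 / (p - 1))) := by
  have hE : Module.finrank ℝ (EuclideanSpace ℝ (Fin n)) = n := finrank_euclideanSpace_fin
  obtain ⟨K, hK, hbound⟩ :=
    IsWeakSolution.exists_gradient_bound (E := EuclideanSpace ℝ (Fin n)) hn hE hp
  set ω := (volume (ball (0 : EuclideanSpace ℝ (Fin n)) 1)).toReal with hω
  have hω0 : 0 < ω :=
    ENNReal.toReal_pos (measure_ball_pos _ _ one_pos).ne' measure_ball_lt_top.ne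
  refine ⟨(K * ω) ^ (1 / p) + K ^ (1 / (p - 1)), by positivity, ?_⟩
  intro Ω _ f hf hfL u hu hmin x₀ r hr hB
  have hsub : ball x₀ r ⊆ Ω := subset_closure.trans hB
  have hL : lorentzIntegral f (ball x₀ r) n ≠ ⊤ :=
    ne_top_of_le_ne_top hfL.ne (lorentzIntegral_mono (f := f) hsub)
  obtain ⟨C, hC⟩ := hu (closedBall x₀ r) (isCompact_closedBall x₀ r)
    (closure_ball x₀ hr.ne' ▸ hB)
  obtain ⟨v, C', hv, hvc, hvu'⟩ := hC.exists_compactSupport_eqOn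
  have hvu : EqOn v u (ball x₀ r) := hvu'.mono ball_subset_closedBall
  have hgrad : ∀ x ∈ ball x₀ r, gradient u x = gradient v x := fun x hx =>
    gradient_eq_of_eqOn isOpen_ball hvu.symm hx
  have hmain := hbound (gradient v) _ x₀ r C' hr
    (hmin.isWeakSolution hn hp hf hu hB hL hv hvc hvu)
    (by rwa [lorentzIntegral_indicator]) (Filter.Eventually.of_forall fun x _ => hv.norm_gradient_le x)
  rw [lorentzIntegral_indicator] at hmain
  have hvol : volume.real (ball x₀ r) = r ^ (n : ℝ) * ω := by
    rw [measureReal_def, Measure.addHaar_ball_of_pos _ _ hr, hE, ENNReal.toReal_mul,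
      ENNReal.toReal_ofReal (by positivity), Real.rpow_natCast]
  have havg : K * (∫ x in ball x₀ r, ‖gradient v x‖ ^ p) / r ^ (n : ℝ) =
      K * ω * ⨍ x in ball x₀ r, ‖gradient u x‖ ^ p := by
    have hI : ∫ x in ball x₀ r, ‖gradient u x‖ ^ p = ∫ x in ball x₀ r, ‖gradient v x‖ ^ p :=
      setIntegral_congr_fun measurableSet_ball fun x hx => by
        beta_reduce
        rw [hgrad x hx]
    rw [setAverage_eq, hvol, smul_eq_mul, hI]
    field_simp
  have havg0 : 0 ≤ ⨍ x in ball x₀ r, ‖gradient u x‖ ^ p := by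
    rw [setAverage_eq]
    exact smul_nonneg (by positivity) (integral_nonneg fun x => by positivity)
  have hKω : 0 ≤ K * ω := by positivity
  rw [havg] at hmain
  refine essSup_le_of_ae_le _ ?_
  rw [Filter.EventuallyLE, ae_restrict_iff' measurableSet_ball]
  filter_upwards [hmain] with x hx hxr
  have hxB : x ∈ ball x₀ r := ball_subset_ball (by linarith) hxr
  change ‖gradient u x‖ₑ ≤ _
  rw [← ofReal_norm, hgrad x hxB]
  refine ENNReal.ofReal_le_ofReal ((hx hxr).trans (add_le_add ?_ ?_))
  · rw [Real.mul_rpow hKω havg0]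
    exact mul_le_mul_of_nonneg_right (le_add_of_nonneg_right (Real.rpow_nonneg hK.le _))
      (Real.rpow_nonneg havg0 _)
  · rw [Real.mul_rpow hK.le ENNReal.toReal_nonneg]
    exact mul_le_mul_of_nonneg_right (le_add_of_nonneg_left (Real.rpow_nonneg hKω _))
      (Real.rpow_nonneg ENNReal.toReal_nonneg _)
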